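/- arXiv:2210.02125 — 4 statements merged into one kernel-verified Lean document; each statement's English description precedes it below -/
import Mathlib

section
/- Let T and M be positive integers with T ≥ 2M, and let p be a real number with p > 2M − T − 1. Fix B ∈ ℂ^{T×M} with B^H B = I_M. If U is distributed according to the Haar probability measure μ on the unitary group U(T), then the p-th moment of the chordal product determinant det(I_M − B^H (UE)(UE)^H B) is ∫_{U(T)} det(I_M − B^H U E E^H U^H B)^p dμ(U) = ∏_{m=1}^{M} [Γ(T−m+1) Γ(T+p−m−M+1)] / [Γ(T−m−M+1) Γ(T+p−m+1)], where Γ is Euler's Gamma function. -/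
open Matrix MeasureTheory

noncomputable instance {m n : ℕ} : MeasureSpace (Matrix (Fin m) (Fin n) ℂ) := by
  unfold Matrix; infer_instance

/-- The `T × M` matrix whose columns are the first `M` standard basis vectors of `ℂ^T`. -/
def stdFrame (T M : ℕ) : Matrix (Fin T) (Fin M) ℂ :=
  Matrix.of fun i j => if (i : ℕ) = (j : ℕ) then 1 else 0


noncomputable def gc : Measure ℂ :=
  (volume : Measure ℂ).withDensity (fun z => ENNReal.ofReal (Real.pi⁻¹ * Real.exp (-‖z‖ ^ (2:ℝ))))

instance gc_prob : IsProbabilityMeasure gc := by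
  constructor
  have h := Complex.integral_exp_neg_rpow (p := 2) (by norm_num)
  have h2 : ∫ z : ℂ, Real.pi⁻¹ * Real.exp (-‖z‖ ^ (2:ℝ)) = 1 := by
    rw [integral_const_mul, h]
    norm_num [Real.Gamma_two]
  have hi : Integrable (fun z : ℂ => Real.pi⁻¹ * Real.exp (-‖z‖ ^ (2:ℝ))) := by
    by_contra hc
    rw [integral_undef hc] at h2
    norm_num at h2
  rw [gc, withDensity_apply _ MeasurableSet.univ, Measure.restrict_univ,
    ← ofReal_integral_eq_lintegral_ofReal hi, h2]
  · simp
  · filter_upwards with z; positivity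

theorem lintegral_fin_prod {n : ℕ} (μ : Fin n → Measure ℂ) [∀ i, SigmaFinite (μ i)]
    (f : Fin n → ℂ → ENNReal) (hf : ∀ i, Measurable (f i)) :
    ∫⁻ x : Fin n → ℂ, ∏ i, f i (x i) ∂(Measure.pi μ) = ∏ i, ∫⁻ x, f i x ∂(μ i) := by
  induction n with
  | zero => simp
  | succ n ih =>
    rw [← ((measurePreserving_piFinSuccAbove μ 0).symm).lintegral_comp_emb
      (MeasurableEquiv.measurableEmbedding _)]
    simp_rw [MeasurableEquiv.piFinSuccAbove_symm_apply, Fin.insertNthEquiv,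
            Fin.prod_univ_succ, Fin.insertNth_zero, Equiv.coe_fn_mk, Fin.cons_succ,
            Fin.zero_succAbove, cast_eq, Fin.cons_zero]
    rw [← ih _ _ (fun i => hf _)]
    exact lintegral_prod_mul (hf 0).aemeasurable
      (Finset.measurable_prod _ fun i _ => (hf _).comp (measurable_pi_apply i)).aemeasurable

/-- Standard complex Gaussian vector. -/
noncomputable def gv (n : ℕ) : Measure (Fin n → ℂ) := Measure.pi fun _ => gc

instance gv_prob (n : ℕ) : IsProbabilityMeasure (gv n) := by unfold gv; infer_instance

theorem gv_eq (n : ℕ) : gv n = (volume : Measure (Fin n → ℂ)).withDensity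
    (fun x => ENNReal.ofReal ((Real.pi⁻¹) ^ n * Real.exp (-∑ i, ‖x i‖ ^ 2))) := by
  refine Measure.pi_eq fun s hs => ?_
  have hm : ∀ i : Fin n, Measurable
    (fun z : ℂ => ENNReal.ofReal (Real.pi⁻¹ * Real.exp (-‖z‖ ^ (2:ℝ)))) := fun i => by fun_prop
  rw [withDensity_apply _ (MeasurableSet.univ_pi hs), volume_pi, Measure.restrict_pi_pi]
  have : ∀ x : Fin n → ℂ, ENNReal.ofReal ((Real.pi⁻¹) ^ n * Real.exp (-∑ i, ‖x i‖ ^ 2)) =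
      ∏ i, ENNReal.ofReal (Real.pi⁻¹ * Real.exp (-‖x i‖ ^ (2:ℝ))) := by
    intro x
    rw [← ENNReal.ofReal_prod_of_nonneg (fun i _ => by positivity), Finset.prod_mul_distrib,
      ← Real.exp_sum]
    simp
  simp_rw [this]
  rw [lintegral_fin_prod _ _ hm]
  simp_rw [gc]
  refine Finset.prod_congr rfl fun i _ => ?_
  rw [withDensity_apply _ (hs i)]

theorem gv_map_unitary {n : ℕ} (W : Matrix (Fin n) (Fin n) ℂ) (hW : W ∈ unitaryGroup (Fin n) ℂ) :
    (gv n).map (fun x => x ᵥ* W) = gv n := by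
  have hdet : ‖W.det‖ = 1 := by
    have := (Matrix.det_of_mem_unitary hW)
    exact CStarRing.norm_of_mem_unitary this
  have hdd : LinearMap.det ((Matrix.vecMulLinear W).restrictScalars ℝ) = 1 := by
    rw [LinearMap.det_restrictScalars, Algebra.norm_complex_apply]
    have : LinearMap.det (Matrix.vecMulLinear W) = W.det := by
      rw [← Matrix.det_transpose, ← LinearMap.det_toLin']
      congr 1
      ext x
      simp [Matrix.vecMulLinear, Matrix.vecMul]
    rw [this, Complex.normSq_eq_norm_sq, hdet]; norm_num
  have hvol : (volume : Measure (Fin n → ℂ)).map (fun x => x ᵥ* W) = volume := by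
    have := Measure.map_linearMap_addHaar_eq_smul_addHaar (volume : Measure (Fin n → ℂ))
      (f := (Matrix.vecMulLinear W).restrictScalars ℝ) (by rw [hdd]; norm_num)
    rw [hdd] at this
    simp only [inv_one, abs_one, ENNReal.ofReal_one, one_smul] at this
    exact this
  have hmeas : Measurable (fun x : Fin n → ℂ => x ᵥ* W) := by
    refine Continuous.measurable ?_
    fun_prop
  have hns : ∀ x : Fin n → ℂ, ∑ i, ‖(x ᵥ* W) i‖ ^ 2 = ∑ i, ‖x i‖ ^ 2 := by
    intro x
    have h1 : ∀ y : Fin n → ℂ, ((∑ i, ‖y i‖ ^ 2 : ℝ) : ℂ) = y ⬝ᵥ star y := by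
      intro y
      simp [dotProduct, Complex.mul_conj, Complex.normSq_eq_norm_sq]
    have h2 : (x ᵥ* W) ⬝ᵥ star (x ᵥ* W) = x ⬝ᵥ star x := by
      rw [Matrix.star_vecMul, ← Matrix.dotProduct_mulVec, Matrix.mulVec_mulVec,
        ← Matrix.star_eq_conjTranspose, (Matrix.mem_unitaryGroup_iff).1 hW, Matrix.one_mulVec]
    rw [← h1, ← h1] at h2
    exact_mod_cast h2
  have hg : Measurable fun x : Fin n → ℂ =>
    ENNReal.ofReal ((Real.pi⁻¹) ^ n * Real.exp (-∑ i, ‖x i‖ ^ 2)) := by fun_prop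
  ext s hs
  rw [Measure.map_apply hmeas hs, gv_eq, withDensity_apply _ hs, withDensity_apply _ (hmeas hs)]
  conv_rhs => rw [← hvol, setLIntegral_map hs hg hmeas]
  simp_rw [hns]

theorem gv_comp {k n : ℕ} (f : Fin k → Fin n) (hf : Function.Injective f) :
    (gv n).map (fun x => x ∘ f) = gv k := by
  refine (Measure.pi_eq fun s hs => ?_).symm
  have hm : Measurable (fun x : Fin n → ℂ => x ∘ f) :=
    measurable_pi_lambda _ fun i => measurable_pi_apply _
  rw [Measure.map_apply hm (MeasurableSet.univ_pi hs)]
  classical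
  have : (fun x : Fin n → ℂ => x ∘ f) ⁻¹' (Set.univ.pi s) =
      Set.univ.pi (fun j => ⋂ i, ⋂ (_ : f i = j), s i) := by
    ext x
    simp only [Set.mem_preimage, Set.mem_pi, Set.mem_univ, Function.comp, Set.mem_iInter,
      true_implies]
    constructor
    · rintro h j i rfl; exact h i
    · intro h i; exact h _ i rfl
  rw [this, gv, Measure.pi_pi]
  rw [← Finset.prod_subset (Finset.subset_univ (Finset.univ.image f)), Finset.prod_image
    (fun _ _ _ _ h => hf h)]
  · refine Finset.prod_congr rfl fun i _ => ?_
    congr 1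
    ext z
    simp only [Set.mem_iInter]
    exact ⟨fun h => h i rfl, fun h j hj => by rwa [hf hj]⟩
  · intro j _ hj
    have : (⋂ i, ⋂ (_ : f i = j), s i) = Set.univ := by
      refine Set.eq_univ_of_forall fun z => ?_
      simp only [Set.mem_iInter]
      intro i hi
      exact absurd (Finset.mem_image.2 ⟨i, Finset.mem_univ _, hi⟩) hj
    rw [this, measure_univ]

theorem radial_aux (n : ℕ) (hn : 0 < n) : ∃ c : ℝ, 0 ≤ c ∧ ∀ p : ℝ, 0 < n + p →
    ∫⁻ x, ENNReal.ofReal ((∑ i, ‖x i‖ ^ 2) ^ p) ∂(gv n) = ENNReal.ofReal (c * Real.Gamma (n + p)) := by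
  let e := (PiLp.continuousLinearEquiv 2 ℝ (fun _ : Fin n => ℂ)).symm
  let ν : Measure (EuclideanSpace ℂ (Fin n)) := (volume : Measure (Fin n → ℂ)).map e
  have : ν.IsAddHaarMeasure := ContinuousLinearEquiv.isAddHaarMeasure_map e _
  have : Nonempty (Fin n) := ⟨⟨0, hn⟩⟩
  have hdim : Module.finrank ℝ (EuclideanSpace ℂ (Fin n)) = 2 * n := by
    rw [← LinearEquiv.finrank_eq e.toLinearEquiv, Module.finrank_pi_fintype]
    simp [mul_comm]
  refine ⟨Real.pi⁻¹ ^ n * ν.real (Metric.ball 0 1) * n, by positivity, fun p hp => ?_⟩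
  let g : ℝ → ℝ := fun r => Real.pi⁻¹ ^ n * (Real.exp (-r^2) * (r^2)^p)
  have key : ∀ y ∈ Set.Ioi (0:ℝ), y ^ (Module.finrank ℝ (EuclideanSpace ℂ (Fin n)) - 1) • g y
      = Real.pi⁻¹ ^ n * (y ^ (2 * (n:ℝ) - 1 + 2 * p) * Real.exp (-y ^ (2:ℝ))) := by
    intro y hy
    have hy : 0 < y := hy
    rw [hdim, Real.rpow_add hy, Real.rpow_mul hy.le]
    have : y ^ (2 * (n:ℝ) - 1) = y ^ (2 * n - 1) := by
      rw [← Real.rpow_natCast]; congr 1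
      rw [Nat.cast_sub (by omega)]; push_cast; ring
    rw [this]
    simp only [g, smul_eq_mul, Real.rpow_two]
    ring
  have hIntg : Integrable (fun x : EuclideanSpace ℂ (Fin n) => g ‖x‖) ν := by
    rw [integrable_fun_norm_addHaar]
    rw [integrableOn_congr_fun key measurableSet_Ioi]
    refine Integrable.const_mul ?_ _
    exact integrableOn_rpow_mul_exp_neg_rpow (by linarith) (by norm_num)
  have hval : ∫ x : EuclideanSpace ℂ (Fin n), g ‖x‖ ∂ν =
      Real.pi⁻¹ ^ n * ν.real (Metric.ball 0 1) * n * Real.Gamma (n + p) := by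
    rw [integral_fun_norm_addHaar, setIntegral_congr_fun measurableSet_Ioi key,
      integral_const_mul, integral_rpow_mul_exp_neg_rpow (by norm_num) (by linarith), hdim]
    simp only [smul_eq_mul, nsmul_eq_mul]
    have : (2 * (n:ℝ) - 1 + 2 * p + 1) / 2 = n + p := by ring
    rw [this]; push_cast; ring
  rw [← hval, ofReal_integral_eq_lintegral_ofReal hIntg]
  · rw [gv_eq, lintegral_withDensity_eq_lintegral_mul _ (by fun_prop) (by fun_prop)]
    have he : Measurable e := e.continuous.measurable
    have hgm : Measurable fun x : EuclideanSpace ℂ (Fin n) => ENNReal.ofReal (g ‖x‖) := by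
      simp only [g]; fun_prop
    rw [lintegral_map hgm he]
    refine lintegral_congr fun x => ?_
    have : ‖e x‖ ^ 2 = ∑ i, ‖x i‖ ^ 2 := by
      rw [EuclideanSpace.norm_sq_eq]; rfl
    simp only [g, Pi.mul_apply]
    rw [this, ← ENNReal.ofReal_mul (by positivity)]
    congr 1; ring
  · filter_upwards with x
    simp only [g]; positivity

theorem radial (n : ℕ) (hn : 0 < n) (p : ℝ) (hp : 0 < n + p) :
    ∫⁻ x, ENNReal.ofReal ((∑ i, ‖x i‖ ^ 2) ^ p) ∂(gv n)
      = ENNReal.ofReal (Real.Gamma (n + p) / Real.Gamma n) := by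
  obtain ⟨c, hc, h⟩ := radial_aux n hn
  rw [h p hp]
  have hn' : (0:ℝ) < n := by exact_mod_cast hn
  have h0 := h 0 (by simpa using hn')
  simp only [Real.rpow_zero, ENNReal.ofReal_one, lintegral_const, measure_univ, mul_one,
    add_zero] at h0
  have h1 : c * Real.Gamma n = 1 := by
    rw [eq_comm, ENNReal.ofReal_eq_one] at h0; exact h0
  have hG := Real.Gamma_pos_of_pos hn'
  congr 1
  rw [eq_div_iff hG.ne']
  linear_combination Real.Gamma (n + p) * h1

theorem mul_stdFrame {k N : ℕ} (_h : k ≤ N) (R : Matrix (Fin k) (Fin k) ℂ) (i : Fin k) (j : Fin N) :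
    (R * (stdFrame N k)ᴴ) i j = if hj : (j : ℕ) < k then R i ⟨j, hj⟩ else 0 := by
  rw [Matrix.mul_apply]
  split_ifs with hj
  · rw [Finset.sum_eq_single ⟨j, hj⟩]
    · simp [stdFrame]
    · intro b _ hb
      have : ¬ ((j:ℕ) = b) := fun h => hb (Fin.ext h.symm)
      simp [stdFrame, this]
    · simp
  · refine Finset.sum_eq_zero fun b _ => ?_
    have : ¬ ((j:ℕ) = b) := fun h => hj (h ▸ b.2)
    simp [stdFrame, this]

theorem stdFrame_isom {k N : ℕ} (h : k ≤ N) : (stdFrame N k)ᴴ * stdFrame N k = 1 := by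
  ext i j
  have := mul_stdFrame h (1 : Matrix (Fin k) (Fin k) ℂ)
  simp only [Matrix.one_mul] at this
  rw [Matrix.mul_apply, Finset.sum_eq_single ⟨j, lt_of_lt_of_le j.2 h⟩]
  · rw [this]; simp [stdFrame]
  · intro b _ hb
    have : ¬ ((b:ℕ) = j) := fun h => hb (Fin.ext h)
    simp [stdFrame, this]
  · simp

theorem qr_exists {k N : ℕ} (h : k ≤ N) (H : Matrix (Fin k) (Fin N) ℂ) :
    ∃ R : Matrix (Fin k) (Fin k) ℂ, ∃ W ∈ unitaryGroup (Fin N) ℂ,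
      H = R * (stdFrame N k)ᴴ * W := by
  let f : Fin N → EuclideanSpace ℂ (Fin N) := fun j =>
    if hj : (j : ℕ) < k then WithLp.toLp 2 (H ⟨j, hj⟩) else 0
  let b := InnerProductSpace.gramSchmidtOrthonormalBasis (𝕜 := ℂ)
    (by simp : Module.finrank ℂ (EuclideanSpace ℂ (Fin N)) = Fintype.card (Fin N)) f
  have hb : ∀ i j, i < j → inner ℂ (b j) (f i) = 0 := fun i j hij =>
    InnerProductSpace.gramSchmidtOrthonormalBasis_inv_triangular _ f hij
  refine ⟨Matrix.of fun i j => inner ℂ (b (Fin.castLE h j)) (f (Fin.castLE h i)),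
    Matrix.of fun j a => b j a, ?_, ?_⟩
  · rw [Matrix.mem_unitaryGroup_iff]
    ext i j
    have := orthonormal_iff_ite.1 b.orthonormal j i
    rw [Matrix.one_apply]
    rw [PiLp.inner_apply] at this
    simp only [Matrix.mul_apply, Matrix.star_apply, Matrix.of_apply]
    simp only [RCLike.inner_apply] at this
    simp only [eq_comm (a := i)]
    exact this
  · ext i a
    have hs := b.sum_repr' (f (Fin.castLE h i))
    have hf : f (Fin.castLE h i) = WithLp.toLp 2 (H i) := by simp [f]
    have h2 := congrArg (fun v : EuclideanSpace ℂ (Fin N) => v a) hs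
    have h3 : f (Fin.castLE h i) a = H i a := by rw [hf]
    simp only at h2
    rw [h3] at h2
    rw [← h2, Matrix.mul_apply]
    simp only [mul_stdFrame h, Matrix.of_apply, WithLp.ofLp_sum, WithLp.ofLp_smul,
      Finset.sum_apply, Pi.smul_apply, smul_eq_mul]
    refine Finset.sum_congr rfl fun j _ => ?_
    split_ifs with hj
    · rfl
    · rw [hb _ _ (by rw [Fin.lt_def]; simp; omega)]

/-- The Gram determinant of the rows. -/
noncomputable def gd {k N : ℕ} (H : Fin k → Fin N → ℂ) : ℝ :=
  ((Matrix.of H * (Matrix.of H)ᴴ).det).re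

theorem det_self_re {k : ℕ} (R : Matrix (Fin k) (Fin k) ℂ) : (R * Rᴴ).det = ((‖R.det‖ ^ 2 : ℝ) : ℂ) := by
  rw [Matrix.det_mul, Matrix.det_conjTranspose, ← Complex.normSq_eq_norm_sq, ← Complex.mul_conj]
  rfl

open scoped ComplexOrder in
theorem gd_nonneg {k N : ℕ} (H : Fin k → Fin N → ℂ) : 0 ≤ gd H :=
  (Complex.le_def.1 (Matrix.posSemidef_self_mul_conjTranspose (Matrix.of H)).det_nonneg).1

theorem gd_continuous {k N : ℕ} : Continuous (gd : (Fin k → Fin N → ℂ) → ℝ) := by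
  unfold gd
  refine Complex.continuous_re.comp (Continuous.matrix_det ?_)
  exact Continuous.matrix_mul continuous_id (Continuous.matrix_conjTranspose continuous_id)

theorem gd_mul {k N : ℕ} (R : Matrix (Fin k) (Fin k) ℂ) (K : Matrix (Fin k) (Fin N) ℂ) :
    gd (R * K : Matrix (Fin k) (Fin N) ℂ) = ‖R.det‖ ^ 2 * gd K := by
  unfold gd
  change ((R * K * (R * K)ᴴ).det).re = _ * ((K * Kᴴ).det).re
  rw [← Complex.re_ofReal_mul, ← det_self_re]
  have : R * K * (R * K)ᴴ = R * (K * Kᴴ) * Rᴴ := by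
    simp only [Matrix.conjTranspose_mul, Matrix.mul_assoc]
  rw [this, Matrix.det_mul, Matrix.det_mul, Matrix.det_mul]
  ring_nf

theorem gd_mul_unitary {k N : ℕ} (K : Matrix (Fin k) (Fin N) ℂ) (W : Matrix (Fin N) (Fin N) ℂ)
    (hW : W ∈ unitaryGroup (Fin N) ℂ) :
    gd (K * W : Matrix (Fin k) (Fin N) ℂ) = gd K := by
  unfold gd
  change ((K * W * (K * W)ᴴ).det).re = ((K * Kᴴ).det).re
  rw [Matrix.conjTranspose_mul, Matrix.mul_assoc, ← Matrix.mul_assoc W,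
    ← Matrix.star_eq_conjTranspose W, Matrix.mem_unitaryGroup_iff.1 hW, Matrix.one_mul]

theorem gd_isom {k N : ℕ} (R : Matrix (Fin k) (Fin k) ℂ) (K : Matrix (Fin k) (Fin N) ℂ)
    (hK : K * Kᴴ = 1) : gd (R * K : Matrix (Fin k) (Fin N) ℂ) = ‖R.det‖ ^ 2 := by
  rw [gd_mul]
  unfold gd
  change _ * ((K * Kᴴ).det).re = _
  simp [hK]

theorem gd_cons {k n : ℕ} (R : Matrix (Fin k) (Fin k) ℂ) (H : Fin k → Fin (k + n) → ℂ)
    (hR : ∀ i j, H i j = if hj : (j : ℕ) < k then R i ⟨j, hj⟩ else 0) (x : Fin (k + n) → ℂ) :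
    gd (Fin.cons x H :
      Fin (k + 1) → Fin (k + n) → ℂ) =
      ‖R.det‖ ^ 2 * ∑ a : Fin n, ‖x (Fin.natAdd k a)‖ ^ 2 := by
  set s : ℝ := ∑ a : Fin n, ‖x (Fin.natAdd k a)‖ ^ 2 with hs
  have hs0 : 0 ≤ s := by positivity
  let Y : Matrix (Fin (k + 1)) (Fin (k + 1)) ℂ := Matrix.of
    (Fin.cons (Fin.cons ((Real.sqrt s : ℝ) : ℂ) (fun j : Fin k => x (Fin.castAdd n j)))
      (fun i => Fin.cons 0 (R i)))
  have hY : Y.det = (Real.sqrt s : ℝ) * R.det := by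
    rw [Matrix.det_succ_column_zero, Fin.sum_univ_succ]
    have : Y.submatrix (Fin.succAbove 0) Fin.succ = R := by
      ext i j; simp [Y]
    rw [this]
    simp [Y]
  have hXY : (Matrix.of (Fin.cons x H :
      Fin (k + 1) → Fin (k + n) → ℂ)) * (Matrix.of (Fin.cons x
        H :
      Fin (k + 1) → Fin (k + n) → ℂ))ᴴ = Y * Yᴴ := by
    have hsq : ((Real.sqrt s : ℝ) : ℂ) * (Real.sqrt s : ℝ) = (s : ℂ) := by
      rw [← Complex.ofReal_mul, Real.mul_self_sqrt hs0]
    have hsum : ∑ a : Fin n, x (Fin.natAdd k a) * (starRingEnd ℂ) (x (Fin.natAdd k a)) = (s : ℂ) := by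
      rw [hs]; push_cast
      exact Finset.sum_congr rfl fun a _ => by
        rw [Complex.mul_conj, Complex.normSq_eq_norm_sq]; push_cast; rfl
    ext i j
    simp only [Matrix.mul_apply (M := Matrix.of _), Matrix.mul_apply (M := Y), Matrix.conjTranspose_apply,
      Matrix.of_apply]
    rw [Fin.sum_univ_add, Fin.sum_univ_succ]
    refine Fin.cases ?_ (fun i => ?_) i <;> refine Fin.cases ?_ (fun j => ?_) j <;>
      simp [Y, hR, hsq, hsum, add_comm]
  unfold gd
  rw [hXY, det_self_re, hY, Complex.ofReal_re, norm_mul, mul_pow, Complex.norm_real, Real.norm_eq_abs,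
    sq_abs, Real.sq_sqrt hs0, mul_comm]

theorem inner_step {k n : ℕ} (hn : 0 < n) (p : ℝ) (hp : 0 < n + p) (H : Fin k → Fin (k + n) → ℂ) :
    ∫⁻ x, ENNReal.ofReal (gd (Fin.cons x H : Fin (k + 1) → Fin (k + n) → ℂ) ^ p) ∂(gv (k + n))
      = ENNReal.ofReal (gd H ^ p) * ENNReal.ofReal (Real.Gamma (n + p) / Real.Gamma n) := by
  obtain ⟨R, W, hW, hH⟩ := qr_exists (Nat.le_add_right k n) (Matrix.of H)
  have hcm : Measurable fun x : Fin (k + n) → ℂ => x ᵥ* W :=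
    Continuous.measurable (by fun_prop)
  have hmeas : Measurable fun x : Fin (k + n) → ℂ =>
      ENNReal.ofReal (gd (Fin.cons x H : Fin (k + 1) → Fin (k + n) → ℂ) ^ p) := by
    have : Measurable fun x : Fin (k + n) → ℂ =>
        gd (Fin.cons x H : Fin (k + 1) → Fin (k + n) → ℂ) := by
      refine gd_continuous.measurable.comp (Continuous.measurable ?_)
      refine continuous_pi fun i => ?_
      refine Fin.cases ?_ (fun i => ?_) i
      · simpa using continuous_id'
      · simpa using continuous_const
    fun_prop
  rw [← gv_map_unitary W hW, lintegral_map hmeas hcm, ← radial n hn p hp]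
  have hE : (stdFrame (k + n) k)ᴴ * ((stdFrame (k + n) k)ᴴ)ᴴ = 1 := by
    rw [Matrix.conjTranspose_conjTranspose, stdFrame_isom (Nat.le_add_right k n)]
  have hgH : gd H = ‖R.det‖ ^ 2 := by
    have h1 : gd H = gd (R * (stdFrame (k + n) k)ᴴ * W : Matrix (Fin k) (Fin (k + n)) ℂ) := by
      rw [← hH]; rfl
    rw [h1, gd_mul_unitary _ _ hW, gd_isom _ _ hE]
  have hpt : ∀ x : Fin (k + n) → ℂ, gd (Fin.cons (x ᵥ* W) H : Fin (k + 1) → Fin (k + n) → ℂ) =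
      ‖R.det‖ ^ 2 * ∑ a : Fin n, ‖(x ∘ Fin.natAdd k) a‖ ^ 2 := by
    intro x
    let H' : Fin k → Fin (k + n) → ℂ := (R * (stdFrame (k + n) k)ᴴ : Matrix (Fin k) (Fin (k + n)) ℂ)
    have : (Fin.cons (x ᵥ* W) H : Fin (k + 1) → Fin (k + n) → ℂ) =
        (Matrix.of (Fin.cons x H' :
          Fin (k + 1) → Fin (k + n) → ℂ) * W : Matrix _ _ ℂ) := by
      ext i j
      refine Fin.cases ?_ (fun i => ?_) i
      · simp [Matrix.mul_apply, Matrix.vecMul, dotProduct]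
      · have := congrFun (congrFun hH i) j
        simp only [Matrix.of_apply] at this
        simp only [Fin.cons_succ, this]
        rw [Matrix.mul_apply, Matrix.mul_apply]
        simp only [Matrix.of_apply, Fin.cons_succ]
        rfl
    rw [this, gd_mul_unitary _ _ hW]
    exact gd_cons R H' (mul_stdFrame (Nat.le_add_right k n) R) x
  simp_rw [hpt, hgH]
  have hnn : ∀ x : Fin (k + n) → ℂ, 0 ≤ ∑ a : Fin n, ‖(x ∘ Fin.natAdd k) a‖ ^ 2 :=
    fun x => by positivity
  simp_rw [fun x => Real.mul_rpow (z := p) (sq_nonneg ‖R.det‖) (hnn x)]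
  simp_rw [ENNReal.ofReal_mul (Real.rpow_nonneg (sq_nonneg ‖R.det‖) p)]
  rw [lintegral_const_mul' _ _ ENNReal.ofReal_ne_top,
    ← gv_comp (Fin.natAdd k) (Fin.natAdd_injective n k), lintegral_map]
  · fun_prop
  · exact measurable_pi_lambda _ fun i => measurable_pi_apply _

noncomputable def gm (k N : ℕ) : Measure (Fin k → Fin N → ℂ) := Measure.pi fun _ => gv N

instance gm_prob (k N : ℕ) : IsProbabilityMeasure (gm k N) := by unfold gm; infer_instance

theorem gm_moment (k N : ℕ) (h : k ≤ N) (p : ℝ) (hp : 0 < (N : ℝ) - k + 1 + p) :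
    ∫⁻ H, ENNReal.ofReal (gd H ^ p) ∂(gm k N) =
      ∏ i ∈ Finset.range k, ENNReal.ofReal (Real.Gamma ((N : ℝ) - i + p) / Real.Gamma ((N : ℝ) - i)) := by
  induction k with
  | zero => simp [gd]
  | succ k ih =>
    obtain ⟨n, rfl⟩ := Nat.exists_eq_add_of_le (Nat.le_of_succ_le h)
    have hn : 0 < n := by omega
    push_cast at hp
    have hg : Measurable fun H : Fin (k + 1) → Fin (k + n) → ℂ => ENNReal.ofReal (gd H ^ p) := by
      have := (gd_continuous (k := k + 1) (N := k + n)).measurable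
      fun_prop
    rw [Finset.prod_range_succ, ← ih (by omega) (by push_cast; linarith)]
    unfold gm
    have hmp := (measurePreserving_piFinSuccAbove
      (fun _ : Fin (k + 1) => gv (k + n)) 0).symm
    rw [← hmp.lintegral_comp_emb (MeasurableEquiv.measurableEmbedding _)]
    rw [lintegral_prod_symm']
    · simp only [MeasurableEquiv.piFinSuccAbove_symm_apply, Fin.insertNthEquiv,
            Fin.insertNth_zero, Equiv.coe_fn_mk]
      have hst := fun H => inner_step (k := k) hn p (by linarith) H
      rw [← lintegral_mul_const' _ _ ENNReal.ofReal_ne_top]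
      refine lintegral_congr fun H => ?_
      have e : ((k + n : ℕ) : ℝ) - k = n := by push_cast; ring
      rw [e]
      exact hst H
    · exact hg.comp (MeasurableEquiv.measurable _)

/-- Gram determinant of the last `n` columns. -/
noncomputable def gd2 {M n : ℕ} (K : Matrix (Fin M) (Fin (M + n)) ℂ) : ℝ :=
  gd (fun i => K i ∘ Fin.natAdd M)

theorem gd2_mul {M n : ℕ} (R : Matrix (Fin M) (Fin M) ℂ) (K : Matrix (Fin M) (Fin (M + n)) ℂ) :
    gd2 (R * K) = ‖R.det‖ ^ 2 * gd2 K := by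
  exact gd_mul R (Matrix.of fun i => K i ∘ Fin.natAdd M)

theorem gd2_nonneg {M n : ℕ} (K : Matrix (Fin M) (Fin (M + n)) ℂ) : 0 ≤ gd2 K := gd_nonneg _

theorem entry_measurable {T : ℕ} (i j : Fin T) :
    Measurable (fun U : Matrix.unitaryGroup (Fin T) ℂ => (U : Matrix (Fin T) (Fin T) ℂ) i j) := by
  have h : Measurable (fun U : Matrix (Fin T) (Fin T) ℂ => U i j) := by
    have h1 : Measurable (fun U : Fin T → Fin T → ℂ => U i j) :=
      (measurable_pi_apply j).comp (measurable_pi_apply i)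
    exact h1
  exact h.comp measurable_subtype_coe

theorem mulLeft_measurable {T : ℕ} (W : Matrix.unitaryGroup (Fin T) ℂ) :
    Measurable (fun U : Matrix.unitaryGroup (Fin T) ℂ => W * U) := by
  refine Measurable.subtype_mk ?_
  have h : Measurable (fun U : Matrix.unitaryGroup (Fin T) ℂ => (fun i j =>
      ∑ l, (W : Matrix (Fin T) (Fin T) ℂ) i l * (U : Matrix (Fin T) (Fin T) ℂ) l j :
        Fin T → Fin T → ℂ)) := by
    refine measurable_pi_lambda _ fun i => measurable_pi_lambda _ fun j => ?_
    exact Finset.measurable_sum _ fun l _ => (entry_measurable l j).const_mul _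
  exact h

theorem gd2_joint {M n : ℕ} (p : ℝ) : Measurable
    (fun q : (Fin M → Fin (M + n) → ℂ) × Matrix.unitaryGroup (Fin (M + n)) ℂ =>
      ENNReal.ofReal (gd2 (Matrix.of q.1 * (q.2 : Matrix (Fin (M + n)) (Fin (M + n)) ℂ)) ^ p)) := by
  have h : Measurable (fun q : (Fin M → Fin (M + n) → ℂ) × Matrix.unitaryGroup (Fin (M + n)) ℂ =>
      (fun i a => ∑ l, q.1 i l * (q.2 : Matrix (Fin (M + n)) (Fin (M + n)) ℂ) l (Fin.natAdd M a) :
        Fin M → Fin n → ℂ)) := by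
    refine measurable_pi_lambda _ fun i => measurable_pi_lambda _ fun j => ?_
    refine Finset.measurable_sum _ fun l _ => Measurable.mul ?_ ?_
    · exact (measurable_pi_apply l).comp ((measurable_pi_apply i).comp measurable_fst)
    · exact (entry_measurable l _).comp measurable_snd
  have h2 := gd_continuous.measurable.comp h
  exact (h2.pow_const p).ennreal_ofReal

theorem frame_factor {M T : ℕ} (h : M ≤ T) (B : Matrix (Fin T) (Fin M) ℂ) (hB : Bᴴ * B = 1)
    (H : Matrix (Fin M) (Fin T) ℂ) : ∃ R : Matrix (Fin M) (Fin M) ℂ,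
      ∃ W : Matrix.unitaryGroup (Fin T) ℂ, H = R * Bᴴ * (W : Matrix (Fin T) (Fin T) ℂ) := by
  obtain ⟨R1, W1, hW1, h1⟩ := qr_exists h H
  obtain ⟨R2, W2, hW2, h2⟩ := qr_exists h Bᴴ
  have hWW : W2 * W2ᴴ = 1 := Matrix.mem_unitaryGroup_iff.1 hW2
  have hE := stdFrame_isom h
  have hR : R2 * R2ᴴ = 1 := by
    rw [← hB]
    nth_rewrite 2 [← Matrix.conjTranspose_conjTranspose B]
    rw [h2]
    simp only [Matrix.conjTranspose_mul, Matrix.conjTranspose_conjTranspose, Matrix.mul_assoc]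
    rw [← Matrix.mul_assoc W2, hWW, Matrix.one_mul, ← Matrix.mul_assoc (stdFrame T M)ᴴ, hE,
      Matrix.one_mul]
  have hR' : R2ᴴ * R2 = 1 := mul_eq_one_comm.1 hR
  refine ⟨R1 * R2ᴴ, (star (⟨W2, hW2⟩ : Matrix.unitaryGroup (Fin T) ℂ)) * ⟨W1, hW1⟩, ?_⟩
  have hs : (((star (⟨W2, hW2⟩ : Matrix.unitaryGroup (Fin T) ℂ)) * ⟨W1, hW1⟩ :
    Matrix.unitaryGroup (Fin T) ℂ) : Matrix (Fin T) (Fin T) ℂ) = W2ᴴ * W1 := rfl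
  rw [hs, h2, h1]
  simp only [Matrix.mul_assoc]
  rw [← Matrix.mul_assoc W2, hWW, Matrix.one_mul, ← Matrix.mul_assoc R2ᴴ, hR', Matrix.one_mul]

theorem integrand_eq {M n : ℕ} (B : Matrix (Fin (M + n)) (Fin M) ℂ) (hB : Bᴴ * B = 1)
    (U : Matrix.unitaryGroup (Fin (M + n)) ℂ) :
    ((1 - Bᴴ * ((U : Matrix (Fin (M + n)) (Fin (M + n)) ℂ) * stdFrame (M + n) M) *
            ((U : Matrix (Fin (M + n)) (Fin (M + n)) ℂ) * stdFrame (M + n) M)ᴴ * B).det).re =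
      gd2 (Bᴴ * (U : Matrix (Fin (M + n)) (Fin (M + n)) ℂ)) := by
  unfold gd2 gd
  congr 2
  set K : Matrix (Fin M) (Fin (M + n)) ℂ := Bᴴ * (U : Matrix (Fin (M + n)) (Fin (M + n)) ℂ) with hK
  have hU : (U : Matrix (Fin (M + n)) (Fin (M + n)) ℂ) * (U : Matrix (Fin (M + n)) (Fin (M + n)) ℂ)ᴴ
    = 1 := Matrix.mem_unitaryGroup_iff.1 U.2
  have hKK : K * Kᴴ = 1 := by
    rw [hK, Matrix.conjTranspose_mul, Matrix.conjTranspose_conjTranspose, Matrix.mul_assoc,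
      ← Matrix.mul_assoc _ _ B, hU, Matrix.one_mul, hB]
  have h1 : Bᴴ * ((U : Matrix (Fin (M + n)) (Fin (M + n)) ℂ) * stdFrame (M + n) M) *
            ((U : Matrix (Fin (M + n)) (Fin (M + n)) ℂ) * stdFrame (M + n) M)ᴴ * B
      = (K * stdFrame (M + n) M) * (K * stdFrame (M + n) M)ᴴ := by
    rw [hK]
    simp only [Matrix.conjTranspose_mul, Matrix.conjTranspose_conjTranspose, Matrix.mul_assoc]
  rw [h1, ← hKK]
  have hKE : ∀ i j, (K * stdFrame (M + n) M) i j = K i (Fin.castAdd n j) := by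
    intro i j
    rw [Matrix.mul_apply, Finset.sum_eq_single (Fin.castAdd n j)]
    · simp [stdFrame]
    · intro b _ hb
      have : ¬ ((b:ℕ) = j) := fun h => hb (Fin.ext h)
      simp [stdFrame, this]
    · simp
  ext i j
  rw [Matrix.sub_apply, Matrix.mul_apply, Matrix.mul_apply, Matrix.mul_apply, Fin.sum_univ_add]
  simp only [Matrix.conjTranspose_apply, hKE, Matrix.of_apply, Function.comp]
  ring

theorem key_identity {M n : ℕ} (p : ℝ)
    (B : Matrix (Fin (M + n)) (Fin M) ℂ) (hB : Bᴴ * B = 1)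
    (μ : Measure (Matrix.unitaryGroup (Fin (M + n)) ℂ))
    [IsProbabilityMeasure μ] [μ.IsMulLeftInvariant] :
    (∫⁻ H, ENNReal.ofReal (gd H ^ p) ∂(gm M (M + n))) *
      (∫⁻ U, ENNReal.ofReal (gd2 (Bᴴ * (U : Matrix (Fin (M + n)) (Fin (M + n)) ℂ)) ^ p) ∂μ) =
    ∫⁻ H, ENNReal.ofReal (gd H ^ p) ∂(gm M n) := by
  have hsec : ∀ H : Matrix (Fin M) (Fin (M + n)) ℂ, Measurable
      fun U : Matrix.unitaryGroup (Fin (M + n)) ℂ =>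
        ENNReal.ofReal (gd2 (H * (U : Matrix (Fin (M + n)) (Fin (M + n)) ℂ)) ^ p) := by
    intro H
    have h0 := (gd2_joint (M := M) (n := n) p).comp
      (measurable_prodMk_left (x := (H : Fin M → Fin (M + n) → ℂ)))
    exact h0
  have hBB : Bᴴ * (Bᴴ)ᴴ = 1 := by rw [Matrix.conjTranspose_conjTranspose, hB]
  have h1 : ∀ H : Fin M → Fin (M + n) → ℂ,
      ∫⁻ U, ENNReal.ofReal (gd2 (Matrix.of H * (U : Matrix (Fin (M + n)) (Fin (M + n)) ℂ)) ^ p) ∂μ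
      = ENNReal.ofReal (gd H ^ p) *
      (∫⁻ U, ENNReal.ofReal (gd2 (Bᴴ * (U : Matrix (Fin (M + n)) (Fin (M + n)) ℂ)) ^ p) ∂μ) := by
    intro H
    obtain ⟨R, W, hH⟩ := frame_factor (Nat.le_add_right M n) B hB (Matrix.of H)
    have hg : gd H = ‖R.det‖ ^ 2 := by
      have h1 : gd H = gd (R * Bᴴ * (W : Matrix (Fin (M + n)) (Fin (M + n)) ℂ) :
        Matrix (Fin M) (Fin (M + n)) ℂ) := by
        rw [← hH]; rfl
      rw [h1, gd_mul_unitary _ _ W.2, gd_isom _ _ hBB]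
    have hpt : ∀ U : Matrix.unitaryGroup (Fin (M + n)) ℂ,
        ENNReal.ofReal (gd2 (Matrix.of H * (U : Matrix (Fin (M + n)) (Fin (M + n)) ℂ)) ^ p) =
        ENNReal.ofReal (gd H ^ p) * ENNReal.ofReal (gd2 (Bᴴ *
          ((W * U : Matrix.unitaryGroup (Fin (M + n)) ℂ) :
            Matrix (Fin (M + n)) (Fin (M + n)) ℂ)) ^ p) := by
      intro U
      have : Matrix.of H * (U : Matrix (Fin (M + n)) (Fin (M + n)) ℂ) = R * (Bᴴ *
          ((W * U : Matrix.unitaryGroup (Fin (M + n)) ℂ) :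
            Matrix (Fin (M + n)) (Fin (M + n)) ℂ)) := by
        rw [hH, Submonoid.coe_mul]
        simp only [Matrix.mul_assoc]
      rw [this, gd2_mul, hg, Real.mul_rpow (sq_nonneg _) (gd2_nonneg _),
        ENNReal.ofReal_mul (Real.rpow_nonneg (sq_nonneg _) _)]
    simp_rw [hpt]
    rw [lintegral_const_mul' _ _ ENNReal.ofReal_ne_top]
    congr 1
    have hinv : μ.map (fun U => W * U) = μ := Measure.IsMulLeftInvariant.map_mul_left_eq_self W
    conv_rhs => rw [← hinv, lintegral_map (hsec _) (mulLeft_measurable W)]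
  have h2 : ∀ U : Matrix.unitaryGroup (Fin (M + n)) ℂ,
      ∫⁻ H, ENNReal.ofReal (gd2 (Matrix.of H * (U : Matrix (Fin (M + n)) (Fin (M + n)) ℂ)) ^ p)
        ∂(gm M (M + n)) = ∫⁻ H, ENNReal.ofReal (gd H ^ p) ∂(gm M n) := by
    intro U
    have hfm : Measurable (fun x : Fin (M + n) → ℂ =>
        (x ᵥ* (U : Matrix (Fin (M + n)) (Fin (M + n)) ℂ)) ∘ Fin.natAdd M) := by
      refine measurable_pi_lambda _ fun i => Continuous.measurable ?_
      simp only [Function.comp]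
      fun_prop
    have hmap : (gv (M + n)).map (fun x =>
        (x ᵥ* (U : Matrix (Fin (M + n)) (Fin (M + n)) ℂ)) ∘ Fin.natAdd M) = gv n := by
      conv_rhs => rw [← gv_comp (Fin.natAdd M) (Fin.natAdd_injective n M), ← gv_map_unitary _ U.2]
      rw [Measure.map_map]
      · rfl
      · exact measurable_pi_lambda _ fun i => measurable_pi_apply _
      · exact Continuous.measurable (by fun_prop)
    have hmm : (gm M (M + n)).map (fun H i =>
        (H i ᵥ* (U : Matrix (Fin (M + n)) (Fin (M + n)) ℂ)) ∘ Fin.natAdd M) = gm M n := by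
      have hpr : IsProbabilityMeasure ((gv (M + n)).map (fun x =>
        (x ᵥ* (U : Matrix (Fin (M + n)) (Fin (M + n)) ℂ)) ∘ Fin.natAdd M)) := by
        rw [hmap]; infer_instance
      unfold gm
      rw [Measure.pi_map_pi (fun _ => hfm.aemeasurable)]
      simp_rw [hmap]
    rw [← hmm, lintegral_map]
    · rfl
    · exact ((gd_continuous.measurable).pow_const p).ennreal_ofReal
    · exact measurable_pi_lambda _ fun i => hfm.comp (measurable_pi_apply i)
  rw [← lintegral_mul_const]
  · simp_rw [← h1]
    rw [lintegral_lintegral_swap (gd2_joint p).aemeasurable]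
    simp_rw [h2]
    simp
  · exact ((gd_continuous.measurable).pow_const p).ennreal_ofReal

theorem chordal_product_moments
    (T M : ℕ) (hT : 0 < T) (hM : 0 < M) (hTM : 2 * M ≤ T)
    (p : ℝ) (hp : 2 * (M : ℝ) - T - 1 < p)
    (B : Matrix (Fin T) (Fin M) ℂ) (hB : Bᴴ * B = 1)
    (μ : Measure (Matrix.unitaryGroup (Fin T) ℂ))
    [IsProbabilityMeasure μ] [μ.IsMulLeftInvariant] :
    ∫ U : Matrix.unitaryGroup (Fin T) ℂ,
        ((1 - Bᴴ * ((U : Matrix (Fin T) (Fin T) ℂ) * stdFrame T M) *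
            ((U : Matrix (Fin T) (Fin T) ℂ) * stdFrame T M)ᴴ * B).det).re ^ p ∂μ
      = ∏ m ∈ Finset.Icc 1 M,
          (Real.Gamma ((T : ℝ) - m + 1) * Real.Gamma ((T : ℝ) + p - m - M + 1)) /
            (Real.Gamma ((T : ℝ) - m - M + 1) * Real.Gamma ((T : ℝ) + p - m + 1)) := by
  obtain ⟨n, rfl⟩ := Nat.exists_eq_add_of_le (show M ≤ T by omega)
  have hMn : M ≤ n := by omega
  have hMn' : (M : ℝ) ≤ n := by exact_mod_cast hMn
  push_cast at hp
  have hM0 : (0 : ℝ) < M := by exact_mod_cast hM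
  have key := key_identity p B hB μ
  rw [gm_moment _ _ (by omega) p (by push_cast; linarith), gm_moment _ _ hMn p (by linarith)] at key
  simp_rw [integrand_eq B hB]
  have hsec : Measurable fun U : Matrix.unitaryGroup (Fin (M + n)) ℂ =>
      gd2 (Bᴴ * (U : Matrix (Fin (M + n)) (Fin (M + n)) ℂ)) ^ p := by
    have h0 := ((gd2_joint (M := M) (n := n) 1).ennreal_toReal).comp
      (measurable_prodMk_left (x := (Bᴴ : Fin M → Fin (M + n) → ℂ)))
    have h1 : Measurable fun U : Matrix.unitaryGroup (Fin (M + n)) ℂ =>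
        gd2 (Bᴴ * (U : Matrix (Fin (M + n)) (Fin (M + n)) ℂ)) := by
      convert h0 using 1
      ext U
      simp only [Function.comp, Real.rpow_one]
      exact (ENNReal.toReal_ofReal (gd2_nonneg _)).symm
    exact h1.pow_const p
  rw [integral_eq_lintegral_of_nonneg_ae
    (Filter.Eventually.of_forall fun U => Real.rpow_nonneg (gd2_nonneg _) _)
    hsec.aestronglyMeasurable]
  have hpos : ∀ i ∈ Finset.range M, (0:ℝ) < n - i ∧ (0:ℝ) < n - i + p := by
    intro i hi
    have : (i : ℝ) + 1 ≤ M := by exact_mod_cast Finset.mem_range.1 hi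
    constructor <;> linarith
  have hposN : ∀ i ∈ Finset.range M,
      (0:ℝ) < ((M + n : ℕ) : ℝ) - i ∧ (0:ℝ) < ((M + n : ℕ) : ℝ) - i + p := by
    intro i hi
    have := hpos i hi
    push_cast
    constructor <;> linarith
  have hposA : ∀ i ∈ Finset.range M, (0:ℝ) <
      Real.Gamma (((M + n : ℕ) : ℝ) - i + p) / Real.Gamma (((M + n : ℕ) : ℝ) - i) := fun i hi =>
    div_pos (Real.Gamma_pos_of_pos (hposN i hi).2) (Real.Gamma_pos_of_pos (hposN i hi).1)
  have hposC : ∀ i ∈ Finset.range M, (0:ℝ) <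
      Real.Gamma ((n : ℝ) - i + p) / Real.Gamma ((n : ℝ) - i) := fun i hi =>
    div_pos (Real.Gamma_pos_of_pos (hpos i hi).2) (Real.Gamma_pos_of_pos (hpos i hi).1)
  rw [← ENNReal.ofReal_prod_of_nonneg (fun i hi => (hposA i hi).le),
    ← ENNReal.ofReal_prod_of_nonneg (fun i hi => (hposC i hi).le)] at key
  have key2 := congrArg ENNReal.toReal key
  rw [ENNReal.toReal_mul, ENNReal.toReal_ofReal (Finset.prod_pos hposA).le,
    ENNReal.toReal_ofReal (Finset.prod_pos hposC).le] at key2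
  rw [← mul_right_inj' (Finset.prod_pos hposA).ne', key2]
  have hIcc : Finset.Icc 1 M = Finset.Ico 1 (M + 1) := by ext; simp
  rw [hIcc, Finset.prod_Ico_eq_prod_range, Nat.add_sub_cancel, ← Finset.prod_mul_distrib]
  refine Finset.prod_congr rfl fun i hi => ?_
  have g1 := (Real.Gamma_pos_of_pos (hposN i hi).1).ne'
  have g2 := (Real.Gamma_pos_of_pos (hposN i hi).2).ne'
  have g3 := (Real.Gamma_pos_of_pos (hpos i hi).1).ne'
  have e1 : ((M + n : ℕ) : ℝ) - ((1 + i : ℕ) : ℝ) + 1 = ((M + n : ℕ) : ℝ) - i := by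
    push_cast; ring
  have e2 : ((M + n : ℕ) : ℝ) + p - ((1 + i : ℕ) : ℝ) - M + 1 = (n : ℝ) - i + p := by
    push_cast; ring
  have e3 : ((M + n : ℕ) : ℝ) - ((1 + i : ℕ) : ℝ) - M + 1 = (n : ℝ) - i := by
    push_cast; ring
  have e4 : ((M + n : ℕ) : ℝ) + p - ((1 + i : ℕ) : ℝ) + 1 = ((M + n : ℕ) : ℝ) - i + p := by
    push_cast; ring
  rw [e1, e2, e3, e4]
  field_simp
end

section
/- Let T and M be positive integers with T ≥ 2M and fix B ∈ ℂ^{T×M} with B^H B = I_M. Let μ be the Haar probability measure on the unitary group U(T). Then the pushforward of μ under the map U ↦ det(I_M − B^H (UE)(UE)^H B) (a real number in [0,1]) equals the pushforward, under the product map (z_1, …, z_M) ↦ z_1 · z_2 ⋯ z_M, of the product measure ⊗_{m=1}^{M} Beta(T−M+1−m, M). In other words, det(I_M − B^H (UE)(UE)^H B) is distributed as the product of M independent beta random variables z_m ∼ Beta(T−M+1−m, M), m = 1, …, M. -/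
open Matrix MeasureTheory

/-- The Beta distribution with parameters `a`, `b`: the measure on `ℝ` with density
`x ^ (a-1) * (1-x) ^ (b-1) * Γ(a+b) / (Γ(a) * Γ(b))` on `(0,1)` and `0` elsewhere. -/
noncomputable def betaMeasure (a b : ℝ) : Measure ℝ :=
  volume.withDensity fun x =>
    ENNReal.ofReal (if x ∈ Set.Ioo (0 : ℝ) 1 then
      x ^ (a - 1) * (1 - x) ^ (b - 1) * Real.Gamma (a + b) / (Real.Gamma a * Real.Gamma b)
    else 0)

namespace CPD

open scoped ENNReal

/-- Fubini for products over `Fin n`, in `ℝ≥0∞`. -/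
lemma lintegral_pi_prod {E : Type*} [MeasurableSpace E] (n : ℕ) (μ : Fin n → Measure E)
    [∀ i, SigmaFinite (μ i)] (f : Fin n → E → ℝ≥0∞) (hf : ∀ i, Measurable (f i)) :
    ∫⁻ x, ∏ i, f i (x i) ∂(Measure.pi μ) = ∏ i, ∫⁻ x, f i x ∂(μ i) := by
  induction n with
  | zero => simp
  | succ n ih =>
    have h := measurePreserving_piFinSuccAbove (α := fun _ => E) μ 0
    have hm : Measurable (fun p : E × (Fin n → E) => f 0 p.1 * ∏ i : Fin n, f i.succ (p.2 i)) := by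
      refine Measurable.mul ((hf 0).comp measurable_fst) ?_
      refine Finset.measurable_prod _ fun i _ => (hf _).comp ?_
      exact (measurable_pi_apply i).comp measurable_snd
    have e := h.lintegral_comp hm
    rw [lintegral_prod _ hm.aemeasurable] at e
    simp only [MeasurableEquiv.piFinSuccAbove_apply, Fin.insertNthEquiv_symm_apply] at e
    simp only [Fin.prod_univ_succ]
    have ihh := ih (fun i => μ i.succ) (fun i => f i.succ) (fun i => hf _)
    have hm2 : Measurable (fun p : (Fin n → E) => ∏ i : Fin n, f i.succ (p i)) :=
      Finset.measurable_prod _ fun i _ => (hf _).comp (measurable_pi_apply i)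
    rw [← ihh, ← lintegral_mul_const _ (hf 0)]
    simp only [lintegral_const_mul _ hm2] at e
    exact e

lemma pi_withDensity' {E : Type*} [MeasurableSpace E] (n : ℕ) (μ : Measure E)
    [SigmaFinite μ] (f : E → ℝ≥0∞) (hf : Measurable f) [h : SigmaFinite (μ.withDensity f)] :
    Measure.pi (fun _ : Fin n => μ.withDensity f)
      = (Measure.pi (fun _ : Fin n => μ)).withDensity (fun x => ∏ i, f (x i)) := by
  apply Measure.pi_eq
  intro s hs
  rw [withDensity_apply _ (MeasurableSet.univ_pi hs), ← lintegral_indicator (MeasurableSet.univ_pi hs)]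
  simp only [withDensity_apply _ (hs _), ← lintegral_indicator (hs _)]
  rw [← lintegral_pi_prod n (fun _ => μ) (fun i => (s i).indicator f)
    (fun i => hf.indicator (hs i))]
  refine lintegral_congr fun x => ?_
  by_cases hx : x ∈ Set.univ.pi s
  · rw [Set.indicator_of_mem hx]
    exact Finset.prod_congr rfl fun i _ => (Set.indicator_of_mem (hx i trivial) _).symm
  · rw [Set.indicator_of_notMem hx]
    simp only [Set.mem_pi, Set.mem_univ, true_imp_iff, not_forall] at hx
    obtain ⟨i, hi⟩ := hx
    exact (Finset.prod_eq_zero (Finset.mem_univ i) (Set.indicator_of_notMem hi _)).symm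

/-- A probability measure on `[0,1]` is determined by its moments. -/
lemma ext_of_moments (μ ν : Measure ℝ) [IsProbabilityMeasure μ] [IsProbabilityMeasure ν]
    (hμ : ∀ᵐ x ∂μ, x ∈ Set.Icc (0 : ℝ) 1) (hν : ∀ᵐ x ∂ν, x ∈ Set.Icc (0 : ℝ) 1)
    (h : ∀ k : ℕ, ∫⁻ x, ‖x‖ₑ ^ k ∂μ = ∫⁻ x, ‖x‖ₑ ^ k ∂ν) : μ = ν := by
  have key : ∀ (ρ : Measure ℝ) [IsProbabilityMeasure ρ], (∀ᵐ x ∂ρ, x ∈ Set.Icc (0 : ℝ) 1) →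
      ∀ t : ℝ, HasSum (fun k : ℕ => (t * Complex.I) ^ k / (k.factorial : ℂ) *
        (((∫⁻ x, ‖x‖ₑ ^ k ∂ρ).toReal : ℝ) : ℂ)) (charFun ρ t) := by
    intro ρ _ hρ t
    have hIntg : ∀ k : ℕ, Integrable (fun x : ℝ => ((x : ℂ)) ^ k) ρ := by
      intro k
      refine Integrable.of_bound (C := 1) (by fun_prop) ?_
      filter_upwards [hρ] with x hx
      rw [norm_pow, Complex.norm_real, Real.norm_of_nonneg hx.1]
      exact pow_le_one₀ hx.1 hx.2
    have hmom : ∀ k : ℕ, (((∫⁻ x, ‖x‖ₑ ^ k ∂ρ).toReal : ℝ) : ℂ) = ∫ x : ℝ, ((x : ℂ)) ^ k ∂ρ := by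
      intro k
      have : ∫ x : ℝ, ((x : ℂ)) ^ k ∂ρ = ((∫ x : ℝ, x ^ k ∂ρ : ℝ) : ℂ) := by
        rw [← integral_complex_ofReal]
        simp
      rw [this, integral_eq_lintegral_of_nonneg_ae]
      · congr 2
        refine lintegral_congr_ae ?_
        filter_upwards [hρ] with x hx
        rw [← ofReal_norm, Real.norm_of_nonneg hx.1, ENNReal.ofReal_pow hx.1]
      · filter_upwards [hρ] with x hx
        exact pow_nonneg hx.1 k
      · fun_prop
    have hs := hasSum_integral_of_summable_integral_norm (μ := ρ)
      (F := fun (k : ℕ) (x : ℝ) => (t * Complex.I) ^ k / (k.factorial : ℂ) * (x : ℂ) ^ k)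
      (fun k => (hIntg k).const_mul _) ?_
    · simp only [integral_const_mul] at hs
      simp only [hmom]
      suffices e : charFun ρ t = ∫ (a : ℝ), ∑' (i : ℕ),
          (↑t * Complex.I) ^ i / ↑i.factorial * (a : ℂ) ^ i ∂ρ by
        rw [e]; exact hs
      rw [charFun_apply_real]
      refine integral_congr_ae (Filter.Eventually.of_forall fun x => ?_)
      simp only
      rw [Complex.exp_eq_exp_ℂ, NormedSpace.exp_eq_tsum_div]
      refine tsum_congr fun k => ?_
      rw [div_mul_eq_mul_div, ← mul_pow]
      congr 2
      ring
    · refine Summable.of_nonneg_of_le (fun k => integral_nonneg fun x => norm_nonneg _) (fun k => ?_)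
        (Real.summable_pow_div_factorial |t|)
      calc _ ≤ ∫ x, |t| ^ k / (k.factorial : ℝ) ∂ρ := by
            refine integral_mono_ae ((hIntg k).const_mul _).norm (integrable_const _) ?_
            filter_upwards [hρ] with x hx
            simp only [norm_mul, norm_div, norm_pow, Complex.norm_real, Complex.norm_I, mul_one,
              Real.norm_eq_abs, Complex.norm_natCast]
            refine mul_le_of_le_one_right (by positivity) ?_
            rw [abs_of_nonneg hx.1]
            exact pow_le_one₀ hx.1 hx.2
        _ = _ := by simp
  apply Measure.ext_of_charFun
  funext t
  have h1 := key μ hμ t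
  have h2 := key ν hν t
  simp only [h] at h1
  exact h1.unique h2

/-! Beta measures -/

lemma betaMeasure_eq (a b : ℝ) : _root_.betaMeasure a b = ProbabilityTheory.betaMeasure a b := by
  unfold _root_.betaMeasure ProbabilityTheory.betaMeasure
  congr 1
  funext x
  rw [ProbabilityTheory.betaPDF_eq]
  simp only [Set.mem_Ioo, ProbabilityTheory.beta]
  congr 2
  rw [one_div_div]
  ring

lemma beta_moment (a b : ℝ) (ha : 0 < a) (hb : 0 < b) (k : ℕ) :
    ∫⁻ x, ‖x‖ₑ ^ k ∂(_root_.betaMeasure a b) =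
      ENNReal.ofReal (Real.Gamma (a + k) * Real.Gamma (a + b) /
        (Real.Gamma a * Real.Gamma (a + b + k))) := by
  rw [betaMeasure_eq]
  unfold ProbabilityTheory.betaMeasure
  have hm : Measurable (ProbabilityTheory.betaPDF a b) :=
    (ProbabilityTheory.measurable_betaPDFReal a b).ennreal_ofReal
  have hm' : Measurable (ProbabilityTheory.betaPDF (a + k) b) :=
    (ProbabilityTheory.measurable_betaPDFReal _ b).ennreal_ofReal
  rw [lintegral_withDensity_eq_lintegral_mul _ hm (by fun_prop)]
  have hak : 0 < a + k := by positivity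
  rw [← mul_one (ENNReal.ofReal _), ← ProbabilityTheory.lintegral_betaPDF_eq_one hak hb,
    ← lintegral_const_mul _ hm']
  refine lintegral_congr fun x => ?_
  simp only [Pi.mul_apply, ProbabilityTheory.betaPDF_eq]
  have g1 := Real.Gamma_pos_of_pos ha
  have g2 := Real.Gamma_pos_of_pos hb
  have g3 := Real.Gamma_pos_of_pos hak
  have g4 := Real.Gamma_pos_of_pos (add_pos ha hb)
  have g5 : 0 < Real.Gamma (a + b + k) := Real.Gamma_pos_of_pos (by positivity)
  split_ifs with hx
  · rw [← ofReal_norm, Real.norm_of_nonneg hx.1.le, ← ENNReal.ofReal_pow hx.1.le,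
      ← ENNReal.ofReal_mul, ← ENNReal.ofReal_mul]
    · congr 1
      have e1 : a + k - 1 = (a - 1) + k := by ring
      rw [e1, Real.rpow_add hx.1, Real.rpow_natCast]
      simp only [ProbabilityTheory.beta]
      rw [show a + (k : ℝ) + b = a + b + k by ring]
      field_simp
    · positivity
    · have := Real.rpow_pos_of_pos hx.1 (a-1)
      have := Real.rpow_pos_of_pos (sub_pos.2 hx.2) (b-1)
      have := ProbabilityTheory.beta_pos ha hb
      positivity
  · simp

lemma beta_prob (a b : ℝ) (ha : 0 < a) (hb : 0 < b) :
    IsProbabilityMeasure (_root_.betaMeasure a b) := by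
  rw [betaMeasure_eq]
  exact ProbabilityTheory.isProbabilityMeasureBeta ha hb

lemma beta_ae (a b : ℝ) : ∀ᵐ x ∂(_root_.betaMeasure a b), x ∈ Set.Icc (0 : ℝ) 1 := by
  rw [betaMeasure_eq]
  unfold ProbabilityTheory.betaMeasure
  have hm : Measurable (ProbabilityTheory.betaPDF a b) :=
    (ProbabilityTheory.measurable_betaPDFReal a b).ennreal_ofReal
  rw [ae_withDensity_iff hm]
  refine Filter.Eventually.of_forall fun x hx => ?_
  rw [ProbabilityTheory.betaPDF_eq] at hx
  split_ifs at hx with h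
  · exact ⟨h.1.le, h.2.le⟩
  · simp at hx

end CPD

namespace CPD

open scoped ENNReal

/-! Complex Gaussian vectors -/

/-- Standard complex Gaussian measure. -/
noncomputable def cg : Measure ℂ :=
  volume.withDensity fun z => ENNReal.ofReal (Real.pi⁻¹ * Real.exp (-‖z‖ ^ 2))

lemma cg_dens_meas : Measurable fun z : ℂ => ENNReal.ofReal (Real.pi⁻¹ * Real.exp (-‖z‖ ^ 2)) := by
  fun_prop

instance : IsProbabilityMeasure cg := by
  constructor
  unfold cg
  rw [withDensity_apply _ MeasurableSet.univ, Measure.restrict_univ]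
  have h : ∫ z : ℂ, Real.exp (-‖z‖ ^ 2) = Real.pi := by
    have := Complex.integral_exp_neg_rpow (p := 2) (by norm_num)
    norm_num at this
    have h2 : Real.Gamma 2 = 1 := Real.Gamma_two
    simpa [h2] using this
  have hi : Integrable (fun z : ℂ => Real.exp (-‖z‖ ^ 2)) :=
    Integrable.of_integral_ne_zero (by rw [h]; exact Real.pi_ne_zero)
  rw [← ofReal_integral_eq_lintegral_ofReal (hi.const_mul _)
    (Filter.Eventually.of_forall fun z => by positivity), integral_const_mul, h]
  simp [Real.pi_ne_zero]

/-- Standard complex Gaussian measure on `ℂ^N`. -/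
noncomputable def gv (N : ℕ) : Measure (Fin N → ℂ) := Measure.pi fun _ => cg

instance (N : ℕ) : IsProbabilityMeasure (gv N) := by unfold gv; infer_instance

lemma gv_eq (N : ℕ) : gv N = volume.withDensity fun v : Fin N → ℂ =>
    ENNReal.ofReal (Real.pi⁻¹ ^ N * Real.exp (-∑ i, ‖v i‖ ^ 2)) := by
  have h := pi_withDensity' N (volume : Measure ℂ) _ cg_dens_meas
    (h := by change SigmaFinite cg; infer_instance)
  unfold gv
  refine h.trans ?_
  rw [← volume_pi]
  congr 1
  funext v
  rw [← ENNReal.ofReal_prod_of_nonneg (fun i _ => by positivity), Finset.prod_mul_distrib,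
    ← Real.exp_sum]
  simp

lemma sum_norm_sq (N : ℕ) (v : Fin N → ℂ) : ((∑ i, ‖v i‖ ^ 2 : ℝ) : ℂ) = v ⬝ᵥ star v := by
  simp only [dotProduct, Pi.star_apply, RCLike.star_def, Complex.mul_conj, Complex.normSq_eq_norm_sq]
  push_cast
  rfl

lemma sum_norm_sq_vecMul (N : ℕ) (U : Matrix (Fin N) (Fin N) ℂ) (hU : U * Uᴴ = 1)
    (v : Fin N → ℂ) : ∑ i, ‖(v ᵥ* U) i‖ ^ 2 = ∑ i, ‖v i‖ ^ 2 := by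
  have : ((∑ i, ‖(v ᵥ* U) i‖ ^ 2 : ℝ) : ℂ) = ((∑ i, ‖v i‖ ^ 2 : ℝ) : ℂ) := by
    rw [sum_norm_sq, sum_norm_sq, star_vecMul, ← dotProduct_mulVec, mulVec_mulVec, hU, one_mulVec]
  exact_mod_cast this

lemma volume_vecMul (N : ℕ) (U : Matrix (Fin N) (Fin N) ℂ) (hU : U * Uᴴ = 1) :
    MeasurePreserving (fun v : Fin N → ℂ => v ᵥ* U) volume volume := by
  have hdet : Complex.normSq U.det = 1 := by
    have := congrArg Matrix.det hU
    rw [det_mul, det_conjTranspose, det_one, RCLike.star_def, Complex.mul_conj] at this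
    exact_mod_cast this
  let f : (Fin N → ℂ) →ₗ[ℂ] (Fin N → ℂ) := Matrix.toLin' Uᵀ
  have hf : LinearMap.det (f.restrictScalars ℝ) = 1 := by
    rw [LinearMap.det_restrictScalars, Algebra.norm_complex_apply, LinearMap.det_toLin',
      det_transpose, hdet]
  have h := Measure.map_linearMap_addHaar_eq_smul_addHaar (volume : Measure (Fin N → ℂ))
    (f := f.restrictScalars ℝ) (by rw [hf]; exact one_ne_zero)
  have e : (⇑(f.restrictScalars ℝ) : (Fin N → ℂ) → (Fin N → ℂ)) = fun v => v ᵥ* U := by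
    funext v
    simp [f, mulVec_transpose]
  rw [hf, e] at h
  refine ⟨?_, by simpa using h⟩
  rw [← e]
  exact (LinearMap.continuous_of_finiteDimensional _).measurable

lemma gv_vecMul (N : ℕ) (U : Matrix (Fin N) (Fin N) ℂ) (hU : U * Uᴴ = 1) :
    MeasurePreserving (fun v : Fin N → ℂ => v ᵥ* U) (gv N) (gv N) := by
  have hv := volume_vecMul N U hU
  refine ⟨hv.measurable, ?_⟩
  have hd : Measurable fun v : Fin N → ℂ =>
    ENNReal.ofReal (Real.pi⁻¹ ^ N * Real.exp (-∑ i, ‖v i‖ ^ 2)) := by fun_prop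
  refine Measure.ext_of_lintegral _ fun f hf => ?_
  rw [lintegral_map hf hv.measurable, gv_eq,
    lintegral_withDensity_eq_lintegral_mul _ hd (g := fun v => f (v ᵥ* U)) (hf.comp hv.measurable),
    lintegral_withDensity_eq_lintegral_mul _ hd hf, ← hv.lintegral_comp (hd.mul hf)]
  refine lintegral_congr fun v => ?_
  simp only [Pi.mul_apply, sum_norm_sq_vecMul N U hU]

/-- restriction of coordinates preserves Gaussian measures -/
lemma gv_restrict (N R : ℕ) (e : Fin R → Fin N) (he : Function.Injective e) :
    MeasurePreserving (fun (v : Fin N → ℂ) (j : Fin R) => v (e j)) (gv N) (gv R) := by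
  refine ⟨by fun_prop, ?_⟩
  have h1 : ProbabilityTheory.iIndepFun (fun (i : Fin N) (v : Fin N → ℂ) => v i) (gv N) :=
    ProbabilityTheory.iIndepFun_pi (μ := fun _ : Fin N => cg) (X := fun _ z => z)
      (fun _ => aemeasurable_id)
  have h2 := h1.precomp he
  rw [ProbabilityTheory.iIndepFun_iff_map_fun_eq_pi_map (fun i => (measurable_pi_apply _).aemeasurable)] at h2
  rw [h2]
  unfold gv
  congr 1
  funext j
  exact (measurePreserving_eval (fun _ : Fin N => cg) (e j)).map_eq

/-- The moments of the squared norm of a Gaussian vector. -/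
noncomputable def mm (k N : ℕ) : ℝ≥0∞ :=
  ENNReal.ofReal (Real.Gamma (N + k) / Real.Gamma N)

lemma gv_moment (k N : ℕ) (hN : 0 < N) :
    ∫⁻ v, ENNReal.ofReal (∑ i, ‖v i‖ ^ 2) ^ k ∂(gv N) = mm k N := by
  let E := EuclideanSpace ℂ (Fin N)
  let L : (Fin N → ℂ) ≃L[ℂ] E := (PiLp.continuousLinearEquiv 2 ℂ (fun _ : Fin N => ℂ)).symm
  let ν : Measure E := (volume : Measure (Fin N → ℂ)).map L
  have : ν.IsAddHaarMeasure := L.toContinuousAddEquiv.isAddHaarMeasure_map volume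
  have : Nonempty (Fin N) := ⟨⟨0, hN⟩⟩
  have hdim : Module.finrank ℝ E = 2 * N := by
    rw [← Module.finrank_mul_finrank ℝ ℂ E]
    simp [E]
  have hLm : Measurable L := L.continuous.measurable
  have hnorm : ∀ v : Fin N → ℂ, ‖L v‖ ^ 2 = ∑ i, ‖v i‖ ^ 2 := fun v => by
    rw [EuclideanSpace.norm_sq_eq]
    rfl
  have hd : Measurable fun v : Fin N → ℂ =>
    ENNReal.ofReal (Real.pi⁻¹ ^ N * Real.exp (-∑ i, ‖v i‖ ^ 2)) := by fun_prop
  set C : ℝ := Real.pi⁻¹ ^ N * (2 * N * ν.real (Metric.ball 0 1)) / 2 with hC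
  have main : ∀ k : ℕ, ∫⁻ v, ENNReal.ofReal (∑ i, ‖v i‖ ^ 2) ^ k ∂(gv N)
      = ENNReal.ofReal (C * Real.Gamma (N + k)) := by
    intro k
    let f : ℝ → ℝ := fun y => Real.pi⁻¹ ^ N * (y ^ (2 * k) * Real.exp (-y ^ 2))
    have hfy : ∀ y ∈ Set.Ioi (0:ℝ), y ^ (Module.finrank ℝ E - 1) • f y =
        Real.pi⁻¹ ^ N * (y ^ ((2 * (N + k) - 1 : ℕ) : ℝ) * Real.exp (-y ^ (2:ℝ))) := by
      intro y hy
      simp only [f, hdim, smul_eq_mul, Real.rpow_natCast, Real.rpow_two]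
      rw [show 2 * (N + k) - 1 = (2 * N - 1) + 2 * k by omega, pow_add]
      ring
    have hq : (-1 : ℝ) < ((2 * (N + k) - 1 : ℕ) : ℝ) :=
      lt_of_lt_of_le (by norm_num) (Nat.cast_nonneg _)
    have hIntg : Integrable (fun x : E => f ‖x‖) ν := by
      rw [integrable_fun_norm_addHaar]
      rw [integrableOn_congr_fun hfy measurableSet_Ioi]
      exact (integrableOn_rpow_mul_exp_neg_rpow hq (by norm_num)).const_mul _
    have hval : ∫ x : E, f ‖x‖ ∂ν = C * Real.Gamma (N + k) := by
      rw [integral_fun_norm_addHaar, setIntegral_congr_fun measurableSet_Ioi hfy,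
        integral_const_mul, integral_rpow_mul_exp_neg_rpow (by norm_num) hq, hdim]
      have : (((2 * (N + k) - 1 : ℕ) : ℝ) + 1) / 2 = N + k := by
        rw [Nat.cast_sub (by omega)]
        push_cast
        ring
      rw [this, hC]
      simp only [nsmul_eq_mul, smul_eq_mul]
      push_cast
      ring
    rw [← hval, ofReal_integral_eq_lintegral_ofReal hIntg
      (Filter.Eventually.of_forall fun x => by simp only [f]; positivity)]
    simp only [ν]
    rw [lintegral_map (by fun_prop) hLm, gv_eq,
      lintegral_withDensity_eq_lintegral_mul _ hd (by fun_prop)]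
    refine lintegral_congr fun v => ?_
    simp only [Pi.mul_apply, f]
    rw [← ENNReal.ofReal_pow (by positivity), ← ENNReal.ofReal_mul (by positivity), pow_mul, hnorm]
    congr 1
    ring
  have hg : 0 < Real.Gamma N := Real.Gamma_pos_of_pos (by exact_mod_cast hN)
  have h0 := main 0
  simp only [pow_zero, lintegral_const, measure_univ, mul_one, Nat.cast_zero, add_zero] at h0
  have hC1 : C * Real.Gamma N = 1 := by
    have := congrArg ENNReal.toReal h0.symm
    rw [ENNReal.toReal_ofReal (by positivity)] at this
    simpa using this
  rw [main k, mm]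
  congr 1
  rw [eq_div_iff hg.ne']
  linear_combination (Real.Gamma (N + k)) * hC1

end CPD

namespace CPD

open scoped ENNReal

/-! Linear algebra -/

lemma exists_unitary_extension {T M : ℕ} (h : M ≤ T) (Q : Matrix (Fin T) (Fin M) ℂ)
    (hQ : Qᴴ * Q = 1) :
    ∃ V : Matrix (Fin T) (Fin T) ℂ, Vᴴ * V = 1 ∧ ∀ i j, V i (Fin.castLE h j) = Q i j := by
  let v : Fin T → EuclideanSpace ℂ (Fin T) := fun t =>
    if ht : (t : ℕ) < M then WithLp.toLp 2 (fun i => Q i ⟨t, ht⟩) else 0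
  let s : Set (Fin T) := {t | (t : ℕ) < M}
  have hv : Orthonormal ℂ (s.domRestrict v) := by
    rw [orthonormal_iff_ite]
    rintro ⟨a, ha⟩ ⟨b, hb⟩
    have ha' : (a : ℕ) < M := ha
    have hb' : (b : ℕ) < M := hb
    have := congrFun (congrFun hQ ⟨a, ha'⟩) ⟨b, hb'⟩
    simp only [Matrix.mul_apply, Matrix.conjTranspose_apply, Matrix.one_apply] at this
    simp only [Set.domRestrict_apply, v, dif_pos ha', dif_pos hb', PiLp.inner_apply]
    simp only [RCLike.inner_apply]
    simp only [Subtype.mk.injEq, Fin.ext_iff, RCLike.star_def] at this ⊢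
    rw [← this]
    exact Finset.sum_congr rfl fun i _ => mul_comm _ _
  obtain ⟨b, hb⟩ := hv.exists_orthonormalBasis_extension_of_card_eq (by simp)
  refine ⟨Matrix.of fun i t => b t i, ?_, ?_⟩
  · ext i j
    have := (orthonormal_iff_ite.1 b.orthonormal) i j
    simp only [PiLp.inner_apply, RCLike.inner_apply] at this
    simp only [Matrix.mul_apply, Matrix.conjTranspose_apply, Matrix.one_apply, Matrix.of_apply,
      RCLike.star_def]
    rw [← this]
    exact Finset.sum_congr rfl fun i _ => mul_comm _ _
  · intro i j
    have hj : ((Fin.castLE h j : Fin T) : ℕ) < M := j.2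
    simp only [Matrix.of_apply]
    rw [hb _ hj]
    simp only [v, dif_pos hj]
    rfl

lemma exists_rotation {N : ℕ} (a : Fin (N + 1) → ℂ) :
    ∃ V : Matrix (Fin (N + 1)) (Fin (N + 1)) ℂ, V * Vᴴ = 1 ∧
      a ᵥ* V = Pi.single 0 ((Real.sqrt (∑ i, ‖a i‖ ^ 2) : ℝ) : ℂ) := by
  set c : ℝ := Real.sqrt (∑ i, ‖a i‖ ^ 2) with hc
  have hc2 : c ^ 2 = ∑ i, ‖a i‖ ^ 2 := Real.sq_sqrt (by positivity)
  by_cases h0 : c = 0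
  · have ha : a = 0 := by
      rw [h0] at hc2
      have := (Finset.sum_eq_zero_iff_of_nonneg (fun i _ => by positivity)).1
        (hc2.symm.trans (by norm_num))
      funext i
      simpa using this i (Finset.mem_univ i)
    exact ⟨1, by simp, by simp [ha, h0]⟩
  · have hcc : (c : ℂ) ≠ 0 := by exact_mod_cast h0
    let Q : Matrix (Fin (N + 1)) (Fin 1) ℂ := Matrix.of fun i _ => star (a i) / c
    have hQ : Qᴴ * Q = 1 := by
      ext i j
      have : i = j := Subsingleton.elim _ _
      subst this
      have hs := sum_norm_sq _ a
      rw [← hc2] at hs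
      simp only [Matrix.mul_apply, Matrix.conjTranspose_apply, Q, Matrix.of_apply, Matrix.one_apply_eq,
        star_div₀, star_star]
      have e : ∀ x : Fin (N+1), a x / star (c : ℂ) * (star (a x) / c) = (a x * star (a x)) / c ^ 2 := by
        intro x
        rw [RCLike.star_def, Complex.conj_ofReal]
        field_simp
      simp only [e, ← Finset.sum_div]
      rw [div_eq_one_iff_eq (pow_ne_zero 2 hcc)]
      push_cast at hs
      exact hs.symm
    obtain ⟨V, hV, hVQ⟩ := exists_unitary_extension (by omega) Q hQ
    refine ⟨V, mul_eq_one_comm.1 hV, ?_⟩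
    have ha : a = (Pi.single 0 (c : ℂ)) ᵥ* Vᴴ := by
      funext i
      have := hVQ i 0
      rw [Matrix.single_vecMul]
      simp only [Pi.smul_apply, Matrix.row_apply, Matrix.conjTranspose_apply]
      have e : (Fin.castLE (by omega) (0 : Fin 1) : Fin (N+1)) = 0 := rfl
      rw [e] at this
      rw [this]
      simp only [Q, Matrix.of_apply, star_div₀, RCLike.star_def, Complex.conj_ofReal,
        smul_eq_mul, Complex.conj_conj]
      field_simp
    conv_lhs => rw [ha]
    rw [vecMul_vecMul, hV, vecMul_one]

lemma det_first_row {n : ℕ} (Z : Matrix (Fin (n + 1)) (Fin (n + 1)) ℂ)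
    (h : ∀ j : Fin n, Z 0 j.succ = 0) :
    Z.det = Z 0 0 * (Z.submatrix Fin.succ Fin.succ).det := by
  rw [det_succ_row_zero, Fin.sum_univ_succ]
  simp [h]

lemma det_cons {M N : ℕ} (c : ℂ) (A : Fin M → Fin (N + 1) → ℂ) :
    ((Matrix.of (Fin.cons (Pi.single 0 c) A : Fin (M + 1) → Fin (N + 1) → ℂ)) *
      (Matrix.of (Fin.cons (Pi.single 0 c) A : Fin (M + 1) → Fin (N + 1) → ℂ))ᴴ).det
      = (c * star c) * ((Matrix.of fun i (j : Fin N) => A i j.succ) *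
        (Matrix.of fun i (j : Fin N) => A i j.succ)ᴴ).det := by
  let X : Matrix (Fin (M + 1)) (Fin (M + 1)) ℂ :=
    Matrix.of (Fin.cons (Pi.single 0 c) (fun i => Fin.cons (A i 0) (Pi.single i 1)))
  let Y : Matrix (Fin (M + 1)) (Fin (N + 1)) ℂ :=
    Matrix.of (Fin.cons (Pi.single 0 1) (fun i => Fin.cons 0 (fun j => A i j.succ)))
  have hXY : Matrix.of (Fin.cons (Pi.single 0 c) A : Fin (M + 1) → Fin (N + 1) → ℂ) = X * Y := by
    ext i j
    refine Fin.cases ?_ (fun i => ?_) i <;> refine Fin.cases ?_ (fun j => ?_) j <;>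
      simp [X, Y, Matrix.mul_apply, Fin.sum_univ_succ, Pi.single_apply]
  have hX : X.det = c := by
    rw [det_first_row X (fun j => by simp [X])]
    have : X.submatrix Fin.succ Fin.succ = 1 := by
      ext i j
      simp [X, Matrix.one_apply, Pi.single_apply, eq_comm]
    rw [this]
    simp [X]
  have hY : (Y * Yᴴ).det = ((Matrix.of fun i (j : Fin N) => A i j.succ) *
        (Matrix.of fun i (j : Fin N) => A i j.succ)ᴴ).det := by
    rw [det_first_row _ (fun j => by simp [Y, Matrix.mul_apply, Fin.sum_univ_succ])]
    have e0 : (Y * Yᴴ) 0 0 = 1 := by simp [Y, Matrix.mul_apply, Fin.sum_univ_succ]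
    rw [e0, one_mul]
    congr 1
    ext i j
    simp [Y, Matrix.mul_apply, Fin.sum_univ_succ]
  rw [hXY, conjTranspose_mul, ← Matrix.mul_assoc, Matrix.mul_assoc X, det_mul, det_mul, hY,
    det_conjTranspose, hX]
  ring

/-- Power of the Gram determinant. -/
noncomputable def gdet (k : ℕ) {M N : ℕ} (A : Fin M → Fin N → ℂ) : ℝ≥0∞ :=
  ‖((Matrix.of A) * (Matrix.of A)ᴴ).det‖ₑ ^ k

lemma gdet_continuous (M N : ℕ) : Continuous (fun A : Fin M → Fin N → ℂ =>
    ((Matrix.of A) * (Matrix.of A)ᴴ).det) := by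
  have h : Continuous (fun A : Fin M → Fin N → ℂ => Matrix.of A) := continuous_id
  exact (h.matrix_mul h.matrix_conjTranspose).matrix_det

lemma gdet_measurable (k M N : ℕ) : Measurable (gdet k : (Fin M → Fin N → ℂ) → ℝ≥0∞) :=
  ((gdet_continuous M N).measurable.enorm).pow_const k

lemma gdet_rot (k : ℕ) {M N : ℕ} (A : Fin M → Fin N → ℂ) (V : Matrix (Fin N) (Fin N) ℂ)
    (hV : V * Vᴴ = 1) : gdet k (fun i => A i ᵥ* V) = gdet k A := by
  have : (Matrix.of fun i => A i ᵥ* V) = (Matrix.of A) * V := rfl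
  rw [gdet, this, conjTranspose_mul, ← Matrix.mul_assoc, Matrix.mul_assoc _ V, hV, Matrix.mul_one]
  rfl

/-- Gaussian matrix measure -/
noncomputable def gm (M N : ℕ) : Measure (Fin M → Fin N → ℂ) := Measure.pi fun _ => gv N

instance (M N : ℕ) : IsProbabilityMeasure (gm M N) := by unfold gm; infer_instance

lemma gm_vecMul (M N : ℕ) (U : Matrix (Fin N) (Fin N) ℂ) (hU : U * Uᴴ = 1) :
    MeasurePreserving (fun (A : Fin M → Fin N → ℂ) i => A i ᵥ* U) (gm M N) (gm M N) :=
  measurePreserving_pi (fun _ : Fin M => gv N) (fun _ : Fin M => gv N) (fun _ => gv_vecMul N U hU)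

lemma gm_restrict (M N R : ℕ) (e : Fin R → Fin N) (he : Function.Injective e) :
    MeasurePreserving (fun (A : Fin M → Fin N → ℂ) i j => A i (e j)) (gm M N) (gm M R) :=
  measurePreserving_pi (fun _ : Fin M => gv N) (fun _ : Fin M => gv R)
    (fun _ => gv_restrict N R e he)

lemma gdet_succ (k M N : ℕ) :
    ∫⁻ A, gdet k A ∂(gm (M + 1) (N + 1)) = mm k (N + 1) * ∫⁻ A, gdet k A ∂(gm M N) := by
  have h := (measurePreserving_piFinSuccAbove (α := fun _ => Fin (N + 1) → ℂ)
    (fun _ : Fin (M + 1) => gv (N + 1)) 0).symm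
  have hm : Measurable (fun p : (Fin (N + 1) → ℂ) × (Fin M → Fin (N + 1) → ℂ) =>
      gdet k ((MeasurableEquiv.piFinSuccAbove (fun _ => Fin (N + 1) → ℂ) 0).symm p)) :=
    (gdet_measurable k _ _).comp (MeasurableEquiv.measurable _)
  have e := h.lintegral_comp (gdet_measurable k (M + 1) (N + 1))
  rw [lintegral_prod _ hm.aemeasurable] at e
  refine e.symm.trans ?_
  have inner : ∀ a : Fin (N + 1) → ℂ,
      ∫⁻ A', gdet k ((MeasurableEquiv.piFinSuccAbove (fun _ => Fin (N + 1) → ℂ) 0).symm (a, A'))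
        ∂(Measure.pi fun _ : Fin M => gv (N + 1)) =
      ENNReal.ofReal (∑ i, ‖a i‖ ^ 2) ^ k * ∫⁻ A, gdet k A ∂(gm M N) := by
    intro a
    obtain ⟨V, hV, haV⟩ := exists_rotation a
    have e1 : ∀ A' : Fin M → Fin (N + 1) → ℂ,
        gdet k ((MeasurableEquiv.piFinSuccAbove (fun _ => Fin (N + 1) → ℂ) 0).symm (a, A')) =
        ENNReal.ofReal (∑ i, ‖a i‖ ^ 2) ^ k *
          gdet k (fun i (j : Fin N) => (A' i ᵥ* V) j.succ) := by
      intro A'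
      have e2 : (MeasurableEquiv.piFinSuccAbove (fun _ => Fin (N + 1) → ℂ) 0).symm (a, A')
          = (Fin.cons a A' : Fin (M + 1) → Fin (N + 1) → ℂ) := by
        exact Fin.insertNth_zero' a A'
      rw [e2, ← gdet_rot k _ V hV]
      have e3 : (fun i => (Fin.cons a A' : Fin (M + 1) → Fin (N + 1) → ℂ) i ᵥ* V)
          = Fin.cons (Pi.single 0 ((Real.sqrt (∑ i, ‖a i‖ ^ 2) : ℝ) : ℂ)) (fun i => A' i ᵥ* V) := by
        funext i
        refine Fin.cases ?_ (fun i => ?_) i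
        · simp [haV]
        · simp
      rw [e3, gdet, det_cons, enorm_mul, mul_pow, gdet]
      congr 2
      rw [RCLike.star_def, Complex.conj_ofReal, ← Complex.ofReal_mul,
        Real.mul_self_sqrt (by positivity), ← ofReal_norm, Complex.norm_real,
        Real.norm_of_nonneg (by positivity)]
    simp only [e1]
    have hmp := (gm_restrict M (N + 1) N Fin.succ (Fin.succ_injective N)).comp
      (gm_vecMul M (N + 1) V hV)
    have h3 := hmp.lintegral_comp (gdet_measurable k M N)
    rw [lintegral_const_mul, ← h3]
    · rfl
    · exact (gdet_measurable k M N).comp hmp.measurable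
  have e4 : ∀ a : Fin (N + 1) → ℂ, _ := inner
  rw [lintegral_congr e4, lintegral_mul_const _ (by fun_prop), gv_moment k (N + 1) (by omega)]

lemma gdet_integral (k M : ℕ) : ∀ N : ℕ, M ≤ N →
    ∫⁻ A, gdet k A ∂(gm M N) = ∏ j : Fin M, mm k (N - j) := by
  induction M with
  | zero => intro N _; simp [gdet]
  | succ M ih =>
    intro N hN
    obtain ⟨N, rfl⟩ : ∃ n, N = n + 1 := ⟨N - 1, by omega⟩
    rw [gdet_succ, ih N (by omega), Fin.prod_univ_succ]
    simp

end CPD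

namespace CPD

open scoped ENNReal ComplexOrder

/-! The Haar measure part -/

lemma measurable_coe_unitary (T : ℕ) : Measurable (fun (U : Matrix.unitaryGroup (Fin T) ℂ)
    (i j : Fin T) => (U : Matrix (Fin T) (Fin T) ℂ) i j) := measurable_subtype_coe

lemma measurable_to_unitary {T : ℕ} {X : Type*} [MeasurableSpace X]
    (f : X → Matrix.unitaryGroup (Fin T) ℂ)
    (hf : Measurable (fun x (i j : Fin T) => (f x : Matrix (Fin T) (Fin T) ℂ) i j)) :
    Measurable f := by
  have : Measurable (fun x => (f x : Matrix (Fin T) (Fin T) ℂ)) := hf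
  exact this.subtype_mk

instance (T : ℕ) : MeasurableMul (Matrix.unitaryGroup (Fin T) ℂ) where
  measurable_const_mul := fun V => by
    apply measurable_to_unitary
    have hc : Continuous (fun (A : Fin T → Fin T → ℂ) (i j : Fin T) =>
        ((V : Matrix (Fin T) (Fin T) ℂ) * Matrix.of A) i j) := by
      have h : Continuous (fun A : Fin T → Fin T → ℂ => Matrix.of A) := continuous_id
      exact (continuous_const.matrix_mul h)
    exact hc.measurable.comp (measurable_coe_unitary T)
  measurable_mul_const := fun V => by
    apply measurable_to_unitary
    have hc : Continuous (fun (A : Fin T → Fin T → ℂ) (i j : Fin T) =>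
        (Matrix.of A * (V : Matrix (Fin T) (Fin T) ℂ)) i j) := by
      have h : Continuous (fun A : Fin T → Fin T → ℂ => Matrix.of A) := continuous_id
      exact (h.matrix_mul continuous_const)
    exact hc.measurable.comp (measurable_coe_unitary T)

/-- Dropping the first `M` columns. -/
def pr {M K R : ℕ} (X : Matrix (Fin K) (Fin (M + R)) ℂ) : Fin K → Fin R → ℂ :=
  fun i j => X i (Fin.natAdd M j)

lemma gdet_mul (k : ℕ) {M N : ℕ} (S : Matrix (Fin M) (Fin M) ℂ) (Y : Fin M → Fin N → ℂ) :
    gdet k (fun i j => (S * Matrix.of Y) i j) = ‖(S * Sᴴ).det‖ₑ ^ k * gdet k Y := by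
  have e : Matrix.of (fun i j => (S * Matrix.of Y) i j) = S * Matrix.of Y := rfl
  rw [gdet, gdet, e, conjTranspose_mul, ← Matrix.mul_assoc, Matrix.mul_assoc S, det_mul, det_mul,
    det_mul, det_conjTranspose]
  simp only [enorm_mul, mul_pow]
  ring

lemma measurable_joint' (k M T R : ℕ) (e : Fin R → Fin T) :
    Measurable (fun p : Matrix.unitaryGroup (Fin T) ℂ × (Fin M → Fin T → ℂ) =>
      gdet k (fun i j => (Matrix.of p.2 * (p.1 : Matrix (Fin T) (Fin T) ℂ)) i (e j))) := by
  have hc : Continuous (fun p : (Fin T → Fin T → ℂ) × (Fin M → Fin T → ℂ) =>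
      (fun i j => (Matrix.of p.2 * Matrix.of p.1) i (e j) : Fin M → Fin R → ℂ)) := by
    have h1 : Continuous (fun p : (Fin T → Fin T → ℂ) × (Fin M → Fin T → ℂ) =>
      Matrix.of p.2) := continuous_snd
    have h2 : Continuous (fun p : (Fin T → Fin T → ℂ) × (Fin M → Fin T → ℂ) =>
      Matrix.of p.1) := continuous_fst
    have h3 := h1.matrix_mul h2
    refine continuous_pi fun i => continuous_pi fun j => ?_
    exact h3.matrix_elem i (e j)
  have hm : Measurable (fun p : Matrix.unitaryGroup (Fin T) ℂ × (Fin M → Fin T → ℂ) =>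
      ((fun i j => (p.1 : Matrix (Fin T) (Fin T) ℂ) i j, p.2) :
      (Fin T → Fin T → ℂ) × (Fin M → Fin T → ℂ))) := by
    exact ((measurable_coe_unitary T).comp measurable_fst).prodMk measurable_snd
  have h5 := (gdet_measurable k M R).comp hc.measurable
  have h6 := h5.comp hm
  have e0 : ∀ X : Matrix (Fin T) (Fin T) ℂ, Matrix.of (fun i j => X i j) = X := fun X => rfl
  simp only [Function.comp_def, e0] at h6
  exact h6

lemma measurable_const_mul' (k M T R : ℕ) (e : Fin R → Fin T) (C : Matrix (Fin M) (Fin T) ℂ) :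
    Measurable (fun U : Matrix.unitaryGroup (Fin T) ℂ =>
      gdet k (fun i j => (C * (U : Matrix (Fin T) (Fin T) ℂ)) i (e j))) := by
  have hc : Continuous (fun p : (Fin T → Fin T → ℂ) =>
      (fun i j => (C * Matrix.of p) i (e j) : Fin M → Fin R → ℂ)) := by
    have h2 : Continuous (fun p : (Fin T → Fin T → ℂ) => Matrix.of p) := continuous_id
    have h3 := (continuous_const (y := C)).matrix_mul h2
    refine continuous_pi fun i => continuous_pi fun j => ?_
    exact h3.matrix_elem i (e j)
  have h5 := (gdet_measurable k M R).comp hc.measurable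
  have h6 := h5.comp (measurable_coe_unitary T)
  have e0 : ∀ X : Matrix (Fin T) (Fin T) ℂ, Matrix.of (fun i j => X i j) = X := fun X => rfl
  simp only [Function.comp_def, e0] at h6
  exact h6

lemma exists_sqrt (M : ℕ) (X : Matrix (Fin M) (Fin M) ℂ) (hX : X.PosSemidef) :
    ∃ S : Matrix (Fin M) (Fin M) ℂ, X = S * Sᴴ := by
  have h := hX.1.spectral_theorem
  let U : Matrix (Fin M) (Fin M) ℂ := hX.1.eigenvectorUnitary
  let D : Matrix (Fin M) (Fin M) ℂ := diagonal fun i => ((Real.sqrt (hX.1.eigenvalues i) : ℝ) : ℂ)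
  refine ⟨U * D, ?_⟩
  have hD : D * Dᴴ = diagonal (RCLike.ofReal ∘ hX.1.eigenvalues) := by
    simp only [D, diagonal_conjTranspose, diagonal_mul_diagonal]
    congr 1
    funext i
    simp only [Pi.star_apply, RCLike.star_def, Complex.conj_ofReal, Function.comp_apply]
    rw [← Complex.ofReal_mul, Real.mul_self_sqrt (hX.eigenvalues_nonneg i)]
    rfl
  rw [conjTranspose_mul, Matrix.mul_assoc, ← Matrix.mul_assoc D, hD]
  conv_lhs => rw [h]
  rw [Unitary.conjStarAlgAut_apply, Matrix.mul_assoc]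
  rfl

lemma measurable_joint (k M R : ℕ) :
    Measurable (fun p : Matrix.unitaryGroup (Fin (M + R)) ℂ × (Fin M → Fin (M + R) → ℂ) =>
      gdet k (pr (M := M) (Matrix.of p.2 * (p.1 : Matrix (Fin (M + R)) (Fin (M + R)) ℂ)))) := by
  exact measurable_joint' k M (M + R) R (Fin.natAdd M)

lemma haar_orbit (k M R : ℕ) (B : Matrix (Fin (M + R)) (Fin M) ℂ) (hB : Bᴴ * B = 1)
    (μ : Measure (Matrix.unitaryGroup (Fin (M + R)) ℂ))
    [IsProbabilityMeasure μ] [μ.IsMulLeftInvariant] (A : Fin M → Fin (M + R) → ℂ) :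
    ∫⁻ U, gdet k (pr (M := M) (Matrix.of A * (U : Matrix (Fin (M + R)) (Fin (M + R)) ℂ))) ∂μ =
      gdet k A *
        ∫⁻ U, gdet k (pr (M := M) (Bᴴ * (U : Matrix (Fin (M + R)) (Fin (M + R)) ℂ))) ∂μ := by
  rcases Nat.eq_zero_or_pos k with rfl | hk
  · simp [gdet]
  by_cases h0 : (Matrix.of A * (Matrix.of A)ᴴ).det = 0
  · have hz : ∀ U : Matrix.unitaryGroup (Fin (M + R)) ℂ,
        gdet k (pr (M := M) (Matrix.of A * (U : Matrix (Fin (M + R)) (Fin (M + R)) ℂ))) = 0 := by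
      intro U
      obtain ⟨v, hv0, hv⟩ := exists_vecMul_eq_zero_iff.2 h0
      rw [vecMul_self_mul_conjTranspose_eq_zero] at hv
      have h2 : v ᵥ* (Matrix.of A * (U : Matrix (Fin (M + R)) (Fin (M + R)) ℂ)) = 0 := by
        rw [← vecMul_vecMul, hv, zero_vecMul]
      set Y := Matrix.of A * (U : Matrix (Fin (M + R)) (Fin (M + R)) ℂ) with hY
      have h3 : v ᵥ* (Matrix.of (pr (M := M) Y)) = 0 := by
        funext j
        exact congrFun h2 (Fin.natAdd M j)
      have h4 : (Matrix.of (pr (M := M) Y) * (Matrix.of (pr (M := M) Y))ᴴ).det = 0 :=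
        exists_vecMul_eq_zero_iff.1 ⟨v, hv0, by rw [← vecMul_vecMul, h3, zero_vecMul]⟩
      rw [gdet, h4]
      simp [hk.ne']
    simp only [hz]
    rw [gdet, h0]
    simp [hk.ne']
  · obtain ⟨S, hS⟩ : ∃ S : Matrix (Fin M) (Fin M) ℂ, Matrix.of A * (Matrix.of A)ᴴ = S * Sᴴ :=
      exists_sqrt M _ (posSemidef_self_mul_conjTranspose _)
    have hSdet : IsUnit S.det := by
      rw [isUnit_iff_ne_zero]
      intro h
      apply h0
      rw [hS, det_mul, h, zero_mul]
    let Q : Matrix (Fin M) (Fin (M + R)) ℂ := S⁻¹ * Matrix.of A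
    have hSQ : Matrix.of A = S * Q := by
      simp only [Q]
      rw [← Matrix.mul_assoc, Matrix.mul_nonsing_inv _ hSdet, Matrix.one_mul]
    have hQ : Qᴴᴴ * Qᴴ = 1 := by
      rw [conjTranspose_conjTranspose]
      simp only [Q, conjTranspose_mul]
      rw [Matrix.mul_assoc, ← Matrix.mul_assoc (Matrix.of A), hS, ← Matrix.mul_assoc,
        ← Matrix.mul_assoc, Matrix.nonsing_inv_mul _ hSdet, Matrix.one_mul, ← conjTranspose_mul,
        Matrix.nonsing_inv_mul _ hSdet, conjTranspose_one]
    obtain ⟨V, hV, hVQ⟩ := exists_unitary_extension (by omega) Qᴴ hQ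
    obtain ⟨W, hW, hWB⟩ := exists_unitary_extension (by omega) B hB
    let Z : Matrix.unitaryGroup (Fin (M + R)) ℂ := ⟨W * Vᴴ, by
      rw [mem_unitaryGroup_iff, star_eq_conjTranspose, conjTranspose_mul,
        conjTranspose_conjTranspose, Matrix.mul_assoc, ← Matrix.mul_assoc Vᴴ, hV, Matrix.one_mul]
      exact mul_eq_one_comm.1 hW⟩
    have hZ : Bᴴ * (Z : Matrix (Fin (M + R)) (Fin (M + R)) ℂ) = Q := by
      let E : Matrix (Fin (M + R)) (Fin M) ℂ := (1 : Matrix (Fin (M + R)) (Fin (M + R)) ℂ).submatrix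
        id (Fin.castLE (by omega))
      have hb : B = W * E := by
        ext i j
        rw [← hWB i j]
        simp only [E]
        simp [Matrix.mul_apply, Matrix.one_apply]
      have hq : Qᴴ = V * E := by
        ext i j
        rw [← hVQ i j]
        simp only [E]
        simp [Matrix.mul_apply, Matrix.one_apply]
      change Bᴴ * (W * Vᴴ) = Q
      rw [hb, conjTranspose_mul, Matrix.mul_assoc, ← Matrix.mul_assoc Wᴴ, hW, Matrix.one_mul,
        ← conjTranspose_mul, ← hq, conjTranspose_conjTranspose]
    have hp : ∀ U : Matrix.unitaryGroup (Fin (M + R)) ℂ,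
        gdet k (pr (M := M) (Matrix.of A * (U : Matrix (Fin (M + R)) (Fin (M + R)) ℂ))) =
        gdet k A * gdet k (pr (M := M) (Bᴴ *
          ((Z * U : Matrix.unitaryGroup (Fin (M + R)) ℂ) : Matrix (Fin (M + R)) (Fin (M + R)) ℂ))) := by
      intro U
      have e1 : Bᴴ * ((Z * U : Matrix.unitaryGroup (Fin (M + R)) ℂ) :
          Matrix (Fin (M + R)) (Fin (M + R)) ℂ) = Q * (U : Matrix (Fin (M + R)) (Fin (M + R)) ℂ) := by
        rw [← hZ, Matrix.mul_assoc]
        rfl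
      rw [e1, hSQ, Matrix.mul_assoc]
      have e2 := gdet_mul k S (pr (M := M) (Q * (U : Matrix (Fin (M + R)) (Fin (M + R)) ℂ)))
      rw [← hS] at e2
      exact e2
    simp only [hp]
    have hmeas : Measurable (fun U : Matrix.unitaryGroup (Fin (M + R)) ℂ =>
        gdet k (pr (M := M) (Bᴴ * (U : Matrix (Fin (M + R)) (Fin (M + R)) ℂ)))) :=
      measurable_const_mul' k M (M + R) R (Fin.natAdd M) Bᴴ
    have hmeas2 := hmeas.comp (measurable_const_mul Z)
    simp only [Function.comp_def] at hmeas2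
    rw [lintegral_const_mul _ hmeas2]
    congr 1
    exact lintegral_mul_left_eq_self (μ := μ) (fun U : Matrix.unitaryGroup (Fin (M + R)) ℂ =>
        gdet k (pr (M := M) (Bᴴ * (U : Matrix (Fin (M + R)) (Fin (M + R)) ℂ)))) Z

lemma haar_moment (k M R : ℕ) (B : Matrix (Fin (M + R)) (Fin M) ℂ) (hB : Bᴴ * B = 1)
    (μ : Measure (Matrix.unitaryGroup (Fin (M + R)) ℂ))
    [IsProbabilityMeasure μ] [μ.IsMulLeftInvariant] :
    ∫⁻ A, gdet k A ∂(gm M R) = (∫⁻ A, gdet k A ∂(gm M (M + R))) *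
        ∫⁻ U, gdet k (pr (M := M) (Bᴴ * (U : Matrix (Fin (M + R)) (Fin (M + R)) ℂ))) ∂μ := by
  have h1 : ∀ U : Matrix.unitaryGroup (Fin (M + R)) ℂ,
      ∫⁻ A, gdet k (pr (M := M) (Matrix.of A * (U : Matrix (Fin (M + R)) (Fin (M + R)) ℂ)))
        ∂(gm M (M + R)) = ∫⁻ A, gdet k A ∂(gm M R) := by
    intro U
    have hU : (U : Matrix (Fin (M + R)) (Fin (M + R)) ℂ) * (U : Matrix _ _ ℂ)ᴴ = 1 :=
      mem_unitaryGroup_iff.1 U.2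
    have hmp := (gm_restrict M (M + R) R (Fin.natAdd M) (Fin.natAdd_injective R M)).comp
      (gm_vecMul M (M + R) U hU)
    exact hmp.lintegral_comp (gdet_measurable k M R)
  calc _ = ∫⁻ U, ∫⁻ A, gdet k (pr (M := M) (Matrix.of A *
        (U : Matrix (Fin (M + R)) (Fin (M + R)) ℂ))) ∂(gm M (M + R)) ∂μ := by
        simp only [h1, lintegral_const, measure_univ, mul_one]
    _ = ∫⁻ A, ∫⁻ U, gdet k (pr (M := M) (Matrix.of A *
        (U : Matrix (Fin (M + R)) (Fin (M + R)) ℂ))) ∂μ ∂(gm M (M + R)) :=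
        lintegral_lintegral_swap (measurable_joint k M R).aemeasurable
    _ = _ := by
        simp only [haar_orbit k M R B hB μ]
        rw [lintegral_mul_const _ (gdet_measurable k _ _)]

lemma one_sub_eq (M R : ℕ) (B : Matrix (Fin (M + R)) (Fin M) ℂ) (hB : Bᴴ * B = 1)
    (U : Matrix (Fin (M + R)) (Fin (M + R)) ℂ) (hU : U * Uᴴ = 1) :
    1 - Bᴴ * (U * stdFrame (M + R) M) * (U * stdFrame (M + R) M)ᴴ * B =
      Matrix.of (pr (M := M) (Bᴴ * U)) * (Matrix.of (pr (M := M) (Bᴴ * U)))ᴴ := by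
  have h1 : (Bᴴ * U) * (Bᴴ * U)ᴴ = 1 := by
    rw [conjTranspose_mul, Matrix.mul_assoc, ← Matrix.mul_assoc U, hU, Matrix.one_mul,
      conjTranspose_conjTranspose, hB]
  have h2 : Bᴴ * (U * stdFrame (M + R) M) * (U * stdFrame (M + R) M)ᴴ * B =
      ((Bᴴ * U) * stdFrame (M + R) M) * ((Bᴴ * U) * stdFrame (M + R) M)ᴴ := by
    simp only [conjTranspose_mul, Matrix.mul_assoc, conjTranspose_conjTranspose]
  rw [h2, ← h1]
  set Y := Bᴴ * U
  have h3 : ∀ i j, (Y * stdFrame (M + R) M) i j = Y i (Fin.castAdd R j) := by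
    intro i j
    rw [Matrix.mul_apply, Finset.sum_eq_single (Fin.castAdd R j)]
    · simp [stdFrame]
    · intro b _ hb
      have : (b : ℕ) ≠ (j : ℕ) := fun h => hb (Fin.ext h)
      simp [stdFrame, this]
    · simp
  ext i j
  rw [Matrix.sub_apply, Matrix.mul_apply, Matrix.mul_apply, Matrix.mul_apply, Fin.sum_univ_add]
  simp only [conjTranspose_apply, h3, Matrix.of_apply, pr]
  ring

lemma det_mem (M : ℕ) (X : Matrix (Fin M) (Fin M) ℂ) (hX : X.PosSemidef)
    (hY : (1 - X).PosSemidef) : 0 ≤ X.det.re ∧ X.det.re ≤ 1 ∧ ((X.det.re : ℝ) : ℂ) = X.det := by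
  have h := hX.1.det_eq_prod_eigenvalues
  have h' : X.det = ((∏ i, hX.1.eigenvalues i : ℝ) : ℂ) := by
    rw [h]; push_cast; rfl
  have hle : ∀ i, hX.1.eigenvalues i ≤ 1 := by
    intro i
    have h1 := hY.re_dotProduct_nonneg (hX.1.eigenvectorBasis i : Fin M → ℂ)
    rw [sub_mulVec, one_mulVec, dotProduct_sub, map_sub, ← hX.1.eigenvalues_eq] at h1
    have h2 : RCLike.re (star (hX.1.eigenvectorBasis i : Fin M → ℂ) ⬝ᵥ
        (hX.1.eigenvectorBasis i : Fin M → ℂ)) = 1 := by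
      have h3 := hX.1.eigenvectorBasis.orthonormal.1 i
      have h4 := inner_self_eq_norm_sq (𝕜 := ℂ) (hX.1.eigenvectorBasis i)
      rw [h3, EuclideanSpace.inner_eq_star_dotProduct, dotProduct_comm] at h4
      simpa using h4
    linarith
  rw [h', Complex.ofReal_re]
  refine ⟨Finset.prod_nonneg fun i _ => hX.eigenvalues_nonneg i,
    Finset.prod_le_one (fun i _ => hX.eigenvalues_nonneg i) (fun i _ => hle i), rfl⟩

end CPD

namespace CPD

open scoped ENNReal ComplexOrder

/-- The real determinant under study is `det (X Xᴴ)` with `X` the last columns of `Bᴴ U`. -/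
lemma chordal_facts (M R : ℕ) (B : Matrix (Fin (M + R)) (Fin M) ℂ) (hB : Bᴴ * B = 1)
    (U : Matrix (Fin (M + R)) (Fin (M + R)) ℂ) (hU : U * Uᴴ = 1) :
    (1 - Bᴴ * (U * stdFrame (M + R) M) * (U * stdFrame (M + R) M)ᴴ * B).det.re ∈
      Set.Icc (0 : ℝ) 1 ∧ ∀ k : ℕ,
    ‖(1 - Bᴴ * (U * stdFrame (M + R) M) * (U * stdFrame (M + R) M)ᴴ * B).det.re‖ₑ ^ k =
      gdet k (pr (M := M) (Bᴴ * U)) := by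
  have h1 := one_sub_eq M R B hB U hU
  have hX : (1 - Bᴴ * (U * stdFrame (M + R) M) *
      (U * stdFrame (M + R) M)ᴴ * B).PosSemidef := by
    rw [h1]
    exact posSemidef_self_mul_conjTranspose _
  have hY : (1 - (1 - Bᴴ * (U * stdFrame (M + R) M) *
      (U * stdFrame (M + R) M)ᴴ * B)).PosSemidef := by
    have e : 1 - (1 - Bᴴ * (U * stdFrame (M + R) M) * (U * stdFrame (M + R) M)ᴴ * B) =
        (Bᴴ * (U * stdFrame (M + R) M)) * (Bᴴ * (U * stdFrame (M + R) M))ᴴ := by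
      rw [sub_sub_cancel, conjTranspose_mul Bᴴ, conjTranspose_conjTranspose]
      simp only [Matrix.mul_assoc]
    rw [e]
    exact posSemidef_self_mul_conjTranspose _
  obtain ⟨ha, hb, hc⟩ := det_mem M _ hX hY
  refine ⟨⟨ha, hb⟩, fun k => ?_⟩
  rw [gdet, ← h1]
  congr 1
  conv_rhs => rw [← hc]
  rw [← ofReal_norm, ← ofReal_norm, Complex.norm_real]

lemma chordal_measurable (T M : ℕ) (B : Matrix (Fin T) (Fin M) ℂ) :
    Measurable (fun U : Matrix.unitaryGroup (Fin T) ℂ =>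
        ((1 - Bᴴ * ((U : Matrix (Fin T) (Fin T) ℂ) * stdFrame T M) *
            ((U : Matrix (Fin T) (Fin T) ℂ) * stdFrame T M)ᴴ * B).det).re) := by
  have hc : Continuous (fun p : (Fin T → Fin T → ℂ) =>
      ((1 - Bᴴ * (Matrix.of p * stdFrame T M) * (Matrix.of p * stdFrame T M)ᴴ * B).det).re) := by
    have h2 : Continuous (fun p : (Fin T → Fin T → ℂ) => Matrix.of p) := continuous_id
    have h3 := h2.matrix_mul (continuous_const (y := stdFrame T M))
    have h4 := (((continuous_const (y := Bᴴ)).matrix_mul h3).matrix_mul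
      h3.matrix_conjTranspose).matrix_mul (continuous_const (y := B))
    exact Complex.continuous_re.comp
      ((continuous_const (y := (1 : Matrix (Fin M) (Fin M) ℂ))).sub h4).matrix_det
  have h6 := hc.measurable.comp (measurable_coe_unitary T)
  have e0 : ∀ X : Matrix (Fin T) (Fin T) ℂ, Matrix.of (fun i j => X i j) = X := fun X => rfl
  simp only [Function.comp_def, e0] at h6
  exact h6

lemma mm_ne (k N : ℕ) (hN : 0 < N) : mm k N ≠ 0 := by
  have h1 : (0 : ℝ) < N := by exact_mod_cast hN
  have h2 : 0 < Real.Gamma ((N : ℝ) + k) := Real.Gamma_pos_of_pos (by positivity)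
  have h3 : 0 < Real.Gamma (N : ℝ) := Real.Gamma_pos_of_pos h1
  rw [mm, ← pos_iff_ne_zero, ENNReal.ofReal_pos]
  positivity

lemma mm_beta (k M R : ℕ) (hM : 0 < M) (hMR : M ≤ R) (j : Fin M) (a : ℝ)
    (ha : a = (R : ℝ) - (j : ℕ)) :
    mm k (R - j) = mm k (M + R - j) * ∫⁻ x, ‖x‖ₑ ^ k ∂(_root_.betaMeasure a M) := by
  have hj := j.2
  have e1 : ((R - (j : ℕ) : ℕ) : ℝ) = a := by
    rw [Nat.cast_sub (by omega), ha]
  have e2 : ((M + R - (j : ℕ) : ℕ) : ℝ) = a + M := by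
    rw [Nat.cast_sub (by omega), ha]
    push_cast
    ring
  have ha0 : 0 < a := by
    rw [← e1]
    exact_mod_cast (by omega : 0 < R - (j : ℕ))
  have hM0 : (0 : ℝ) < M := by exact_mod_cast hM
  rw [beta_moment a M ha0 hM0, mm, mm, e1, e2]
  have g1 : 0 < Real.Gamma a := Real.Gamma_pos_of_pos ha0
  have g2 : 0 < Real.Gamma (a + M) := Real.Gamma_pos_of_pos (by positivity)
  have g3 : 0 < Real.Gamma (a + M + k) := Real.Gamma_pos_of_pos (by positivity)
  rw [← ENNReal.ofReal_mul (by positivity)]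
  congr 1
  field_simp

lemma main_aux (M R : ℕ) (hM : 0 < M) (hMR : M ≤ R)
    (B : Matrix (Fin (M + R)) (Fin M) ℂ) (hB : Bᴴ * B = 1)
    (μ : Measure (Matrix.unitaryGroup (Fin (M + R)) ℂ))
    [IsProbabilityMeasure μ] [μ.IsMulLeftInvariant] (a : Fin M → ℝ)
    (ha : ∀ j : Fin M, a j = (R : ℝ) - (j : ℕ)) :
    μ.map (fun U : Matrix.unitaryGroup (Fin (M + R)) ℂ =>
        ((1 - Bᴴ * ((U : Matrix (Fin (M + R)) (Fin (M + R)) ℂ) * stdFrame (M + R) M) *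
          ((U : Matrix (Fin (M + R)) (Fin (M + R)) ℂ) * stdFrame (M + R) M)ᴴ * B).det).re)
      = (Measure.pi fun m : Fin M => _root_.betaMeasure (a m) M).map
          (fun z : Fin M → ℝ => ∏ m, z m) := by
  have hM0 : (0 : ℝ) < M := by exact_mod_cast hM
  have ha0 : ∀ j, 0 < a j := by
    intro j
    rw [ha, sub_pos]
    exact_mod_cast (by have := j.2; omega : (j : ℕ) < R)
  have hprob : ∀ j, IsProbabilityMeasure (_root_.betaMeasure (a j) M) :=
    fun j => beta_prob _ _ (ha0 j) hM0
  have hmU := chordal_measurable (M + R) M B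
  have hmz : Measurable (fun z : Fin M → ℝ => ∏ m, z m) := by fun_prop
  have hUU : ∀ U : Matrix.unitaryGroup (Fin (M + R)) ℂ,
      (U : Matrix (Fin (M + R)) (Fin (M + R)) ℂ) * (U : Matrix (Fin (M + R)) (Fin (M + R)) ℂ)ᴴ = 1 :=
    fun U => mem_unitaryGroup_iff.1 U.2
  have hs : MeasurableSet (Set.Icc (0 : ℝ) 1) := measurableSet_Icc
  have := Measure.isProbabilityMeasure_map (μ := μ) hmU.aemeasurable
  have := Measure.isProbabilityMeasure_map
    (μ := Measure.pi fun m : Fin M => _root_.betaMeasure (a m) M) hmz.aemeasurable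
  apply ext_of_moments
  · refine (ae_map_iff hmU.aemeasurable hs).2 (Filter.Eventually.of_forall fun U => ?_)
    exact (chordal_facts M R B hB U (hUU U)).1
  · refine (ae_map_iff hmz.aemeasurable hs).2 ?_
    have h1 : ∀ j : Fin M, ∀ᵐ z ∂(Measure.pi fun m : Fin M => _root_.betaMeasure (a m) M),
        z j ∈ Set.Icc (0 : ℝ) 1 := fun j =>
      (Measure.quasiMeasurePreserving_eval
        (μ := fun m : Fin M => _root_.betaMeasure (a m) M) j).ae (beta_ae (a j) M)
    filter_upwards [ae_all_iff.2 h1] with z hz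
    exact ⟨Finset.prod_nonneg fun i _ => (hz i).1,
      Finset.prod_le_one (fun i _ => (hz i).1) (fun i _ => (hz i).2)⟩
  · intro k
    have hme : Measurable (fun x : ℝ => ‖x‖ₑ ^ k) := by fun_prop
    rw [lintegral_map hme hmU, lintegral_map hme hmz]
    have hl : ∫⁻ U : Matrix.unitaryGroup (Fin (M + R)) ℂ,
        ‖((1 - Bᴴ * ((U : Matrix (Fin (M + R)) (Fin (M + R)) ℂ) * stdFrame (M + R) M) *
          ((U : Matrix (Fin (M + R)) (Fin (M + R)) ℂ) * stdFrame (M + R) M)ᴴ * B).det).re‖ₑ ^ k ∂μ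
        = ∫⁻ U, gdet k (pr (M := M) (Bᴴ * (U : Matrix (Fin (M + R)) (Fin (M + R)) ℂ))) ∂μ :=
      lintegral_congr fun U => (chordal_facts M R B hB U (hUU U)).2 k
    have hr : ∀ z : Fin M → ℝ, ‖∏ m, z m‖ₑ ^ k = ∏ m, ‖z m‖ₑ ^ k := by
      intro z
      rw [Finset.prod_pow]
      congr 1
      simp only [← ofReal_norm, norm_prod]
      rw [ENNReal.ofReal_prod_of_nonneg fun i _ => norm_nonneg _]
    simp only [hr]
    rw [hl, lintegral_pi_prod M _ (fun _ x => ‖x‖ₑ ^ k) (fun _ => hme)]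
    have hh := haar_moment k M R B hB μ
    rw [gdet_integral k M R hMR, gdet_integral k M (M + R) (by omega),
      Finset.prod_congr rfl fun j _ => mm_beta k M R hM hMR j (a j) (ha j),
      Finset.prod_mul_distrib] at hh
    refine ((ENNReal.mul_right_inj ?_ ?_).1 hh).symm
    · exact Finset.prod_ne_zero_iff.2 fun j _ => mm_ne k _ (by have := j.2; omega)
    · exact ENNReal.prod_ne_top fun j _ => ENNReal.ofReal_ne_top

end CPD


theorem chordal_product_distribution
    (T M : ℕ) (hT : 0 < T) (hM : 0 < M) (hTM : 2 * M ≤ T)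
    (B : Matrix (Fin T) (Fin M) ℂ) (hB : Bᴴ * B = 1)
    (μ : Measure (Matrix.unitaryGroup (Fin T) ℂ))
    [IsProbabilityMeasure μ] [μ.IsMulLeftInvariant] :
    μ.map (fun U : Matrix.unitaryGroup (Fin T) ℂ =>
        ((1 - Bᴴ * ((U : Matrix (Fin T) (Fin T) ℂ) * stdFrame T M) *
            ((U : Matrix (Fin T) (Fin T) ℂ) * stdFrame T M)ᴴ * B).det).re)
      = (Measure.pi fun m : Fin M =>
            betaMeasure ((T : ℝ) - M + 1 - ((m : ℕ) + 1)) M).map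
          (fun z : Fin M → ℝ => ∏ m, z m) := by
  obtain ⟨R, rfl⟩ : ∃ R, T = M + R := ⟨T - M, by omega⟩
  refine CPD.main_aux M R hM (by omega) B hB μ _ fun j => ?_
  push_cast
  ring
end

section
/- Let T, M, N, K be positive integers with T ≥ 2M, N ≤ T − 2M and K ≥ 2. Let μ be the Haar probability measure on U(T), and let U_1, …, U_K be independent and Haar-distributed. Then the expected value of the chordal product energy with parameter N of the random code formed by the column spans of U_1E, …, U_KE equals ∫_{U(T)^K} ∑_{i≠j} det(I_M − (U_iE)^H (U_jE)(U_jE)^H (U_iE))^{−N} dμ(U_1)⋯dμ(U_K) = K(K−1) ∏_{m=1}^{M} [(T−m)! (T−N−m−M)!] / [(T−m−M)! (T−N−m)!]. -/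
open Matrix MeasureTheory

/-- Density of the standard complex Gaussian. -/
noncomputable def gdens (z : ℂ) : ℝ := Real.pi⁻¹ * Real.exp (-‖z‖ ^ 2)

lemma gdens_nonneg (z : ℂ) : 0 ≤ gdens z := by unfold gdens; positivity

lemma gdens_continuous : Continuous gdens := by unfold gdens; fun_prop

lemma gdens_integral : ∫ z, gdens z = 1 := by
  have h := Complex.integral_exp_neg_rpow (p := 2) (by norm_num)
  have h2 : ∫ x : ℂ, Real.exp (-‖x‖ ^ 2) = Real.pi := by
    have : Real.Gamma (2 / 2 + 1) = 1 := by norm_num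
    rw [this, mul_one] at h
    rw [← h]; congr 1; ext x; norm_num
  unfold gdens
  rw [integral_const_mul, h2, inv_mul_cancel₀ Real.pi_ne_zero]

lemma gdens_integrable : Integrable gdens := by
  by_contra h
  have := integral_undef h
  rw [gdens_integral] at this
  norm_num at this

/-- Standard complex Gaussian measure. -/
noncomputable def gmeas : Measure ℂ := volume.withDensity fun z => ENNReal.ofReal (gdens z)

instance : IsProbabilityMeasure gmeas := ⟨by
  unfold gmeas
  rw [withDensity_apply _ MeasurableSet.univ, Measure.restrict_univ,
    ← ofReal_integral_eq_lintegral_ofReal gdens_integrable (ae_of_all _ gdens_nonneg),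
    gdens_integral, ENNReal.ofReal_one]⟩

/-- Standard complex Gaussian on `ι → ℂ`. -/
noncomputable abbrev gpi (ι : Type) [Fintype ι] : Measure (ι → ℂ) := Measure.pi fun _ : ι => gmeas

lemma gpi_eq (ι : Type) [Fintype ι] :
    gpi ι = volume.withDensity fun z => ENNReal.ofReal (∏ i, gdens (z i)) := by
  refine Measure.pi_eq fun s hs => ?_
  rw [withDensity_apply _ (MeasurableSet.univ_pi hs), ← lintegral_indicator (MeasurableSet.univ_pi hs)]
  have hIntg : ∀ i, Integrable ((s i).indicator gdens) := fun i =>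
    gdens_integrable.indicator (hs i)
  have hnn : ∀ i z, 0 ≤ (s i).indicator gdens z := fun i z =>
    Set.indicator_nonneg (fun z _ => gdens_nonneg z) z
  have h1 : ∀ z : ι → ℂ, (Set.univ.pi s).indicator (fun z => ENNReal.ofReal (∏ i, gdens (z i))) z
      = ENNReal.ofReal (∏ i, (s i).indicator gdens (z i)) := by
    intro z
    by_cases hz : z ∈ Set.univ.pi s
    · rw [Set.indicator_of_mem hz]
      congr 1
      refine Finset.prod_congr rfl fun i _ => ?_
      rw [Set.indicator_of_mem (hz i (Set.mem_univ i))]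
    · rw [Set.indicator_of_notMem hz]
      simp only [Set.mem_univ_pi, not_forall] at hz
      obtain ⟨i, hi⟩ := hz
      rw [Finset.prod_eq_zero (Finset.mem_univ i) (Set.indicator_of_notMem hi _)]
      simp
  simp_rw [h1]
  have hI : Integrable (fun z : ι → ℂ => ∏ i, (s i).indicator gdens (z i)) volume :=
    Integrable.fintype_prod hIntg
  rw [← ofReal_integral_eq_lintegral_ofReal hI
    (ae_of_all _ fun z => Finset.prod_nonneg fun i _ => hnn i _),
    integral_fintype_prod_volume_eq_prod (fun i => (s i).indicator gdens),
    ENNReal.ofReal_prod_of_nonneg (fun i _ => integral_nonneg (hnn i))]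
  refine Finset.prod_congr rfl fun i _ => ?_
  rw [ofReal_integral_eq_lintegral_ofReal (hIntg i) (ae_of_all _ (hnn i))]
  unfold gmeas
  rw [withDensity_apply _ (hs i), ← lintegral_indicator (hs i)]
  congr 1; ext z
  by_cases hz : z ∈ s i <;> simp [hz]

lemma gdens_prod {ι : Type} [Fintype ι] (z : ι → ℂ) :
    ∏ i, gdens (z i) = Real.pi⁻¹ ^ (Fintype.card ι) * Real.exp (-∑ i, ‖z i‖ ^ 2) := by
  unfold gdens
  rw [Finset.prod_mul_distrib, ← Real.exp_sum]
  simp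

lemma sum_norm_sq_eq {ι : Type} [Fintype ι] (z : ι → ℂ) :
    ((∑ i, ‖z i‖ ^ 2 : ℝ) : ℂ) = star z ⬝ᵥ z := by
  simp only [dotProduct, Pi.star_apply, Complex.ofReal_sum]
  refine Finset.sum_congr rfl fun i _ => ?_
  rw [Complex.star_def, ← Complex.normSq_eq_conj_mul_self, Complex.normSq_eq_norm_sq]

lemma unitary_norm_sq {ι : Type} [Fintype ι] [DecidableEq ι] (V : Matrix ι ι ℂ)
    (hV : Vᴴ * V = 1) (z : ι → ℂ) : ∑ i, ‖(V *ᵥ z) i‖ ^ 2 = ∑ i, ‖z i‖ ^ 2 := by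
  have : ((∑ i, ‖(V *ᵥ z) i‖ ^ 2 : ℝ) : ℂ) = ((∑ i, ‖z i‖ ^ 2 : ℝ) : ℂ) := by
    rw [sum_norm_sq_eq, sum_norm_sq_eq, star_mulVec, ← dotProduct_mulVec, mulVec_mulVec, hV,
      one_mulVec]
  exact_mod_cast this

lemma gpi_unitary {ι : Type} [Fintype ι] [DecidableEq ι] (V : Matrix ι ι ℂ)
    (hV : Vᴴ * V = 1) : MeasurePreserving (fun z => V *ᵥ z) (gpi ι) (gpi ι) := by
  have hm : Measurable (fun z : ι → ℂ => V *ᵥ z) := by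
    refine Continuous.measurable ?_
    fun_prop
  refine ⟨hm, ?_⟩
  have hV' : V * Vᴴ = 1 := mul_eq_one_comm.mp hV
  let L : (ι → ℂ) ≃ₗ[ℝ] (ι → ℂ) :=
    { toFun := fun z => V *ᵥ z
      invFun := fun z => Vᴴ *ᵥ z
      map_add' := fun x y => mulVec_add _ _ _
      map_smul' := fun c x => mulVec_smul _ _ _
      left_inv := fun z => by simp [mulVec_mulVec, hV]
      right_inv := fun z => by simp [mulVec_mulVec, hV'] }
  have hdet : LinearMap.det (L : (ι → ℂ) →ₗ[ℝ] (ι → ℂ)) ≠ 0 := (LinearEquiv.isUnit_det' L).ne_zero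
  have hmap := Measure.map_linearMap_addHaar_eq_smul_addHaar (volume : Measure (ι → ℂ)) hdet
  set c := ENNReal.ofReal |(LinearMap.det (L : (ι → ℂ) →ₗ[ℝ] (ι → ℂ)))⁻¹|
  have hLfun : ((L : (ι → ℂ) →ₗ[ℝ] (ι → ℂ)) : (ι → ℂ) → (ι → ℂ)) = fun z => V *ᵥ z := rfl
  rw [hLfun] at hmap
  have hdm : Measurable fun z : ι → ℂ => ENNReal.ofReal (∏ i, gdens (z i)) := by
    have := gdens_continuous
    refine ENNReal.measurable_ofReal.comp (Continuous.measurable ?_)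
    fun_prop
  have key : Measure.map (fun z => V *ᵥ z) (gpi ι) = c • gpi ι := by
    rw [gpi_eq]
    ext s hs
    rw [Measure.map_apply hm hs, Measure.smul_apply, withDensity_apply _ (hm hs),
      withDensity_apply _ hs, ← lintegral_smul_measure, ← Measure.restrict_smul,
      ← hmap, ← lintegral_indicator (hm hs), ← lintegral_indicator hs,
      lintegral_map (hdm.indicator hs) hm]
    congr 1; ext z
    simp only [Set.indicator, Set.mem_preimage, gdens_prod, unitary_norm_sq V hV]
    rfl
  have hc : c = 1 := by
    have := congrArg (fun m => m Set.univ) key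
    simp only [Measure.map_apply hm MeasurableSet.univ, Set.preimage_univ, measure_univ,
      Measure.smul_apply, smul_eq_mul, mul_one] at this
    exact this.symm
  rw [key, hc, one_smul]

lemma radial_integral (ι : Type) [Fintype ι] [Nonempty ι] :
    ∃ C : ℝ, C ≠ 0 ∧ ∀ N : ℕ, N < Fintype.card ι →
      ∫ z : ι → ℂ, ((∑ i, ‖z i‖ ^ 2) ^ N)⁻¹ * Real.exp (-∑ i, ‖z i‖ ^ 2)
        = C * ((Fintype.card ι - 1 - N).factorial : ℝ) := by
  let e := (PiLp.continuousLinearEquiv 2 ℝ (fun _ : ι => ℂ)).symm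
  have hemb : MeasurableEmbedding e := e.toHomeomorph.measurableEmbedding
  let m : Measure (EuclideanSpace ℂ ι) := Measure.map e volume
  have : m.IsAddHaarMeasure := e.isAddHaarMeasure_map volume
  have hdim : Module.finrank ℝ (EuclideanSpace ℂ ι) = 2 * Fintype.card ι := by
    rw [finrank_real_of_complex]; simp
  have hnorm : ∀ z : ι → ℂ, ‖e z‖ ^ 2 = ∑ i, ‖z i‖ ^ 2 := fun z => by
    rw [EuclideanSpace.norm_sq_eq]; rfl
  set k := Fintype.card ι with hk
  have hball : m.real (Metric.ball 0 1) ≠ 0 := by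
    have h1 : m (Metric.ball 0 1) ≠ 0 := (Metric.measure_ball_pos m 0 one_pos).ne'
    have h2 : m (Metric.ball 0 1) ≠ ⊤ := measure_ball_lt_top.ne
    simp [Measure.real, ENNReal.toReal_eq_zero_iff, h1, h2]
  refine ⟨(2 * k : ℕ) * m.real (Metric.ball 0 1) * (1 / 2), ?_, ?_⟩
  · have : (2 * k : ℕ) ≠ 0 := by
      have := Fintype.card_pos (α := ι)
      omega
    have : ((2 * k : ℕ) : ℝ) ≠ 0 := by exact_mod_cast this
    positivity
  intro N hN
  have h1 : ∫ z : ι → ℂ, ((∑ i, ‖z i‖ ^ 2) ^ N)⁻¹ * Real.exp (-∑ i, ‖z i‖ ^ 2)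
      = ∫ x, (fun r : ℝ => ((r ^ 2) ^ N)⁻¹ * Real.exp (- r ^ 2)) ‖x‖ ∂m := by
    rw [hemb.integral_map]
    simp only [hnorm]
  rw [h1, integral_fun_norm_addHaar m (fun r : ℝ => ((r ^ 2) ^ N)⁻¹ * Real.exp (- r ^ 2)), hdim]
  have h2 : ∫ y in Set.Ioi (0 : ℝ), y ^ (2 * k - 1) • (((y ^ 2) ^ N)⁻¹ * Real.exp (- y ^ 2))
      = (1 / 2) * ((k - 1 - N).factorial : ℝ) := by
    have h3 := integral_rpow_mul_exp_neg_rpow (p := 2) (q := ((2 * (k - 1 - N) + 1 : ℕ) : ℝ))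
      (by norm_num) (by have : (0:ℝ) ≤ ((2 * (k - 1 - N) + 1 : ℕ) : ℝ) := by positivity
                        linarith)
    have h4 : ((((2 * (k - 1 - N) + 1 : ℕ) : ℝ)) + 1) / 2 = ((k - 1 - N : ℕ) : ℝ) + 1 := by
      push_cast; ring
    rw [h4, Real.Gamma_nat_eq_factorial] at h3
    rw [← h3]
    refine setIntegral_congr_fun measurableSet_Ioi fun y hy => ?_
    have hy' : y ≠ 0 := ne_of_gt hy
    simp only [smul_eq_mul, Real.rpow_natCast, Real.rpow_two]
    have h5 : 2 * k - 1 = (2 * (k - 1 - N) + 1) + 2 * N := by omega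
    rw [h5, pow_add, pow_mul y 2 N, mul_assoc, mul_inv_cancel_left₀ (by positivity)]
  rw [h2]
  simp only [nsmul_eq_mul, smul_eq_mul]
  ring

/-- Negative moment of the squared norm of a Gaussian vector. -/
lemma gpi_moment (ι : Type) [Fintype ι] (N : ℕ) (hN : N < Fintype.card ι) :
    ∫⁻ z, ENNReal.ofReal ((∑ i, ‖z i‖ ^ 2) ^ N)⁻¹ ∂(gpi ι)
      = ENNReal.ofReal (((Fintype.card ι - 1 - N).factorial : ℝ)
          / ((Fintype.card ι - 1).factorial : ℝ)) := by
  have : Nonempty ι := Fintype.card_pos_iff.mp (by omega)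
  obtain ⟨C, hC, hIntg⟩ := radial_integral ι
  have hdm : Measurable fun z : ι → ℂ => ENNReal.ofReal (∏ i, gdens (z i)) := by
    have := gdens_continuous
    refine ENNReal.measurable_ofReal.comp (Continuous.measurable ?_)
    fun_prop
  have main : ∀ N, N < Fintype.card ι →
    ∫⁻ z, ENNReal.ofReal ((∑ i, ‖z i‖ ^ 2) ^ N)⁻¹ ∂(gpi ι)
      = ENNReal.ofReal (Real.pi⁻¹ ^ (Fintype.card ι) *
          (C * ((Fintype.card ι - 1 - N).factorial : ℝ))) := by
    intro N hN
    have hm : Measurable fun z : ι → ℂ => ENNReal.ofReal ((∑ i, ‖z i‖ ^ 2) ^ N)⁻¹ := by fun_prop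
    rw [gpi_eq, lintegral_withDensity_eq_lintegral_mul _ hdm hm, ← hIntg N hN, ← integral_const_mul,
      ofReal_integral_eq_lintegral_ofReal]
    · congr 1; ext z
      rw [Pi.mul_apply, ← ENNReal.ofReal_mul (Finset.prod_nonneg fun i _ => gdens_nonneg _),
        gdens_prod]
      congr 1; ring
    · refine Integrable.const_mul ?_ _
      by_contra h
      have h2 := hIntg N hN
      rw [integral_undef h] at h2
      have : ((Fintype.card ι - 1 - N).factorial : ℝ) ≠ 0 := by positivity
      exact (mul_ne_zero hC this) h2.symm
    · refine ae_of_all _ fun z => ?_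
      simp only [Pi.zero_apply]
      positivity
  have h0 := main 0 (by omega)
  simp only [pow_zero, inv_one, ENNReal.ofReal_one, lintegral_const, measure_univ, mul_one,
    Nat.sub_zero] at h0
  have h0' : Real.pi⁻¹ ^ (Fintype.card ι) * (C * ((Fintype.card ι - 1).factorial : ℝ)) = 1 := by
    have := congrArg ENNReal.toReal h0.symm
    rw [ENNReal.toReal_one] at this
    by_cases hp : 0 ≤ Real.pi⁻¹ ^ (Fintype.card ι) * (C * ((Fintype.card ι - 1).factorial : ℝ))
    · rwa [ENNReal.toReal_ofReal hp] at this
    · rw [ENNReal.ofReal_of_nonpos (le_of_not_ge hp)] at this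
      simp at this
  rw [main N hN]
  congr 1
  have hf : ((Fintype.card ι - 1).factorial : ℝ) ≠ 0 := by positivity
  rw [eq_div_iff hf]
  linear_combination ((Fintype.card ι - 1 - N).factorial : ℝ) * h0'

lemma proj_diag {ι : Type} [Fintype ι] [DecidableEq ι] (P : Matrix ι ι ℂ) (hP : P.IsHermitian)
    (hPP : P * P = P) (S : Finset ι) (htr : P.trace = S.card) :
    ∃ V : Matrix ι ι ℂ, Vᴴ * V = 1 ∧
      P = V * diagonal (fun i => if i ∈ S then (1 : ℂ) else 0) * Vᴴ := by
  obtain ⟨W, l, hWW', hsp'⟩ : ∃ (W : Matrix ι ι ℂ) (l : ι → ℝ), Wᴴ * W = 1 ∧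
      P = W * diagonal (fun i => (l i : ℂ)) * Wᴴ := by
    have hsp := hP.spectral_theorem
    rw [Unitary.conjStarAlgAut_apply] at hsp
    exact ⟨_, _, Unitary.star_mul_self_of_mem hP.eigenvectorUnitary.2, hsp⟩
  have hD : Wᴴ * P * W = diagonal (fun i => (l i : ℂ)) := by
    rw [hsp']
    simp only [Matrix.mul_assoc, hWW']
    rw [← Matrix.mul_assoc Wᴴ W, hWW', Matrix.one_mul, Matrix.mul_one]
  have hWW2 : W * Wᴴ = 1 := mul_eq_one_comm.mp hWW'
  have hDD : diagonal (fun i => (l i : ℂ)) * diagonal (fun i => (l i : ℂ))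
      = diagonal (fun i => (l i : ℂ)) := by
    have h1 : Wᴴ * P * W * (Wᴴ * P * W) = Wᴴ * (P * P) * W := by
      simp only [Matrix.mul_assoc]
      rw [← Matrix.mul_assoc W Wᴴ, hWW2, Matrix.one_mul]
    rw [hPP, hD] at h1
    exact h1
  have hl01 : ∀ i, l i = 0 ∨ l i = 1 := by
    intro i
    have h1 := congrFun (congrFun hDD i) i
    simp only [diagonal_mul_diagonal, diagonal_apply_eq] at h1
    have h2 : l i * l i = l i := by exact_mod_cast h1
    rcases eq_or_ne (l i) 0 with h | h
    · exact Or.inl h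
    · exact Or.inr (by simpa [h] using h2)
  have htr2 : ∑ i, (l i : ℂ) = S.card := by
    rw [← htr, hsp', Matrix.mul_assoc, Matrix.trace_mul_comm, Matrix.mul_assoc, hWW',
      Matrix.mul_one, trace_diagonal]
  have hcard : Fintype.card {i // i ∈ S} = Fintype.card {i // l i = 1} := by
    have h1 : ∑ i, (l i : ℂ) = ((Finset.univ.filter fun i => l i = 1).card : ℂ) := by
      rw [Finset.card_filter]
      push_cast
      refine Finset.sum_congr rfl fun i _ => ?_
      rcases hl01 i with h | h <;> simp [h]
    rw [h1] at htr2
    have h2 : (Finset.univ.filter fun i => l i = 1).card = S.card := by exact_mod_cast htr2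
    rw [Fintype.card_coe, ← h2, Fintype.card_subtype]
  let e : {i // i ∈ S} ≃ {i // l i = 1} := Fintype.equivOfCardEq hcard
  let σ : Equiv.Perm ι := e.extendSubtype
  have hσ : ∀ i, (l (σ i) : ℂ) = if i ∈ S then (1 : ℂ) else 0 := by
    intro i
    split_ifs with h
    · have := e.extendSubtype_mem i h
      exact_mod_cast this
    · have h1 := e.extendSubtype_not_mem i h
      rcases hl01 (σ i) with h2 | h2
      · exact_mod_cast h2
      · exact absurd h2 h1
  refine ⟨W.submatrix id σ, ?_, ?_⟩
  · have h1 : (W.submatrix id σ)ᴴ * W.submatrix id σ = (Wᴴ * W).submatrix σ σ := by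
      ext a b
      simp [mul_apply]
    rw [h1, hWW', submatrix_one_equiv]
  · rw [hsp']
    ext a b
    rw [mul_apply, mul_apply]
    simp only [mul_diagonal, submatrix_apply, id, conjTranspose_apply]
    rw [← Equiv.sum_comp σ]
    simp only [hσ]

lemma gram_proj {ι κ : Type} [Fintype ι] [DecidableEq ι] [Fintype κ] [DecidableEq κ]
    (G : Matrix ι κ ℂ) (hG : (Gᴴ * G).det ≠ 0) :
    (G * (Gᴴ * G)⁻¹ * Gᴴ).IsHermitian ∧
    (G * (Gᴴ * G)⁻¹ * Gᴴ) * (G * (Gᴴ * G)⁻¹ * Gᴴ) = G * (Gᴴ * G)⁻¹ * Gᴴ ∧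
    (G * (Gᴴ * G)⁻¹ * Gᴴ).trace = Fintype.card κ := by
  have hu : IsUnit (Gᴴ * G).det := isUnit_iff_ne_zero.mpr hG
  refine ⟨?_, ?_, ?_⟩
  · unfold IsHermitian
    simp only [conjTranspose_mul, conjTranspose_nonsing_inv, conjTranspose_conjTranspose,
      Matrix.mul_assoc]
  · have : (G * (Gᴴ * G)⁻¹ * Gᴴ) * (G * (Gᴴ * G)⁻¹ * Gᴴ)
        = G * (((Gᴴ * G)⁻¹ * (Gᴴ * G)) * ((Gᴴ * G)⁻¹ * Gᴴ)) := by
      simp only [Matrix.mul_assoc]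
    rw [this, nonsing_inv_mul _ hu, Matrix.one_mul, Matrix.mul_assoc]
  · rw [Matrix.mul_assoc, Matrix.trace_mul_comm, Matrix.mul_assoc, nonsing_inv_mul _ hu, trace_one]

lemma gpi_restrict {ι : Type} [Fintype ι] (p : ι → Prop) [DecidablePred p]
    [inst : Fintype (Subtype p)] :
    MeasurePreserving (fun (z : ι → ℂ) (i : Subtype p) => z i) (gpi ι) (gpi (Subtype p)) := by
  obtain rfl := Subsingleton.elim inst (Subtype.fintype p)
  have h1 := measurePreserving_piEquivPiSubtypeProd (fun _ : ι => gmeas) p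
  exact (measurePreserving_fst).comp h1

lemma gpi_proj_moment {ι : Type} [Fintype ι] [DecidableEq ι] (Q : Matrix ι ι ℂ)
    (hQ : Q.IsHermitian) (hQQ : Q * Q = Q) (k N : ℕ) (htr : Q.trace = k)
    (hk : k ≤ Fintype.card ι) (hN : N < k) :
    ∫⁻ z, ENNReal.ofReal ((star z ⬝ᵥ (Q *ᵥ z)).re ^ N)⁻¹ ∂(gpi ι)
      = ENNReal.ofReal (((k - 1 - N).factorial : ℝ) / ((k - 1).factorial : ℝ)) := by
  obtain ⟨S, -, hS⟩ := Finset.exists_subset_card_eq (s := (Finset.univ : Finset ι)) (n := k)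
    (by simpa using hk)
  obtain ⟨V, hV, hQV⟩ := proj_diag Q hQ hQQ S (by rw [htr, hS])
  have hV2 : V * Vᴴ = 1 := mul_eq_one_comm.mp hV
  have hcardS : Fintype.card {i // i ∈ S} = k := by rw [Fintype.card_coe, hS]
  have hval : ∀ z : ι → ℂ, (star z ⬝ᵥ (Q *ᵥ z)).re
      = ∑ i : {i // i ∈ S}, ‖(Vᴴ *ᵥ z) i‖ ^ 2 := by
    intro z
    have h1 : star z ⬝ᵥ (Q *ᵥ z) = star (Vᴴ *ᵥ z) ⬝ᵥ
        (diagonal (fun i => if i ∈ S then (1 : ℂ) else 0) *ᵥ (Vᴴ *ᵥ z)) := by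
      rw [hQV, star_mulVec, ← dotProduct_mulVec, conjTranspose_conjTranspose]
      simp only [mulVec_mulVec, Matrix.mul_assoc]
    have h2 : star z ⬝ᵥ (Q *ᵥ z) = ((∑ i : {i // i ∈ S}, ‖(Vᴴ *ᵥ z) i‖ ^ 2 : ℝ) : ℂ) := by
      rw [h1, Finset.sum_coe_sort S (fun i => ‖(Vᴴ *ᵥ z) i‖ ^ 2)]
      simp only [dotProduct, mulVec_diagonal, Pi.star_apply]
      rw [← Finset.sum_subset (Finset.subset_univ S)]
      · rw [Complex.ofReal_sum]
        refine Finset.sum_congr rfl fun i hi => ?_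
        rw [if_pos hi, one_mul, Complex.star_def, ← Complex.normSq_eq_conj_mul_self,
          Complex.normSq_eq_norm_sq]
      · intro i _ hi
        simp [hi]
    rw [h2, Complex.ofReal_re]
  have hm : Measurable fun w : {i // i ∈ S} → ℂ => ENNReal.ofReal ((∑ i, ‖w i‖ ^ 2) ^ N)⁻¹ := by
    fun_prop
  have hmp := (gpi_restrict (fun i => i ∈ S)).comp
    (gpi_unitary Vᴴ (by rw [conjTranspose_conjTranspose, hV2]))
  have h3 := gpi_moment {i // i ∈ S} N (by omega)
  rw [hcardS] at h3
  rw [← h3]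
  have h4 := hmp.lintegral_comp hm
  rw [← h4]
  simp only [hval]
  rfl

/-- The matrix with prescribed columns. -/
def colM {ι : Type} {M : ℕ} (G : Fin M → ι → ℂ) : Matrix ι (Fin M) ℂ := Matrix.of fun i j => G j i

/-- Inverse power of the (real part of the) determinant. -/
noncomputable def ipow {κ : Type} [Fintype κ] [DecidableEq κ] (N : ℕ) (A : Matrix κ κ ℂ) : ℝ :=
  (A.det.re ^ N)⁻¹

lemma continuous_colM {ι : Type} {M : ℕ} :
    Continuous (colM : (Fin M → ι → ℂ) → Matrix ι (Fin M) ℂ) := by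
  unfold colM
  refine continuous_matrix fun i j => ?_
  simp only [of_apply]
  fun_prop

lemma measurable_ipow {κ α : Type} [Fintype κ] [DecidableEq κ] [TopologicalSpace α]
    [MeasurableSpace α] [OpensMeasurableSpace α] (N : ℕ) (A : α → Matrix κ κ ℂ)
    (hA : Continuous A) : Measurable fun x => ENNReal.ofReal (ipow N (A x)) := by
  unfold ipow
  have h : Continuous fun x => (A x).det.re := Complex.continuous_re.comp hA.matrix_det
  exact ENNReal.measurable_ofReal.comp ((h.measurable.pow_const N).inv)

open ComplexOrder in
lemma gram_det_real {ι κ : Type} [Fintype ι] [Fintype κ] [DecidableEq κ] (G : Matrix ι κ ℂ) :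
    0 ≤ (Gᴴ * G).det.re ∧ ((Gᴴ * G).det.re : ℂ) = (Gᴴ * G).det := by
  have h := (posSemidef_conjTranspose_mul_self G).det_nonneg
  rw [Complex.le_def] at h
  refine ⟨h.1, ?_⟩
  apply Complex.ext
  · simp
  · simpa using h.2

/-- Block form of the Gram matrix of a vector and a family. -/
noncomputable def blockGram {ι : Type} [Fintype ι] {M : ℕ} (g : ι → ℂ) (G : Fin M → ι → ℂ) :
    Matrix (Fin M ⊕ PUnit) (Fin M ⊕ PUnit) ℂ :=
  fromBlocks ((colM G)ᴴ * colM G) ((colM G)ᴴ * replicateCol PUnit g)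
    ((replicateCol PUnit g)ᴴ * colM G) ((replicateCol PUnit g)ᴴ * replicateCol PUnit g)

lemma gram_succ {ι : Type} [Fintype ι] {M : ℕ} (G : Fin (M + 1) → ι → ℂ) :
    ((colM G)ᴴ * colM G).det = (blockGram (G 0) fun j => G j.succ).det := by
  let e : Fin (M + 1) ≃ Fin M ⊕ PUnit :=
    (finSuccEquiv M).trans (Equiv.optionEquivSumPUnit (Fin M))
  rw [← det_submatrix_equiv_self e.symm]
  congr 1
  ext a b
  rcases a with a | a <;> rcases b with b | b <;>
  simp [e, blockGram, mul_apply, colM, finSuccEquiv]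

lemma blockGram_det {ι : Type} [Fintype ι] [DecidableEq ι] {M : ℕ} (g : ι → ℂ)
    (G : Fin M → ι → ℂ) (hG : ((colM G)ᴴ * colM G).det ≠ 0) :
    (blockGram g G).det = ((colM G)ᴴ * colM G).det *
      (star g ⬝ᵥ ((1 - colM G * ((colM G)ᴴ * colM G)⁻¹ * (colM G)ᴴ) *ᵥ g)) := by
  have hu : IsUnit ((colM G)ᴴ * colM G).det := isUnit_iff_ne_zero.mpr hG
  let _ := invertibleOfIsUnitDet _ hu
  unfold blockGram
  rw [det_fromBlocks₁₁]
  congr 1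
  rw [invOf_eq_nonsing_inv]
  set B := ((colM G)ᴴ * colM G)⁻¹
  have : (replicateCol PUnit g)ᴴ * replicateCol PUnit g -
      (replicateCol PUnit g)ᴴ * colM G * B * ((colM G)ᴴ * replicateCol PUnit g)
      = (replicateCol PUnit g)ᴴ * ((1 - colM G * B * (colM G)ᴴ) * replicateCol PUnit g) := by
    rw [Matrix.sub_mul, Matrix.mul_sub, Matrix.one_mul]
    simp only [Matrix.mul_assoc]
  rw [this, ← replicateCol_mulVec, det_unique]
  simp [mul_apply, dotProduct]

open ComplexOrder in
lemma gram_null {ι κ : Type} [Fintype ι] [Fintype κ] [DecidableEq κ] (G : Matrix ι κ ℂ)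
    (hG : (Gᴴ * G).det = 0) : ∃ v, v ≠ 0 ∧ G *ᵥ v = 0 := by
  obtain ⟨v, hv, hv0⟩ := exists_mulVec_eq_zero_iff.mpr hG
  exact ⟨v, hv, (conjTranspose_mul_self_mulVec_eq_zero _ _).mp hv0⟩

lemma blockGram_det_zero {ι : Type} [Fintype ι] [DecidableEq ι] {M : ℕ} (g : ι → ℂ)
    (G : Fin M → ι → ℂ) (hG : ((colM G)ᴴ * colM G).det = 0) :
    (blockGram g G).det = 0 := by
  obtain ⟨v, hv, h1⟩ := gram_null _ hG
  refine exists_mulVec_eq_zero_iff.mp ⟨Sum.elim v 0, ?_, ?_⟩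
  · intro h
    apply hv
    ext i
    exact congrFun h (Sum.inl i)
  · unfold blockGram
    rw [fromBlocks_mulVec]
    simp only [Sum.elim_comp_inl, Sum.elim_comp_inr, ← mulVec_mulVec, h1, mulVec_zero, add_zero]
    ext i
    rcases i <;> rfl

/-- Inverse determinant moments of complex Wishart matrices. -/
lemma wishart {ι : Type} [Fintype ι] [DecidableEq ι] (N : ℕ) (hN0 : N ≠ 0) : ∀ M : ℕ, M + N ≤ Fintype.card ι →
    ∫⁻ G : Fin M → ι → ℂ, ENNReal.ofReal (ipow N ((colM G)ᴴ * colM G))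
        ∂(Measure.pi fun _ : Fin M => gpi ι)
      = ENNReal.ofReal (∏ m ∈ Finset.Icc 1 M,
          ((Fintype.card ι - m - N).factorial : ℝ) / ((Fintype.card ι - m).factorial : ℝ)) := by
  intro M
  induction M with
  | zero => intro _; simp [ipow]
  | succ M ih =>
    intro h
    have ih' := ih (by omega)
    have hmp := measurePreserving_piFinSuccAbove (fun _ : Fin (M + 1) => gpi ι) 0
    have hblk : Continuous fun x : (ι → ℂ) × (Fin M → ι → ℂ) => blockGram x.1 x.2 := by
      unfold blockGram
      have h1 : Continuous fun x : (ι → ℂ) × (Fin M → ι → ℂ) => colM x.2 :=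
        continuous_colM.comp continuous_snd
      have h2 : Continuous fun x : (ι → ℂ) × (Fin M → ι → ℂ) => replicateCol PUnit.{1} x.1 :=
        continuous_matrix fun i j => by simp only [replicateCol_apply]; fun_prop
      exact Continuous.matrix_fromBlocks (h1.matrix_conjTranspose.matrix_mul h1)
        (h1.matrix_conjTranspose.matrix_mul h2) (h2.matrix_conjTranspose.matrix_mul h1)
        (h2.matrix_conjTranspose.matrix_mul h2)
    have hmeas : Measurable fun x : (ι → ℂ) × (Fin M → ι → ℂ) =>
        ENNReal.ofReal (ipow N (blockGram x.1 x.2)) := measurable_ipow N _ hblk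
    have e1 : ∫⁻ G : Fin (M + 1) → ι → ℂ, ENNReal.ofReal (ipow N ((colM G)ᴴ * colM G))
          ∂(Measure.pi fun _ : Fin (M + 1) => gpi ι)
        = ∫⁻ x : (ι → ℂ) × (Fin M → ι → ℂ), ENNReal.ofReal (ipow N (blockGram x.1 x.2))
          ∂((gpi ι).prod (Measure.pi fun _ : Fin M => gpi ι)) := by
      rw [← hmp.lintegral_comp hmeas]
      refine lintegral_congr fun G => ?_
      unfold ipow
      rw [gram_succ]
      rfl
    rw [e1, lintegral_prod_symm' _ hmeas]
    have e2 : ∀ G : Fin M → ι → ℂ,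
        ∫⁻ g, ENNReal.ofReal (ipow N (blockGram g G)) ∂(gpi ι)
        = ENNReal.ofReal (ipow N ((colM G)ᴴ * colM G)) *
          ENNReal.ofReal (((Fintype.card ι - (M + 1) - N).factorial : ℝ) /
            ((Fintype.card ι - (M + 1)).factorial : ℝ)) := by
      intro G
      by_cases hG : ((colM G)ᴴ * colM G).det = 0
      · simp [ipow, blockGram_det_zero _ G hG, hG, hN0]
      · obtain ⟨hH, hI, hT⟩ := gram_proj (colM G) hG
        set P := colM G * ((colM G)ᴴ * colM G)⁻¹ * (colM G)ᴴ with hP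
        have hm := gpi_proj_moment (1 - P) (isHermitian_one.sub hH)
          (by rw [Matrix.mul_sub, Matrix.sub_mul, Matrix.sub_mul, hI]; simp)
          (Fintype.card ι - M) N
          (by rw [trace_sub, hT, trace_one, Nat.cast_sub (by omega)]; simp) (by omega) (by omega)
        have h1 : Fintype.card ι - M - 1 - N = Fintype.card ι - (M + 1) - N := by omega
        have h2 : Fintype.card ι - M - 1 = Fintype.card ι - (M + 1) := by omega
        rw [h1, h2] at hm
        rw [← hm, ← lintegral_const_mul']
        · refine lintegral_congr fun g => ?_
          have hr := gram_det_real (colM G)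
          rw [← ENNReal.ofReal_mul (by unfold ipow; exact inv_nonneg.mpr (pow_nonneg hr.1 N))]
          unfold ipow
          rw [blockGram_det g G hG, ← hP, ← hr.2, Complex.re_ofReal_mul, mul_pow, mul_inv,
            Complex.ofReal_re]
        · exact ENNReal.ofReal_ne_top
    simp_rw [e2]
    rw [lintegral_mul_const', ih', ← ENNReal.ofReal_mul (by positivity),
      Finset.prod_Icc_succ_top (by omega)]
    exact ENNReal.ofReal_ne_top

instance matBorel {m n : ℕ} : BorelSpace (Matrix (Fin m) (Fin n) ℂ) :=
  inferInstanceAs (BorelSpace (Fin m → Fin n → ℂ))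

instance matSC {m n : ℕ} : SecondCountableTopology (Matrix (Fin m) (Fin n) ℂ) :=
  inferInstanceAs (SecondCountableTopology (Fin m → Fin n → ℂ))

instance unitarySC {n : ℕ} : SecondCountableTopology (Matrix.unitaryGroup (Fin n) ℂ) :=
  TopologicalSpace.Subtype.secondCountableTopology _

lemma stdFrame_iso (T M : ℕ) (h : M ≤ T) : (stdFrame T M)ᴴ * stdFrame T M = 1 := by
  ext a b
  simp only [mul_apply, conjTranspose_apply, stdFrame, of_apply]
  rw [Finset.sum_eq_single (Fin.castLE h a)]
  · simp [one_apply, Fin.ext_iff]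
  · intro i _ hi
    have : (i : ℕ) ≠ a := fun h' => hi (Fin.ext h')
    simp [this]
  · simp

lemma stdFrame_proj (T M : ℕ) : stdFrame T M * (stdFrame T M)ᴴ =
    diagonal (fun i : Fin T => if (i : ℕ) < M then (1 : ℂ) else 0) := by
  ext a b
  simp only [mul_apply, conjTranspose_apply, stdFrame, of_apply, diagonal_apply]
  by_cases ha : (a : ℕ) < M
  · rw [Finset.sum_eq_single (⟨a, ha⟩ : Fin M)]
    · by_cases hab : a = b
      · subst hab; simp [ha]
      · have : (b : ℕ) ≠ a := fun h' => hab (Fin.ext h'.symm)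
        simp [hab, this]
    · intro i _ hi
      have : (a : ℕ) ≠ i := fun h' => hi (Fin.ext h'.symm)
      simp [this]
    · simp
  · rw [Finset.sum_eq_zero]
    · simp [ha]
    · intro i _
      have : (a : ℕ) ≠ i := fun h' => ha (h' ▸ i.2)
      simp [this]

/-- The compression of the complementary projection. -/
noncomputable def comp2 (T M : ℕ) (X : Matrix (Fin T) (Fin M) ℂ) : Matrix (Fin M) (Fin M) ℂ :=
  Xᴴ * ((1 - stdFrame T M * (stdFrame T M)ᴴ) * X)

lemma comp2_eq (T M : ℕ) (X : Matrix (Fin T) (Fin M) ℂ) :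
    comp2 T M X = (X.submatrix (Subtype.val : {i : Fin T // ¬ (i : ℕ) < M} → Fin T) id)ᴴ *
      X.submatrix (Subtype.val : {i : Fin T // ¬ (i : ℕ) < M} → Fin T) id := by
  ext a b
  unfold comp2
  rw [stdFrame_proj, ← diagonal_one, diagonal_sub, mul_apply, mul_apply]
  simp only [diagonal_mul, conjTranspose_apply, submatrix_apply, id]
  rw [← Fintype.sum_subtype_add_sum_subtype (fun i : Fin T => ¬ (i : ℕ) < M)]
  have h2 : ∑ i : {i : Fin T // ¬ ¬ (i : ℕ) < M}, star (X i a) *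
      ((1 - if ((i : Fin T) : ℕ) < M then (1 : ℂ) else 0) * X i b) = 0 := by
    refine Finset.sum_eq_zero fun i _ => ?_
    have := not_not.mp i.2
    simp [this]
  rw [h2, add_zero]
  refine Finset.sum_congr rfl fun i _ => ?_
  have := i.2
  simp [this]

lemma continuous_comp2 (T M : ℕ) : Continuous (comp2 T M) := by
  unfold comp2
  fun_prop

lemma comp2_nonneg (T M N : ℕ) (X : Matrix (Fin T) (Fin M) ℂ) : 0 ≤ ipow N (comp2 T M X) := by
  rw [comp2_eq]
  unfold ipow
  exact inv_nonneg.mpr (pow_nonneg (gram_det_real _).1 N)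

lemma comp2_moment (T M N : ℕ) (hN0 : N ≠ 0) (h : 2 * M + N ≤ T) :
    ∫⁻ G : Fin M → Fin T → ℂ, ENNReal.ofReal (ipow N (comp2 T M (colM G)))
        ∂(Measure.pi fun _ : Fin M => gpi (Fin T))
      = ENNReal.ofReal (∏ m ∈ Finset.Icc 1 M,
          ((T - M - m - N).factorial : ℝ) / ((T - M - m).factorial : ℝ)) := by
  have hcard : Fintype.card {i : Fin T // ¬ (i : ℕ) < M} = T - M := by
    rw [Fintype.card_subtype_compl, Fintype.card_fin]
    congr 1
    have : Fintype.card {i : Fin T // (i : ℕ) < M} = Fintype.card (Fin M) :=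
      Fintype.card_congr
        { toFun := fun i => ⟨i.1, i.2⟩
          invFun := fun j => ⟨⟨j, by omega⟩, j.2⟩
          left_inv := fun i => rfl
          right_inv := fun j => rfl }
    rw [this, Fintype.card_fin]
  have hw := wishart (ι := {i : Fin T // ¬ (i : ℕ) < M}) N hN0 M (by omega)
  rw [hcard] at hw
  rw [← hw]
  have hmp := measurePreserving_pi (fun _ : Fin M => gpi (Fin T))
    (fun _ : Fin M => gpi {i : Fin T // ¬ (i : ℕ) < M})
    (fun _ => gpi_restrict (fun i : Fin T => ¬ (i : ℕ) < M))
  have hc : Continuous fun G : Fin M → {i : Fin T // ¬ (i : ℕ) < M} → ℂ =>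
      (colM G)ᴴ * colM G :=
    continuous_colM.matrix_conjTranspose.matrix_mul continuous_colM
  rw [← hmp.lintegral_comp (measurable_ipow N _ hc)]
  refine lintegral_congr fun G => ?_
  rw [comp2_eq]
  rfl

lemma key_det (T M : ℕ) (hMT : M ≤ T) (G : Matrix (Fin T) (Fin M) ℂ) (hG : (Gᴴ * G).det ≠ 0) :
    ∃ V : Matrix (Fin T) (Fin T) ℂ, Vᴴ * V = 1 ∧ ∀ U : Matrix (Fin T) (Fin T) ℂ, Uᴴ * U = 1 →
      (comp2 T M (Uᴴ * G)).det = (Gᴴ * G).det * (comp2 T M (Vᴴ * U * stdFrame T M)).det := by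
  obtain ⟨hH, hI, hT⟩ := gram_proj G hG
  let S : Finset (Fin T) := Finset.univ.filter fun i => (i : ℕ) < M
  have hS : S.card = M := by
    have : S = Finset.univ.map (Fin.castLEEmb hMT) := by
      ext i
      simp only [S, Finset.mem_filter, Finset.mem_univ, true_and, Finset.mem_map]
      constructor
      · intro h; exact ⟨⟨i, h⟩, rfl⟩
      · rintro ⟨j, rfl⟩; exact j.2
    rw [this, Finset.card_map, Finset.card_univ, Fintype.card_fin]
  obtain ⟨V, hV, hPV⟩ := proj_diag _ hH hI S (by rw [hT, hS, Fintype.card_fin])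
  refine ⟨V, hV, fun U hU => ?_⟩
  have hD : diagonal (fun i => if i ∈ S then (1 : ℂ) else 0)
      = stdFrame T M * (stdFrame T M)ᴴ := by
    rw [stdFrame_proj]; simp [S]
  rw [hD] at hPV
  have hV2 : V * Vᴴ = 1 := mul_eq_one_comm.mp hV
  have hU2 : U * Uᴴ = 1 := mul_eq_one_comm.mp hU
  have hu : IsUnit (Gᴴ * G).det := isUnit_iff_ne_zero.mpr hG
  set E := stdFrame T M
  have hE : Eᴴ * E = 1 := stdFrame_iso T M hMT
  have e1 : comp2 T M (Uᴴ * G) = (Gᴴ * G) * (1 - ((Gᴴ * G)⁻¹ * Gᴴ * U * E) * (Eᴴ * Uᴴ * G)) := by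
    have h1 : comp2 T M (Uᴴ * G) = Gᴴ * ((U * Uᴴ) * G) - Gᴴ * U * E * (Eᴴ * Uᴴ * G) := by
      unfold comp2
      simp only [conjTranspose_mul, conjTranspose_conjTranspose, Matrix.sub_mul, Matrix.mul_sub,
        Matrix.one_mul, Matrix.mul_assoc]
      rfl
    have h2 : (Gᴴ * G) * (1 - ((Gᴴ * G)⁻¹ * Gᴴ * U * E) * (Eᴴ * Uᴴ * G))
        = Gᴴ * G - ((Gᴴ * G) * (Gᴴ * G)⁻¹) * (Gᴴ * U * E * (Eᴴ * Uᴴ * G)) := by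
      simp only [Matrix.mul_sub, Matrix.mul_one, Matrix.mul_assoc]
    rw [h1, h2, mul_nonsing_inv _ hu, hU2, Matrix.one_mul, Matrix.one_mul]
  have e2 : comp2 T M (Vᴴ * U * E) = 1 - (Eᴴ * Uᴴ * G) * ((Gᴴ * G)⁻¹ * Gᴴ * U * E) := by
    have h1 : comp2 T M (Vᴴ * U * E) = Eᴴ * (Uᴴ * ((V * Vᴴ) * (U * E)))
        - Eᴴ * Uᴴ * (V * (E * Eᴴ) * Vᴴ) * (U * E) := by
      unfold comp2
      simp only [conjTranspose_mul, conjTranspose_conjTranspose, Matrix.sub_mul, Matrix.mul_sub,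
        Matrix.one_mul, Matrix.mul_assoc]
      rfl
    rw [h1, ← hPV, hV2, Matrix.one_mul, ← Matrix.mul_assoc Uᴴ, hU, Matrix.one_mul, hE]
    simp only [Matrix.mul_assoc]
  rw [e1, e2, det_mul, det_one_sub_mul_comm]

lemma comp2_det_zero (T M : ℕ) (G : Matrix (Fin T) (Fin M) ℂ) (hG : (Gᴴ * G).det = 0)
    (U : Matrix (Fin T) (Fin T) ℂ) : (comp2 T M (U * G)).det = 0 := by
  obtain ⟨v, hv, h1⟩ := gram_null _ hG
  refine exists_mulVec_eq_zero_iff.mp ⟨v, hv, ?_⟩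
  unfold comp2
  simp only [← mulVec_mulVec, h1, mulVec_zero]

lemma haar_moment (T M N : ℕ) (hN0 : N ≠ 0) (h : 2 * M + N ≤ T)
    (μ : Measure (Matrix.unitaryGroup (Fin T) ℂ))
    [IsProbabilityMeasure μ] [μ.IsMulLeftInvariant] :
    ∫⁻ U : Matrix.unitaryGroup (Fin T) ℂ,
        ENNReal.ofReal (ipow N (comp2 T M ((U : Matrix (Fin T) (Fin T) ℂ) * stdFrame T M))) ∂μ
      = ENNReal.ofReal (∏ m ∈ Finset.Icc 1 M,
          ((Nat.factorial (T - m) : ℝ) * (Nat.factorial (T - N - m - M) : ℝ)) /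
            ((Nat.factorial (T - m - M) : ℝ) * (Nat.factorial (T - N - m) : ℝ))) := by
  set c := ∫⁻ U : Matrix.unitaryGroup (Fin T) ℂ,
        ENNReal.ofReal (ipow N (comp2 T M ((U : Matrix (Fin T) (Fin T) ℂ) * stdFrame T M))) ∂μ
    with hc
  set ν := Measure.pi fun _ : Fin M => gpi (Fin T)
  have hA := comp2_moment T M N hN0 h
  have hB := wishart (ι := Fin T) N hN0 M (by rw [Fintype.card_fin]; omega)
  rw [Fintype.card_fin] at hB
  have hUs : ∀ U : Matrix.unitaryGroup (Fin T) ℂ, (U : Matrix (Fin T) (Fin T) ℂ)ᴴ * U = 1 :=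
    fun U => Unitary.star_mul_self_of_mem U.2
  have hUs2 : ∀ U : Matrix.unitaryGroup (Fin T) ℂ, (U : Matrix (Fin T) (Fin T) ℂ) *
    (U : Matrix (Fin T) (Fin T) ℂ)ᴴ = 1 :=
    fun U => Unitary.mul_star_self_of_mem U.2
  have hjoint : Continuous fun x : Matrix.unitaryGroup (Fin T) ℂ × (Fin M → Fin T → ℂ) =>
      comp2 T M ((x.1 : Matrix (Fin T) (Fin T) ℂ)ᴴ * colM x.2) :=
    (continuous_comp2 T M).comp
      ((continuous_subtype_val.comp continuous_fst).matrix_conjTranspose.matrix_mul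
        (continuous_colM.comp continuous_snd))
  have hjm := measurable_ipow N _ hjoint
  have h1 : ∀ U : Matrix.unitaryGroup (Fin T) ℂ,
      ∫⁻ G : Fin M → Fin T → ℂ, ENNReal.ofReal (ipow N (comp2 T M
        ((U : Matrix (Fin T) (Fin T) ℂ)ᴴ * colM G))) ∂ν
      = ∫⁻ G : Fin M → Fin T → ℂ, ENNReal.ofReal (ipow N (comp2 T M (colM G))) ∂ν := by
    intro U
    have hmp := measurePreserving_pi (fun _ : Fin M => gpi (Fin T))
      (fun _ : Fin M => gpi (Fin T))
      (fun _ => gpi_unitary (U : Matrix (Fin T) (Fin T) ℂ)ᴴ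
        (by rw [conjTranspose_conjTranspose, hUs2]))
    exact hmp.lintegral_comp (measurable_ipow N _ ((continuous_comp2 T M).comp continuous_colM))
  have h2 : ∀ G : Fin M → Fin T → ℂ,
      ∫⁻ U : Matrix.unitaryGroup (Fin T) ℂ, ENNReal.ofReal (ipow N (comp2 T M
        ((U : Matrix (Fin T) (Fin T) ℂ)ᴴ * colM G))) ∂μ
      = ENNReal.ofReal (ipow N ((colM G)ᴴ * colM G)) * c := by
    intro G
    by_cases hG : ((colM G)ᴴ * colM G).det = 0
    · simp [ipow, comp2_det_zero T M _ hG, hG, hN0]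
    · obtain ⟨V, hV, hVU⟩ := key_det T M (by omega) (colM G) hG
      have hr := gram_det_real (colM G)
      let V' : Matrix.unitaryGroup (Fin T) ℂ :=
        ⟨V, mem_unitaryGroup_iff'.mpr hV⟩
      rw [hc, ← lintegral_mul_left_eq_self (fun U : Matrix.unitaryGroup (Fin T) ℂ => ENNReal.ofReal
        (ipow N (comp2 T M ((U : Matrix (Fin T) (Fin T) ℂ) * stdFrame T M)))) V'⁻¹,
        ← lintegral_const_mul' _ _ ENNReal.ofReal_ne_top]
      refine lintegral_congr fun U => ?_
      rw [← ENNReal.ofReal_mul (by unfold ipow; exact inv_nonneg.mpr (pow_nonneg hr.1 N))]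
      have e : ((V'⁻¹ * U : Matrix.unitaryGroup (Fin T) ℂ) : Matrix (Fin T) (Fin T) ℂ)
        = Vᴴ * U := rfl
      rw [e]
      unfold ipow
      rw [hVU _ (hUs U), ← hr.2, Complex.re_ofReal_mul, mul_pow, mul_inv, Complex.ofReal_re]
  have h3 : ∫⁻ G : Fin M → Fin T → ℂ, ENNReal.ofReal (ipow N (comp2 T M (colM G))) ∂ν
      = (∫⁻ G : Fin M → Fin T → ℂ, ENNReal.ofReal (ipow N ((colM G)ᴴ * colM G)) ∂ν) * c := by
    rw [← lintegral_mul_const c (measurable_ipow N _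
      (continuous_colM.matrix_conjTranspose.matrix_mul continuous_colM))]
    simp_rw [← h2]
    rw [← lintegral_lintegral_swap (f := fun (U : Matrix.unitaryGroup (Fin T) ℂ)
      (G : Fin M → Fin T → ℂ) => ENNReal.ofReal (ipow N (comp2 T M
        ((U : Matrix (Fin T) (Fin T) ℂ)ᴴ * colM G)))) hjm.aemeasurable]
    simp_rw [h1]
    simp
  rw [hA, hB] at h3
  have hpos : ∀ m : ℕ, (0 : ℝ) < (m.factorial : ℝ) := fun m => by positivity
  have hbpos : 0 < ∏ m ∈ Finset.Icc 1 M, ((T - m - N).factorial : ℝ) / ((T - m).factorial : ℝ) :=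
    Finset.prod_pos fun m _ => div_pos (hpos _) (hpos _)
  have h4 : c = ENNReal.ofReal (∏ m ∈ Finset.Icc 1 M,
      ((T - M - m - N).factorial : ℝ) / ((T - M - m).factorial : ℝ)) / ENNReal.ofReal
      (∏ m ∈ Finset.Icc 1 M, ((T - m - N).factorial : ℝ) / ((T - m).factorial : ℝ)) := by
    rw [h3, mul_comm, ENNReal.mul_div_cancel_right]
    · exact (ENNReal.ofReal_pos.mpr hbpos).ne'
    · exact ENNReal.ofReal_ne_top
  rw [h4, ← ENNReal.ofReal_div_of_pos hbpos, ← Finset.prod_div_distrib]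
  congr 1
  refine Finset.prod_congr rfl fun m _ => ?_
  have a1 : T - M - m - N = T - N - m - M := by omega
  have a2 : T - M - m = T - m - M := by omega
  have a3 : T - m - N = T - N - m := by omega
  rw [a1, a2, a3]
  have := hpos (T - m)
  have := hpos (T - m - M)
  have := hpos (T - N - m)
  field_simp

noncomputable def pairE (T M N : ℕ) (u v : Matrix.unitaryGroup (Fin T) ℂ) : ℝ :=
  ipow N (comp2 T M (((v⁻¹ * u : Matrix.unitaryGroup (Fin T) ℂ) :
          Matrix (Fin T) (Fin T) ℂ) * stdFrame T M))

lemma energy_term (T M N : ℕ) (hMT : M ≤ T) (u v : Matrix.unitaryGroup (Fin T) ℂ) :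
      ((1 - ((u : Matrix (Fin T) (Fin T) ℂ) * stdFrame T M)ᴴ *
              ((v : Matrix (Fin T) (Fin T) ℂ) * stdFrame T M) *
              ((v : Matrix (Fin T) (Fin T) ℂ) * stdFrame T M)ᴴ *
              ((u : Matrix (Fin T) (Fin T) ℂ) * stdFrame T M)).det).re ^ (-(N : ℝ))
      = pairE T M N u v := by
  unfold pairE
  have hUs : ∀ U : Matrix.unitaryGroup (Fin T) ℂ, (U : Matrix (Fin T) (Fin T) ℂ)ᴴ * U = 1 :=
    fun U => Unitary.star_mul_self_of_mem U.2
  have hUs2 : ∀ U : Matrix.unitaryGroup (Fin T) ℂ, (U : Matrix (Fin T) (Fin T) ℂ) *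
    (U : Matrix (Fin T) (Fin T) ℂ)ᴴ = 1 :=
    fun U => Unitary.mul_star_self_of_mem U.2
  have hE : (stdFrame T M)ᴴ * stdFrame T M = 1 := stdFrame_iso T M hMT
  have e : ((v⁻¹ * u : Matrix.unitaryGroup (Fin T) ℂ) : Matrix (Fin T) (Fin T) ℂ)
      = (v : Matrix (Fin T) (Fin T) ℂ)ᴴ * (u : Matrix (Fin T) (Fin T) ℂ) := rfl
  rw [e]
  have e2 : comp2 T M ((v : Matrix (Fin T) (Fin T) ℂ)ᴴ * (u : Matrix (Fin T) (Fin T) ℂ) * stdFrame T M)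
      = 1 - ((u : Matrix (Fin T) (Fin T) ℂ) * stdFrame T M)ᴴ *
            ((v : Matrix (Fin T) (Fin T) ℂ) * stdFrame T M) *
            ((v : Matrix (Fin T) (Fin T) ℂ) * stdFrame T M)ᴴ *
            ((u : Matrix (Fin T) (Fin T) ℂ) * stdFrame T M) := by
    have h1 : comp2 T M ((v : Matrix (Fin T) (Fin T) ℂ)ᴴ * (u : Matrix (Fin T) (Fin T) ℂ) * stdFrame T M)
      = (stdFrame T M)ᴴ * ((u : Matrix (Fin T) (Fin T) ℂ)ᴴ *
          (((v : Matrix (Fin T) (Fin T) ℂ) * (v : Matrix (Fin T) (Fin T) ℂ)ᴴ) *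
            ((u : Matrix (Fin T) (Fin T) ℂ) * stdFrame T M)))
        - ((u : Matrix (Fin T) (Fin T) ℂ) * stdFrame T M)ᴴ *
            ((v : Matrix (Fin T) (Fin T) ℂ) * stdFrame T M) *
            ((v : Matrix (Fin T) (Fin T) ℂ) * stdFrame T M)ᴴ *
            ((u : Matrix (Fin T) (Fin T) ℂ) * stdFrame T M) := by
      unfold comp2
      simp only [conjTranspose_mul, conjTranspose_conjTranspose, Matrix.sub_mul,
        Matrix.mul_sub, Matrix.one_mul, Matrix.mul_assoc]
    rw [h1, hUs2, Matrix.one_mul, ← Matrix.mul_assoc _ _ (stdFrame T M), hUs, Matrix.one_mul, hE]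
  rw [e2]
  unfold ipow
  rw [← Int.cast_natCast N, ← Int.cast_neg, Real.rpow_intCast, _root_.zpow_neg, _root_.zpow_natCast]

lemma pairE_nonneg (T M N : ℕ) (u v : Matrix.unitaryGroup (Fin T) ℂ) : 0 ≤ pairE T M N u v :=
  comp2_nonneg T M N _

lemma pairE_meas (T M N : ℕ) :
    Measurable fun x : Matrix.unitaryGroup (Fin T) ℂ × Matrix.unitaryGroup (Fin T) ℂ =>
      ENNReal.ofReal (pairE T M N x.1 x.2) := by
  have hpc : Continuous fun x : Matrix.unitaryGroup (Fin T) ℂ × Matrix.unitaryGroup (Fin T) ℂ =>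
      comp2 T M (((x.2⁻¹ * x.1 : Matrix.unitaryGroup (Fin T) ℂ) :
          Matrix (Fin T) (Fin T) ℂ) * stdFrame T M) := by
    refine (continuous_comp2 T M).comp ((continuous_subtype_val.comp ?_).matrix_mul
      continuous_const)
    exact continuous_snd.inv.mul continuous_fst
  exact measurable_ipow N _ hpc

lemma pair_moment (T M N K : ℕ) (R : ℝ) (μ : Measure (Matrix.unitaryGroup (Fin T) ℂ))
    [IsProbabilityMeasure μ] [μ.IsMulLeftInvariant]
    (hhaar : ∫⁻ U : Matrix.unitaryGroup (Fin T) ℂ,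
        ENNReal.ofReal (ipow N (comp2 T M ((U : Matrix (Fin T) (Fin T) ℂ) * stdFrame T M))) ∂μ
      = ENNReal.ofReal R) (i j : Fin K) (hij : j ≠ i) :
    ∫⁻ U : Fin K → Matrix.unitaryGroup (Fin T) ℂ,
        ENNReal.ofReal (pairE T M N (U i) (U j)) ∂(Measure.pi fun _ : Fin K => μ)
        = ENNReal.ofReal R := by
  have hpm := pairE_meas T M N
  have hind := (ProbabilityTheory.iIndepFun_pi (μ := fun _ : Fin K => μ)
    (X := fun _ x => x) (fun _ => aemeasurable_id)).indepFun hij.symm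
  have hmap := (ProbabilityTheory.indepFun_iff_map_prod_eq_prod_map_map
    (measurable_pi_apply i).aemeasurable (measurable_pi_apply j).aemeasurable).mp hind
  have hmi : ∀ i, Measure.map (fun U : Fin K → Matrix.unitaryGroup (Fin T) ℂ => U i)
      (Measure.pi fun _ : Fin K => μ) = μ := fun i =>
    (measurePreserving_eval (fun _ : Fin K => μ) i).map_eq
  rw [hmi, hmi] at hmap
  have e1 := lintegral_map (μ := Measure.pi fun _ : Fin K => μ) hpm
    ((measurable_pi_apply i).prodMk (measurable_pi_apply j))
  rw [hmap] at e1
  rw [← e1, lintegral_prod_symm' _ hpm]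
  have e2 : ∀ v : Matrix.unitaryGroup (Fin T) ℂ, ∫⁻ u : Matrix.unitaryGroup (Fin T) ℂ,
      ENNReal.ofReal (pairE T M N u v) ∂μ = ENNReal.ofReal R := by
    intro v
    rw [← hhaar]
    exact lintegral_mul_left_eq_self (fun U : Matrix.unitaryGroup (Fin T) ℂ =>
      ENNReal.ofReal (ipow N (comp2 T M ((U : Matrix (Fin T) (Fin T) ℂ) * stdFrame T M)))) v⁻¹
  simp only [e2]
  simp

lemma meas_pair_apply {G β : Type*} [MeasurableSpace G] [MeasurableSpace β] {K : ℕ}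
    (g : G × G → β) (hg : Measurable g) (i j : Fin K) :
    Measurable fun U : Fin K → G => g (U i, U j) :=
  hg.comp ((measurable_pi_apply i).prodMk (measurable_pi_apply j))

lemma pairE_meas_real (T M N K : ℕ) (i j : Fin K) :
    Measurable fun U : Fin K → Matrix.unitaryGroup (Fin T) ℂ => pairE T M N (U i) (U j) := by
  have h1 : Measurable fun U : Fin K → Matrix.unitaryGroup (Fin T) ℂ =>
      ENNReal.ofReal (pairE T M N (U i) (U j)) :=
    meas_pair_apply _ (pairE_meas T M N) i j
  have h2 := h1.ennreal_toReal
  have h3 : (fun U : Fin K → Matrix.unitaryGroup (Fin T) ℂ => pairE T M N (U i) (U j))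
      = fun U => (ENNReal.ofReal (pairE T M N (U i) (U j))).toReal :=
    funext fun U => (ENNReal.toReal_ofReal (pairE_nonneg T M N _ _)).symm
  rw [h3]
  exact h2

lemma integrable_of_lint {α : Type*} [MeasurableSpace α] (ν : Measure α) (f : α → ℝ)
    (hf : Measurable f) (h0 : ∀ x, 0 ≤ f x) (R : ℝ) (hR : 0 ≤ R)
    (h : ∫⁻ x, ENNReal.ofReal (f x) ∂ν = ENNReal.ofReal R) :
    Integrable f ν ∧ ∫ x, f x ∂ν = R := by
  constructor
  · refine ⟨hf.aestronglyMeasurable, ?_⟩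
    rw [hasFiniteIntegral_iff_ofReal (ae_of_all _ h0), h]
    exact ENNReal.ofReal_lt_top
  · rw [integral_eq_lintegral_of_nonneg_ae (ae_of_all _ h0) hf.aestronglyMeasurable, h,
      ENNReal.toReal_ofReal hR]

lemma sum_pairs {α : Type*} [MeasurableSpace α] (ν : Measure α) (K : ℕ) (hK : 2 ≤ K)
    (f : Fin K → Fin K → α → ℝ) (R : ℝ)
    (h : ∀ i j, j ≠ i → Integrable (f i j) ν ∧ ∫ x, f i j x ∂ν = R) :
    ∫ x, (∑ i : Fin K, ∑ j ∈ Finset.univ.filter (fun j => j ≠ i), f i j x) ∂ν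
      = K * (K - 1) * R := by
  have hIntg : ∀ i : Fin K, ∀ j ∈ Finset.univ.filter (fun j => j ≠ i), Integrable (f i j) ν :=
    fun i j hj => (h i j (Finset.mem_filter.mp hj).2).1
  rw [integral_finsetSum _ fun i _ => integrable_finsetSum _ (hIntg i)]
  have hfin : ∀ i : Fin K, ∫ x, ∑ j ∈ Finset.univ.filter (fun j => j ≠ i), f i j x ∂ν
      = ((K - 1 : ℕ) : ℝ) * R := by
    intro i
    rw [integral_finsetSum _ (hIntg i),
      Finset.sum_congr rfl fun j hj => (h i j (Finset.mem_filter.mp hj).2).2,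
      Finset.sum_const, Finset.filter_ne', Finset.card_erase_of_mem (Finset.mem_univ i),
      Finset.card_univ, Fintype.card_fin, nsmul_eq_mul]
  rw [Finset.sum_congr rfl fun i _ => hfin i, Finset.sum_const, Finset.card_univ,
    Fintype.card_fin, nsmul_eq_mul, Nat.cast_sub (by omega), Nat.cast_one, mul_assoc]

lemma energy_sum (T M N K : ℕ) (hK : 2 ≤ K) (R : ℝ) (hRnn : 0 ≤ R)
    (μ : Measure (Matrix.unitaryGroup (Fin T) ℂ))
    [IsProbabilityMeasure μ] [μ.IsMulLeftInvariant]
    (hhaar : ∫⁻ U : Matrix.unitaryGroup (Fin T) ℂ,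
        ENNReal.ofReal (ipow N (comp2 T M ((U : Matrix (Fin T) (Fin T) ℂ) * stdFrame T M))) ∂μ
      = ENNReal.ofReal R) :
    ∫ U : Fin K → Matrix.unitaryGroup (Fin T) ℂ,
        (∑ i : Fin K, ∑ j ∈ Finset.univ.filter (fun j => j ≠ i), pairE T M N (U i) (U j))
        ∂(Measure.pi fun _ : Fin K => μ) = K * (K - 1) * R := by
  refine sum_pairs (Measure.pi fun _ : Fin K => μ) K hK
    (fun i j U => pairE T M N (U i) (U j)) R fun i j hij => ?_
  exact integrable_of_lint _ _ (pairE_meas_real T M N K i j)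
    (fun U => pairE_nonneg T M N _ _) R hRnn (pair_moment T M N K R μ hhaar i j hij)

theorem expected_chordal_product_energy
    (T M N K : ℕ) (hT : 0 < T) (hM : 0 < M) (hN : 0 < N) (hK : 2 ≤ K)
    (hTM : 2 * M ≤ T) (hNT : N ≤ T - 2 * M)
    (μ : Measure (Matrix.unitaryGroup (Fin T) ℂ))
    [IsProbabilityMeasure μ] [μ.IsMulLeftInvariant] :
    ∫ U : Fin K → Matrix.unitaryGroup (Fin T) ℂ,
        (∑ i : Fin K, ∑ j ∈ Finset.univ.filter (fun j => j ≠ i),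
          ((1 - ((U i : Matrix (Fin T) (Fin T) ℂ) * stdFrame T M)ᴴ *
              ((U j : Matrix (Fin T) (Fin T) ℂ) * stdFrame T M) *
              ((U j : Matrix (Fin T) (Fin T) ℂ) * stdFrame T M)ᴴ *
              ((U i : Matrix (Fin T) (Fin T) ℂ) * stdFrame T M)).det).re ^ (-(N : ℝ)))
        ∂(Measure.pi fun _ : Fin K => μ)
      = K * (K - 1) * ∏ m ∈ Finset.Icc 1 M,
          ((Nat.factorial (T - m) : ℝ) * (Nat.factorial (T - N - m - M) : ℝ)) /
            ((Nat.factorial (T - m - M) : ℝ) * (Nat.factorial (T - N - m) : ℝ)) := by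
  have hhaar := haar_moment T M N (by omega) (by omega) μ
  have hRnn : 0 ≤ ∏ m ∈ Finset.Icc 1 M,
          ((Nat.factorial (T - m) : ℝ) * (Nat.factorial (T - N - m - M) : ℝ)) /
            ((Nat.factorial (T - m - M) : ℝ) * (Nat.factorial (T - N - m) : ℝ)) :=
    Finset.prod_nonneg fun m _ => by positivity
  rw [← energy_sum T M N K hK _ hRnn μ hhaar]
  refine integral_congr_ae (ae_of_all _ fun U => ?_)
  exact Finset.sum_congr rfl fun i _ => Finset.sum_congr rfl fun j _ =>
    energy_term T M N (by omega) (U i) (U j)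
end

section
/- Let T, M, N, K be positive integers with T ≥ 2M, N ≤ T − 2M and K ≥ 2. Then there exist matrices X_1, …, X_K ∈ ℂ^{T×M} with X_i^H X_i = I_M for every i, such that the chordal product energy satisfies ∑_{i≠j} det(I_M − X_i^H X_j X_j^H X_i)^{−N} ≤ K(K−1) ∏_{m=1}^{M} [(T−m)! (T−N−m−M)!] / [(T−m−M)! (T−N−m)!]. In particular, all pairwise chordal product determinants det(I_M − X_i^H X_j X_j^H X_i) for i ≠ j are strictly positive. -/
open Matrix MeasureTheory

section
set_option linter.unusedSectionVars false
variable {E : Type*} [NormedAddCommGroup E] [InnerProductSpace ℝ E] [FiniteDimensional ℝ E]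
  [MeasurableSpace E] [BorelSpace E]

lemma aux_one_dim_integrable (d N : ℕ) (hN : N < d) :
    IntegrableOn (fun y : ℝ => y ^ (2 * d - 1) • (((y ^ 2)⁻¹) ^ N * Real.exp (-y ^ 2)))
      (Set.Ioi 0) := by
  have h := integrableOn_rpow_mul_exp_neg_mul_sq (b := 1) one_pos (s := ((2 * (d - N : ℕ) - 1 : ℕ) : ℝ))
    (by have : (0:ℝ) ≤ ((2 * (d - N : ℕ) - 1 : ℕ) : ℝ) := Nat.cast_nonneg _
        linarith)
  refine h.congr_fun (fun y hy => ?_) measurableSet_Ioi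
  have hy : 0 < y := hy
  obtain ⟨k, rfl⟩ := Nat.exists_eq_add_of_lt hN
  simp only [Real.rpow_natCast, smul_eq_mul, neg_mul, one_mul]
  rw [show 2 * (N + k + 1) - 1 = (2 * (N + k + 1 - N) - 1) + 2 * N by omega, pow_add, inv_pow, pow_mul]
  have : (y ^ 2) ^ N ≠ 0 := by positivity
  field_simp

lemma aux_one_dim_integral (d N : ℕ) (hN : N < d) :
    ∫ y in Set.Ioi (0 : ℝ), y ^ (2 * d - 1) • (((y ^ 2)⁻¹) ^ N * Real.exp (-y ^ 2))
      = (Nat.factorial (d - 1 - N) : ℝ) / 2 := by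
  obtain ⟨k, rfl⟩ := Nat.exists_eq_add_of_lt hN
  have h := integral_rpow_mul_exp_neg_rpow (p := 2) (q := ((2 * k + 1 : ℕ) : ℝ)) two_pos
    (by have : (0:ℝ) ≤ ((2 * k + 1 : ℕ) : ℝ) := Nat.cast_nonneg _
        linarith)
  have e : ((((2 * k + 1 : ℕ) : ℝ) + 1) / 2) = k + 1 := by push_cast; ring
  rw [e, Real.Gamma_nat_eq_factorial] at h
  rw [show N + k + 1 - 1 - N = k by omega, div_eq_inv_mul, ← one_div, ← h]
  refine setIntegral_congr_fun measurableSet_Ioi (fun y hy => ?_)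
  have hy : 0 < y := hy
  simp only [Real.rpow_natCast, smul_eq_mul, Real.rpow_ofNat]
  rw [show 2 * (N + k + 1) - 1 = (2 * k + 1) + 2 * N by omega, pow_add, inv_pow, pow_mul y 2 N]
  have : (y ^ 2) ^ N ≠ 0 := by positivity
  field_simp

lemma radial_integrable (d N : ℕ) (hd : Module.finrank ℝ E = 2 * d) (hN : N < d) :
    Integrable (fun x : E => ((‖x‖ ^ 2)⁻¹) ^ N * Real.exp (-‖x‖ ^ 2)) := by
  have : Nontrivial E := Module.nontrivial_of_finrank_pos (R := ℝ) (by omega)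
  have := (integrable_fun_norm_addHaar (volume : Measure E)
    (f := fun y : ℝ => (((y ^ 2)⁻¹) ^ N * Real.exp (-y ^ 2)))).2
  apply this
  rw [hd]
  exact aux_one_dim_integrable d N hN

lemma radial_integral_s3 (d N : ℕ) (hd : Module.finrank ℝ E = 2 * d) (hN : N < d) :
    ∫ x : E, ((‖x‖ ^ 2)⁻¹) ^ N * Real.exp (-‖x‖ ^ 2)
      = ((Nat.factorial (d - 1 - N) : ℝ) / Nat.factorial (d - 1)) * ∫ x : E, Real.exp (-‖x‖ ^ 2) := by
  have : Nontrivial E := Module.nontrivial_of_finrank_pos (R := ℝ) (by omega)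
  have h1 := (integral_fun_norm_addHaar (volume : Measure E)
    (f := fun y : ℝ => (((y ^ 2)⁻¹) ^ N * Real.exp (-y ^ 2))))
  have h2 := (integral_fun_norm_addHaar (volume : Measure E)
    (f := fun y : ℝ => (((y ^ 2)⁻¹) ^ 0 * Real.exp (-y ^ 2))))
  rw [hd, aux_one_dim_integral d N hN] at h1
  rw [hd, aux_one_dim_integral d 0 (by omega)] at h2
  simp only [pow_zero, one_mul] at h2
  rw [h1, h2]
  simp only [nsmul_eq_mul, smul_eq_mul]
  have : (Nat.factorial (d - 1) : ℝ) ≠ 0 := by positivity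
  simp only [Nat.sub_zero]
  field_simp

lemma gauss_integrable : Integrable (fun x : E => Real.exp (-‖x‖ ^ 2)) := by
  rcases subsingleton_or_nontrivial E with h | h
  · have : (fun x : E => Real.exp (-‖x‖ ^ 2)) = fun _ => 1 := by
      ext x; simp [Subsingleton.elim x 0]
    rw [this]
    rw [integrable_const_iff]
    right
    exact ⟨(isCompact_univ (X := E)).measure_lt_top⟩
  · have := (integrable_fun_norm_addHaar (volume : Measure E)
      (f := fun y : ℝ => (Real.exp (-y ^ 2)))).2
    apply this
    have h := integrableOn_rpow_mul_exp_neg_mul_sq (b := 1) one_pos 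
      (s := ((Module.finrank ℝ E - 1 : ℕ) : ℝ))
      (by have : (0:ℝ) ≤ ((Module.finrank ℝ E - 1 : ℕ) : ℝ) := Nat.cast_nonneg _
          linarith)
    refine h.congr_fun (fun y hy => ?_) measurableSet_Ioi
    simp

lemma gauss_pos : 0 < ∫ x : E, Real.exp (-‖x‖ ^ 2) :=
  integral_exp_pos gauss_integrable

lemma split_integral (U : Submodule ℝ E) (f : U → ℝ) (hf : Integrable f) :
    Integrable (fun x : E => f (U.orthogonalDecomposition x).fst *
      Real.exp (-‖(U.orthogonalDecomposition x).snd‖ ^ 2)) ∧ 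
    ∫ x : E, f (U.orthogonalDecomposition x).fst *
      Real.exp (-‖(U.orthogonalDecomposition x).snd‖ ^ 2) = 
     (∫ u, f u) * ∫ v : Uᗮ, Real.exp (-‖v‖ ^ 2) := by
  have mp : MeasurePreserving (fun x : E => WithLp.ofLp (U.orthogonalDecomposition x)) :=
    (WithLp.volume_preserving_ofLp (U := U) (V := Uᗮ)).comp U.orthogonalDecomposition.measurePreserving
  have me : MeasurableEmbedding (fun x : E => WithLp.ofLp (U.orthogonalDecomposition x)) :=
    (WithLp.homeomorphProd 2 U Uᗮ).measurableEmbedding.comp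
      U.orthogonalDecomposition.toHomeomorph.measurableEmbedding
  constructor
  · exact (mp.integrable_comp_emb me (g := fun p : U × Uᗮ => f p.1 * Real.exp (-‖p.2‖ ^ 2))).2
      (hf.mul_prod gauss_integrable)
  · rw [← integral_prod_mul]
    exact (mp.integral_comp me (fun p : U × Uᗮ => f p.1 * Real.exp (-‖p.2‖ ^ 2)))

lemma split_norm (U : Submodule ℝ E) (x : E) : 
    ‖x‖ ^ 2 = ‖(U.orthogonalDecomposition x).fst‖ ^ 2 + ‖(U.orthogonalDecomposition x).snd‖ ^ 2 := by
  rw [← U.orthogonalDecomposition.norm_map x, WithLp.prod_norm_sq_eq_of_L2]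

lemma split_fst (U : Submodule ℝ E) (x : E) : 
    ‖(U.orthogonalDecomposition x).fst‖ = ‖U.starProjection x‖ := by
  simp [Submodule.orthogonalDecomposition_apply]

lemma proj_integral (U : Submodule ℝ E) (d N : ℕ) (hd : Module.finrank ℝ U = 2 * d) (hN : N < d) :
    Integrable (fun x : E => ((‖U.starProjection x‖ ^ 2)⁻¹) ^ N * Real.exp (-‖x‖ ^ 2)) ∧
    ∫ x : E, ((‖U.starProjection x‖ ^ 2)⁻¹) ^ N * Real.exp (-‖x‖ ^ 2)
      = ((Nat.factorial (d - 1 - N) : ℝ) / Nat.factorial (d - 1)) * ∫ x : E, Real.exp (-‖x‖ ^ 2) := by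
  have key := split_integral U _ (radial_integrable d N hd hN)
  have key0 := split_integral U _ gauss_integrable
  have e : ∀ x : E, Real.exp (-‖x‖ ^ 2) = Real.exp (-‖(U.orthogonalDecomposition x).fst‖ ^ 2) *
      Real.exp (-‖(U.orthogonalDecomposition x).snd‖ ^ 2) := by
    intro x
    rw [← Real.exp_add, split_norm U x]; congr 1; ring
  have e1 : (fun x : E => ((‖U.starProjection x‖ ^ 2)⁻¹) ^ N * Real.exp (-‖x‖ ^ 2)) = 
     fun x : E => ((‖(U.orthogonalDecomposition x).fst‖ ^ 2)⁻¹) ^ N * 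
       Real.exp (-‖(U.orthogonalDecomposition x).fst‖ ^ 2) *
      Real.exp (-‖(U.orthogonalDecomposition x).snd‖ ^ 2) := by
    ext x
    rw [e x, ← split_fst, mul_assoc]
  rw [e1]
  refine ⟨key.1, ?_⟩
  rw [key.2, radial_integral_s3 d N hd hN, mul_assoc, ← key0.2]
  simp only [e]

lemma proj_ae_ne (U : Submodule ℝ E) (hU : 0 < Module.finrank ℝ U) :
    ∀ᵐ x : E, U.starProjection x ≠ 0 := by
  have hne : Uᗮ ≠ ⊤ := by
    intro h
    have : U = ⊥ := by rw [← U.orthogonal_orthogonal, h, Submodule.top_orthogonal_eq_bot]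
    rw [this] at hU; simp at hU
  have := Measure.addHaar_submodule (volume : Measure E) Uᗮ hne
  filter_upwards [compl_mem_ae_iff.2 this] with x hx h
  apply hx
  exact (Submodule.starProjection_apply_eq_zero_iff U).1 h

end

lemma exists_good_real {E : Type*} [NormedAddCommGroup E] [InnerProductSpace ℝ E]
    [FiniteDimensional ℝ E] {J : Type*} [Fintype J] (S : Submodule ℝ E) (U : J → Submodule ℝ E)
    (w : J → ℝ) (n d N : ℕ) (hS : Module.finrank ℝ S = 2 * n)
    (hU : ∀ j, Module.finrank ℝ (U j) = 2 * d) (hNd : N < d) (hNn : N < n) :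
    ∃ x : E, S.starProjection x ≠ 0 ∧ (∀ j, (U j).starProjection x ≠ 0) ∧
      (∑ j, w j * ((‖(U j).starProjection x‖ ^ 2)⁻¹) ^ N) *
        ((Nat.factorial (n - 1 - N) : ℝ) / Nat.factorial (n - 1)) ≤
      ((∑ j, w j) * ((Nat.factorial (d - 1 - N) : ℝ) / Nat.factorial (d - 1))) *
        ((‖S.starProjection x‖ ^ 2)⁻¹) ^ N := by
  let _ : MeasurableSpace E := borel E
  have : BorelSpace E := ⟨rfl⟩
  by_contra! hcon
  obtain ⟨iS, vS⟩ := proj_integral S n N hS hNn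
  have iU := fun j => (proj_integral (U j) d N (hU j) hNd).1
  have vU := fun j => (proj_integral (U j) d N (hU j) hNd).2
  set a := ((Nat.factorial (n - 1 - N) : ℝ) / Nat.factorial (n - 1))
  set b := ((Nat.factorial (d - 1 - N) : ℝ) / Nat.factorial (d - 1))
  set I := ∫ x : E, Real.exp (-‖x‖ ^ 2)
  let f : E → ℝ := fun x => ∑ j, (a * w j) * (((‖(U j).starProjection x‖ ^ 2)⁻¹) ^ N * Real.exp (-‖x‖ ^ 2))
  let g : E → ℝ := fun x => ((∑ j, w j) * b) * (((‖S.starProjection x‖ ^ 2)⁻¹) ^ N * Real.exp (-‖x‖ ^ 2))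
  have hf : Integrable f := integrable_finsetSum _ fun j _ => (iU j).const_mul _
  have hg : Integrable g := iS.const_mul _
  have hfv : ∫ x, f x = a * (∑ j, w j) * b * I := by
    rw [integral_finsetSum _ fun j _ => (iU j).const_mul _]
    simp_rw [integral_const_mul, vU]
    rw [Finset.mul_sum, Finset.sum_mul, Finset.sum_mul]
    exact Finset.sum_congr rfl fun j _ => by ring
  have hgv : ∫ x, g x = a * (∑ j, w j) * b * I := by
    rw [integral_const_mul, vS]; ring
  have hlt : ∀ᵐ x : E, 0 < (f - g) x := by
    filter_upwards [proj_ae_ne S (by omega),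
      ae_all_iff.2 fun j => proj_ae_ne (U j) (by rw [hU j]; omega)] with x h1 h2
    have h := hcon x h1 h2
    have := mul_lt_mul_of_pos_right h (Real.exp_pos (-‖x‖ ^ 2))
    have eg : g x = ((∑ j, w j) * b) * ((‖S.starProjection x‖ ^ 2)⁻¹) ^ N * Real.exp (-‖x‖ ^ 2) :=
      (mul_assoc _ _ _).symm
    have ef : f x = (∑ j, w j * ((‖(U j).starProjection x‖ ^ 2)⁻¹) ^ N) * a * Real.exp (-‖x‖ ^ 2) := by
      rw [Finset.sum_mul, Finset.sum_mul]
      exact Finset.sum_congr rfl fun j _ => by ring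
    rw [Pi.sub_apply, sub_pos, eg, ef]
    exact this
  have hpos := (integral_pos_iff_support_of_nonneg_ae (hlt.mono fun x hx => hx.le) (hf.sub hg)).2
    (by
      rw [pos_iff_ne_zero]
      intro h0
      have : ∀ᵐ x : E, (f - g) x = 0 := by
        rw [ae_iff]; exact h0
      obtain ⟨x, h1, h2⟩ := (hlt.and this).exists
      exact h1.ne' h2)
  simp only [Pi.sub_apply] at hpos
  rw [integral_sub hf hg, hfv, hgv] at hpos
  simp at hpos

section
attribute [local instance] InnerProductSpace.complexToReal

lemma symproj_data {E : Type*} [NormedAddCommGroup E] [InnerProductSpace ℂ E]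
    [FiniteDimensional ℂ E] (A : E →ₗ[ℂ] E) (hs : A.IsSymmetric) (hi : A * A = A) (n : ℕ)
    (ht : LinearMap.trace ℂ E A = n) :
    Module.finrank ℝ ((LinearMap.range A).restrictScalars ℝ) = 2 * n ∧
    ∀ x : E, ‖Submodule.starProjection (𝕜 := ℝ) ((LinearMap.range A).restrictScalars ℝ) x‖ ^ 2 = (inner ℂ x (A x)).re := by
  have hAA : ∀ x, A (A x) = A x := fun x => by
    conv_rhs => rw [← hi]
    rfl
  have : FiniteDimensional ℝ E := FiniteDimensional.complexToReal E
  constructor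
  · have hp : LinearMap.IsProj (LinearMap.range A) A :=
      ⟨fun x => ⟨x, rfl⟩, by rintro _ ⟨y, rfl⟩; exact hAA y⟩
    have h := hp.trace
    rw [ht] at h
    have h' : n = Module.finrank ℂ (LinearMap.range A) := by exact_mod_cast h
    rw [h']
    exact finrank_real_of_complex (LinearMap.range A)
  · intro x
    have e : Submodule.starProjection (𝕜 := ℝ) ((LinearMap.range A).restrictScalars ℝ) x = A x := by
      apply Submodule.eq_starProjection_of_mem_of_inner_eq_zero
      · exact ⟨x, rfl⟩
      · rintro _ ⟨y, rfl⟩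
        have : inner ℂ (x - A x) (A y) = 0 := by
          rw [← hs, map_sub, hAA, sub_self, inner_zero_left]
        change (inner ℂ (x - A x) (A y)).re = 0
        rw [this]; rfl
    have h2 : inner ℂ (A x) (A x) = inner ℂ x (A x) := by rw [hs, hAA]
    rw [e, ← h2]
    exact norm_sq_eq_re_inner (𝕜 := ℂ) (A x)

lemma exists_good_complex {E : Type*} [NormedAddCommGroup E] [InnerProductSpace ℂ E]
    [FiniteDimensional ℂ E] {J : Type*} [Fintype J] (S : E →ₗ[ℂ] E) (R : J → E →ₗ[ℂ] E)
    (w : J → ℝ) (n d N : ℕ) (hSs : S.IsSymmetric) (hSi : S * S = S)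
    (hSt : LinearMap.trace ℂ E S = n) (hRs : ∀ j, (R j).IsSymmetric) (hRi : ∀ j, R j * R j = R j)
    (hRt : ∀ j, LinearMap.trace ℂ E (R j) = d) (hNd : N < d) (hNn : N < n) :
    ∃ x : E, 0 < (inner ℂ x (S x)).re ∧ (∀ j, 0 < (inner ℂ x (R j x)).re) ∧
      (∑ j, w j * (((inner ℂ x (R j x)).re)⁻¹) ^ N) *
        ((Nat.factorial (n - 1 - N) : ℝ) / Nat.factorial (n - 1)) ≤
      ((∑ j, w j) * ((Nat.factorial (d - 1 - N) : ℝ) / Nat.factorial (d - 1))) *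
        (((inner ℂ x (S x)).re)⁻¹) ^ N := by
  have : FiniteDimensional ℝ E := FiniteDimensional.complexToReal E
  obtain ⟨f1, p1⟩ := symproj_data S hSs hSi n hSt
  have f2 := fun j => (symproj_data (R j) (hRs j) (hRi j) d (hRt j)).1
  have p2 := fun j => (symproj_data (R j) (hRs j) (hRi j) d (hRt j)).2
  obtain ⟨x, h1, h2, h3⟩ := exists_good_real _ _ w n d N f1 f2 hNd hNn
  refine ⟨x, ?_, fun j => ?_, ?_⟩
  · rw [← p1]; positivity
  · rw [← p2]; have := h2 j; positivity
  · simpa only [p1, p2] using h3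

end

lemma exists_good_matrix {T : ℕ} {J : Type*} [Fintype J] (S : Matrix (Fin T) (Fin T) ℂ)
    (R : J → Matrix (Fin T) (Fin T) ℂ)
    (w : J → ℝ) (n d N : ℕ) (hSs : S.IsHermitian) (hSi : S * S = S)
    (hSt : S.trace = n) (hRs : ∀ j, (R j).IsHermitian) (hRi : ∀ j, R j * R j = R j)
    (hRt : ∀ j, (R j).trace = d) (hNd : N < d) (hNn : N < n) :
    ∃ x : Fin T → ℂ, 0 < (star x ⬝ᵥ S *ᵥ x).re ∧ (∀ j, 0 < (star x ⬝ᵥ R j *ᵥ x).re) ∧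
      (∑ j, w j * (((star x ⬝ᵥ R j *ᵥ x).re)⁻¹) ^ N) *
        ((Nat.factorial (n - 1 - N) : ℝ) / Nat.factorial (n - 1)) ≤
      ((∑ j, w j) * ((Nat.factorial (d - 1 - N) : ℝ) / Nat.factorial (d - 1))) *
        (((star x ⬝ᵥ S *ᵥ x).re)⁻¹) ^ N := by
  have tr : ∀ A : Matrix (Fin T) (Fin T) ℂ,
      LinearMap.trace ℂ _ (toEuclideanLin A) = A.trace := by
    intro A
    rw [toEuclideanLin_eq_toLin_orthonormal, Matrix.trace_toLin_eq]
  have mu : ∀ A : Matrix (Fin T) (Fin T) ℂ, A * A = A → 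
      toEuclideanLin A * toEuclideanLin A = toEuclideanLin A := by
    intro A hA
    conv_rhs => rw [← hA]
    rw [toEuclideanLin_eq_toLin_orthonormal, Matrix.toLin_mul _ (EuclideanSpace.basisFun (Fin T) ℂ).toBasis]
    rfl
  have inn : ∀ (A : Matrix (Fin T) (Fin T) ℂ) (x : EuclideanSpace ℂ (Fin T)), 
      inner ℂ x (toEuclideanLin A x) = star (x : Fin T → ℂ) ⬝ᵥ A *ᵥ (x : Fin T → ℂ) := by
    intro A x
    rw [EuclideanSpace.inner_eq_star_dotProduct, dotProduct_comm]
    rfl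
  obtain ⟨x, h1, h2, h3⟩ := exists_good_complex (toEuclideanLin S) (fun j => toEuclideanLin (R j))
    w n d N (isSymmetric_toEuclideanLin_iff.2 hSs) (mu _ hSi) (by rw [tr, hSt])
    (fun j => isSymmetric_toEuclideanLin_iff.2 (hRs j)) (fun j => mu _ (hRi j))
    (fun j => by rw [tr, hRt]) hNd hNn
  simp only [inn] at h1 h2 h3
  exact ⟨x, h1, h2, h3⟩

lemma quad_col {T : ℕ} (P : Matrix (Fin T) (Fin T) ℂ) (hP : P.IsHermitian) (z : Fin T → ℂ) :
    (replicateCol Unit z)ᴴ * P * replicateCol Unit z =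
      (((star z ⬝ᵥ P *ᵥ z).re : ℝ) : ℂ) • (1 : Matrix Unit Unit ℂ) := by
  have h : (((star z ⬝ᵥ P *ᵥ z).re : ℝ) : ℂ) = star z ⬝ᵥ P *ᵥ z := by
    apply Complex.ext
    · simp
    · have := hP.im_star_dotProduct_mulVec_self z
      simp only [Complex.ofReal_im]
      exact this.symm
  rw [h, Matrix.mul_assoc]
  ext i j
  simp [Matrix.mul_apply, dotProduct, mulVec, replicateCol]

/-- Adding one column. -/
lemma step_column {T M m N : ℕ} {J : Type*} [Fintype J] (Y : J → Matrix (Fin T) (Fin M) ℂ)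
    (hY : ∀ j, (Y j)ᴴ * Y j = 1) (X : Matrix (Fin T) (Fin m) ℂ) (hX : Xᴴ * X = 1)
    (r : J → ℝ) (hr : ∀ j, 0 < r j)
    (hdet : ∀ j, (Xᴴ * (1 - Y j * (Y j)ᴴ) * X).det = ((r j : ℝ) : ℂ))
    (hm : M + m + N < T) :
    ∃ (X' : Matrix (Fin T) (Fin (m + 1)) ℂ) (r' : J → ℝ), X'ᴴ * X' = 1 ∧ (∀ j, 0 < r' j) ∧
      (∀ j, (X'ᴴ * (1 - Y j * (Y j)ᴴ) * X').det = ((r' j : ℝ) : ℂ)) ∧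
      ∑ j, (r' j)⁻¹ ^ N ≤ (∑ j, (r j)⁻¹ ^ N) *
        (((Nat.factorial (T - (m + 1)) : ℝ) * (Nat.factorial (T - N - (m + 1) - M) : ℝ)) /
              ((Nat.factorial (T - (m + 1) - M) : ℝ) * (Nat.factorial (T - N - (m + 1)) : ℝ))) := by
  classical
  let Q : J → Matrix (Fin T) (Fin T) ℂ := fun j => 1 - Y j * (Y j)ᴴ
  have hQh : ∀ j, (Q j)ᴴ = Q j := fun j => by simp [Q]
  have hQi : ∀ j, Q j * Q j = Q j := fun j => by
    have : Y j * (Y j)ᴴ * (Y j * (Y j)ᴴ) = Y j * (Y j)ᴴ := by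
      rw [Matrix.mul_assoc, ← Matrix.mul_assoc (Y j)ᴴ, hY, Matrix.one_mul]
    simp only [Q, Matrix.mul_sub, Matrix.sub_mul, this, Matrix.one_mul, Matrix.mul_one]
    abel
  have hQt : ∀ j, (Q j).trace = (T : ℂ) - M := fun j => by
    simp only [Q]
    rw [trace_sub, trace_one, trace_mul_comm, hY, trace_one]; simp
  let A : J → Matrix (Fin m) (Fin m) ℂ := fun j => Xᴴ * Q j * X
  have hAd : ∀ j, (A j).det = ((r j : ℝ) : ℂ) := hdet
  have hAu : ∀ j, IsUnit (A j).det := fun j => by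
    rw [hAd]; exact isUnit_iff_ne_zero.2 (by exact_mod_cast (hr j).ne')
  have hAh : ∀ j, (A j)ᴴ = A j := fun j => by
    simp [A, conjTranspose_mul, hQh, Matrix.mul_assoc]
  let R : J → Matrix (Fin T) (Fin T) ℂ := fun j => Q j - Q j * X * (A j)⁻¹ * (Xᴴ * Q j)
  have hRh : ∀ j, (R j)ᴴ = R j := fun j => by
    simp only [R, conjTranspose_sub, conjTranspose_mul, conjTranspose_nonsing_inv, hQh, hAh,
      conjTranspose_conjTranspose, Matrix.mul_assoc]
  have hXR : ∀ j, Xᴴ * R j = 0 := fun j => by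
    have : Xᴴ * (Q j * X * (A j)⁻¹ * (Xᴴ * Q j)) = (A j * (A j)⁻¹) * (Xᴴ * Q j) := by
      simp only [A, Matrix.mul_assoc]
    simp only [R, Matrix.mul_sub]
    rw [this, Matrix.mul_nonsing_inv _ (hAu j), Matrix.one_mul, sub_self]
  have hQR : ∀ j, Q j * R j = R j := fun j => by
    simp only [R, Matrix.mul_sub, ← Matrix.mul_assoc, hQi]
  have hRi : ∀ j, R j * R j = R j := fun j => by
    conv_lhs => enter [1]; simp only [R]
    rw [Matrix.sub_mul, hQR, Matrix.mul_assoc _ (Xᴴ * Q j), Matrix.mul_assoc Xᴴ, hQR, hXR,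
      Matrix.mul_zero, sub_zero]
  have hRt : ∀ j, (R j).trace = ((T - M - m : ℕ) : ℂ) := fun j => by
    simp only [R]
    rw [trace_sub, hQt, trace_mul_comm, ← Matrix.mul_assoc, Matrix.mul_assoc Xᴴ, ← Matrix.mul_assoc (Q j),
      hQi, ← Matrix.mul_assoc]
    rw [show Xᴴ * Q j * X = A j from rfl, Matrix.mul_nonsing_inv _ (hAu j), trace_one,
      Nat.cast_sub (by omega), Nat.cast_sub (by omega)]
    simp
  let S : Matrix (Fin T) (Fin T) ℂ := 1 - X * Xᴴ
  have hSh : Sᴴ = S := by simp [S]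
  have hXS : Xᴴ * S = 0 := by
    simp only [S, Matrix.mul_sub]
    rw [← Matrix.mul_assoc, hX]; simp
  have hSi : S * S = S := by
    conv_lhs => enter [1]; simp only [S]
    rw [Matrix.sub_mul, Matrix.mul_assoc, hXS]; simp
  have hSt : S.trace = ((T - m : ℕ) : ℂ) := by
    simp only [S]
    rw [trace_sub, trace_one, trace_mul_comm, hX, trace_one, Nat.cast_sub (by omega)]; simp
  have hSR : ∀ j, S * R j = R j := fun j => by
    simp only [S]
    rw [Matrix.sub_mul, Matrix.mul_assoc, hXR]; simp
  have hRS : ∀ j, R j * S = R j := fun j => by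
    have := congrArg conjTranspose (hSR j)
    rwa [conjTranspose_mul, hRh, hSh] at this
  obtain ⟨z, hs, hq, hineq⟩ := exists_good_matrix S R (fun j => (r j)⁻¹ ^ N) (T - m) (T - M - m) N
    hSh hSi hSt hRh hRi hRt (by omega) (by omega)
  have zS := quad_col S hSh z
  have zR := fun j => quad_col (R j) (hRh j) z
  set s := (star z ⬝ᵥ S *ᵥ z).re
  set q : J → ℝ := fun j => (star z ⬝ᵥ R j *ᵥ z).re with hqdef
  set Z := replicateCol Unit z
  let c : ℂ := (((√s)⁻¹ : ℝ) : ℂ)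
  have hcc : star c * c = ((s⁻¹ : ℝ) : ℂ) := by
    simp only [c, RCLike.star_def, Complex.conj_ofReal]
    rw [← Complex.ofReal_mul, ← mul_inv, Real.mul_self_sqrt hs.le]
  let x : Matrix (Fin T) Unit ℂ := c • (S * Z)
  have hxP : ∀ P : Matrix (Fin T) (Fin T) ℂ, xᴴ * P * x = ((s⁻¹ : ℝ) : ℂ) • (Zᴴ * (S * P * S) * Z) := by
    intro P
    simp only [x, conjTranspose_smul, conjTranspose_mul, hSh, Matrix.smul_mul, Matrix.mul_smul, smul_smul]
    rw [← hcc, mul_comm]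
    simp only [Matrix.mul_assoc]
  have hxx : xᴴ * x = 1 := by
    have := hxP 1
    rw [Matrix.mul_one, Matrix.mul_one, hSi, zS, smul_smul, ← Complex.ofReal_mul,
      inv_mul_cancel₀ hs.ne'] at this
    simpa using this
  have hxR : ∀ j, xᴴ * R j * x = ((s⁻¹ * q j : ℝ) : ℂ) • 1 := fun j => by
    rw [hxP, hSR, hRS, zR, smul_smul, ← Complex.ofReal_mul]
  have hXx : Xᴴ * x = 0 := by
    simp only [x, Matrix.mul_smul]
    rw [← Matrix.mul_assoc, hXS]; simp
  have hxX : xᴴ * X = 0 := by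
    have := congrArg conjTranspose hXx
    simpa using this
  let e : Fin (m + 1) ≃ Fin m ⊕ Unit :=
    finSumFinEquiv.symm.trans (Equiv.sumCongr (Equiv.refl _) (Equiv.ofUnique _ _))
  let W : Matrix (Fin T) (Fin m ⊕ Unit) ℂ := fromCols X x
  have hW : ∀ P : Matrix (Fin T) (Fin T) ℂ,
      Wᴴ * P * W = fromBlocks (Xᴴ * P * X) (Xᴴ * P * x) (xᴴ * P * X) (xᴴ * P * x) := by
    intro P
    simp only [W, conjTranspose_fromCols_eq_fromRows_conjTranspose]
    rw [fromRows_mul, fromRows_mul_fromCols]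
  have hsub : ∀ P : Matrix (Fin T) (Fin T) ℂ,
      (W.submatrix id e)ᴴ * P * (W.submatrix id e) = (Wᴴ * P * W).submatrix e e := by
    intro P
    ext i k
    simp [Matrix.mul_apply]
  refine ⟨W.submatrix id e, fun j => r j * (s⁻¹ * q j), ?_, ?_, ?_, ?_⟩
  · have := hsub 1
    rw [hW, Matrix.mul_one, Matrix.mul_one, Matrix.mul_one, hX, hXx, hxX, hxx, fromBlocks_one] at this
    rw [this]; simp
  · intro j
    have := hr j
    have := hq j
    positivity
  · intro j
    have hdx : xᴴ * Q j * x - xᴴ * Q j * X * (A j)⁻¹ * (Xᴴ * Q j * x) = xᴴ * R j * x := by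
      simp only [R, Matrix.mul_sub, Matrix.sub_mul, Matrix.mul_assoc]
    change ((W.submatrix id e)ᴴ * Q j * (W.submatrix id e)).det = _
    rw [hsub, det_submatrix_equiv_self, hW]
    haveI : Invertible (A j) := invertibleOfIsUnitDet _ (hAu j)
    rw [show Xᴴ * Q j * X = A j from rfl, det_fromBlocks₁₁, invOf_eq_nonsing_inv, hdx, hxR, hAd]
    simp
  · set a := ((Nat.factorial (T - m - 1 - N) : ℝ) / Nat.factorial (T - m - 1)) with ha
    set b := ((Nat.factorial (T - M - m - 1 - N) : ℝ) / Nat.factorial (T - M - m - 1)) with hb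
    have ha0 : 0 < a := by positivity
    have hC : (((Nat.factorial (T - (m + 1)) : ℝ) * (Nat.factorial (T - N - (m + 1) - M) : ℝ)) /
              ((Nat.factorial (T - (m + 1) - M) : ℝ) * (Nat.factorial (T - N - (m + 1)) : ℝ))) = b / a := by
      rw [ha, hb, show T - m - 1 - N = T - N - (m + 1) by omega, show T - m - 1 = T - (m + 1) by omega,
        show T - M - m - 1 - N = T - N - (m + 1) - M by omega,
        show T - M - m - 1 = T - (m + 1) - M by omega]
      field_simp
    rw [hC, ← mul_div_assoc, le_div_iff₀ ha0]
    have h1 : ∑ j, (r j * (s⁻¹ * q j))⁻¹ ^ N = s ^ N * ∑ j, (r j)⁻¹ ^ N * (q j)⁻¹ ^ N := by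
      rw [Finset.mul_sum]
      refine Finset.sum_congr rfl fun j _ => ?_
      rw [mul_inv, mul_inv, inv_inv, mul_pow, mul_pow]; ring
    rw [h1, mul_assoc]
    calc _ ≤ s ^ N * ((∑ j, (r j)⁻¹ ^ N) * b * s⁻¹ ^ N) :=
          mul_le_mul_of_nonneg_left hineq (by positivity)
      _ = (∑ j, (r j)⁻¹ ^ N) * b * (s ^ N * s⁻¹ ^ N) := by ring
      _ = _ := by rw [← mul_pow, mul_inv_cancel₀ hs.ne', one_pow, mul_one]

lemma exists_next {T M N : ℕ} {J : Type*} [Fintype J] (Y : J → Matrix (Fin T) (Fin M) ℂ)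
    (hY : ∀ j, (Y j)ᴴ * Y j = 1) (hTM : 2 * M + N ≤ T) (m : ℕ) (hm : m ≤ M) :
    ∃ (X : Matrix (Fin T) (Fin m) ℂ) (r : J → ℝ), Xᴴ * X = 1 ∧ (∀ j, 0 < r j) ∧
      (∀ j, (Xᴴ * (1 - Y j * (Y j)ᴴ) * X).det = ((r j : ℝ) : ℂ)) ∧
      ∑ j, (r j)⁻¹ ^ N ≤ Fintype.card J * ∏ i ∈ Finset.Icc 1 m,
        (((Nat.factorial (T - i) : ℝ) * (Nat.factorial (T - N - i - M) : ℝ)) /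
              ((Nat.factorial (T - i - M) : ℝ) * (Nat.factorial (T - N - i) : ℝ))) := by
  induction m with
  | zero =>
    refine ⟨0, fun _ => 1, ?_, by simp, by simp, by simp⟩
    ext i; exact i.elim0
  | succ m ih =>
    obtain ⟨X, r, h1, h2, h3, h4⟩ := ih (by omega)
    obtain ⟨X', r', g1, g2, g3, g4⟩ := step_column (N := N) Y hY X h1 r h2 h3 (by omega)
    refine ⟨X', r', g1, g2, g3, g4.trans ?_⟩
    rw [Finset.prod_Icc_succ_top (by omega), ← mul_assoc]
    exact mul_le_mul_of_nonneg_right h4 (by positivity)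

lemma chordal_symm {T M : ℕ} (X Y : Matrix (Fin T) (Fin M) ℂ) :
    (1 - Xᴴ * Y * Yᴴ * X).det = (1 - Yᴴ * X * Xᴴ * Y).det := by
  rw [Matrix.mul_assoc (Xᴴ * Y), det_one_sub_mul_comm, ← Matrix.mul_assoc]

lemma exists_code_aux (T M N : ℕ) (hTM : 2 * M + N ≤ T) (C : ℝ)
    (hC : C = ∏ m ∈ Finset.Icc 1 M,
            ((Nat.factorial (T - m) : ℝ) * (Nat.factorial (T - N - m - M) : ℝ)) /
              ((Nat.factorial (T - m - M) : ℝ) * (Nat.factorial (T - N - m) : ℝ))) (K : ℕ) :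
    ∃ X : Fin K → Matrix (Fin T) (Fin M) ℂ,
      (∀ i, (X i)ᴴ * X i = 1) ∧
      (∑ i : Fin K, ∑ j : Fin K, if j ≠ i then
          (((1 - (X i)ᴴ * X j * (X j)ᴴ * X i).det).re)⁻¹ ^ N else 0)
        ≤ K * (K - 1) * C ∧
      (∀ i j, i ≠ j → 0 < ((1 - (X i)ᴴ * X j * (X j)ᴴ * X i).det).re) := by
  induction K with
  | zero => exact ⟨fun i => i.elim0, fun i => i.elim0, by simp, fun i => i.elim0⟩
  | succ K ih =>
    obtain ⟨X, h1, h2, h3⟩ := ih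
    obtain ⟨Z, r, g1, g2, g3, g4⟩ := exists_next (N := N) X h1 hTM M le_rfl
    rw [← hC, Fintype.card_fin] at g4
    have g5 : ∀ j, (1 - Zᴴ * X j * (X j)ᴴ * Z).det = ((r j : ℝ) : ℂ) := fun j => by
      rw [← g3 j]
      congr 1
      simp only [Matrix.mul_sub, Matrix.sub_mul, Matrix.mul_one, g1, Matrix.mul_assoc]
    have g6 : ∀ j, (1 - (X j)ᴴ * Z * Zᴴ * (X j)).det = ((r j : ℝ) : ℂ) := fun j => by
      rw [chordal_symm, g5]
    refine ⟨Fin.cons Z X, ?_, ?_, ?_⟩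
    · intro i
      refine Fin.cases ?_ (fun i => ?_) i
      · simpa using g1
      · simpa using h1 i
    · have e : (∑ i : Fin (K + 1), ∑ j : Fin (K + 1), if j ≠ i then
          (((1 - ((Fin.cons Z X : Fin (K + 1) → Matrix (Fin T) (Fin M) ℂ) i)ᴴ *
            (Fin.cons Z X : Fin (K + 1) → Matrix (Fin T) (Fin M) ℂ) j *
            ((Fin.cons Z X : Fin (K + 1) → Matrix (Fin T) (Fin M) ℂ) j)ᴴ *
            (Fin.cons Z X : Fin (K + 1) → Matrix (Fin T) (Fin M) ℂ) i).det).re)⁻¹ ^ N else 0) =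
          2 * ∑ j, (r j)⁻¹ ^ N + (∑ i : Fin K, ∑ j : Fin K, if j ≠ i then
          (((1 - (X i)ᴴ * X j * (X j)ᴴ * X i).det).re)⁻¹ ^ N else 0) := by
        simp only [Fin.sum_univ_succ, Fin.cons_zero, Fin.cons_succ, ne_eq, not_true_eq_false,
          if_false, zero_add, Fin.succ_ne_zero, not_false_eq_true, if_true, Fin.succ_inj,
          (Fin.succ_ne_zero _).symm, Finset.sum_add_distrib, g5, g6, Complex.ofReal_re]
        ring
      rw [e]
      push_cast
      nlinarith
    · intro i j
      refine Fin.cases ?_ (fun i => ?_) i <;> refine Fin.cases ?_ (fun j => ?_) j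
      · simp
      · intro _
        simp only [Fin.cons_zero, Fin.cons_succ, g5, Complex.ofReal_re]
        exact g2 j
      · intro _
        simp only [Fin.cons_zero, Fin.cons_succ, g6, Complex.ofReal_re]
        exact g2 i
      · intro hij
        simp only [Fin.cons_succ]
        exact h3 i j (fun h => hij (by rw [h]))

theorem exists_code_with_small_energy
    (T M N K : ℕ) (hT : 0 < T) (hM : 0 < M) (hN : 0 < N) (hK : 2 ≤ K)
    (hTM : 2 * M ≤ T) (hNT : N ≤ T - 2 * M) :
    ∃ X : Fin K → Matrix (Fin T) (Fin M) ℂ,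
      (∀ i, (X i)ᴴ * X i = 1) ∧
      (∑ i : Fin K, ∑ j ∈ Finset.univ.filter (fun j => j ≠ i),
          ((1 - (X i)ᴴ * X j * (X j)ᴴ * X i).det).re ^ (-(N : ℝ)))
        ≤ K * (K - 1) * ∏ m ∈ Finset.Icc 1 M,
            ((Nat.factorial (T - m) : ℝ) * (Nat.factorial (T - N - m - M) : ℝ)) /
              ((Nat.factorial (T - m - M) : ℝ) * (Nat.factorial (T - N - m) : ℝ)) ∧
      (∀ i j, i ≠ j → 0 < ((1 - (X i)ᴴ * X j * (X j)ᴴ * X i).det).re) := by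
  obtain ⟨X, h1, h2, h3⟩ := exists_code_aux T M N (by omega) _ rfl K
  refine ⟨X, h1, le_trans (le_of_eq ?_) h2, h3⟩
  refine Finset.sum_congr rfl fun i _ => ?_
  rw [Finset.sum_filter]
  refine Finset.sum_congr rfl fun j _ => ?_
  split_ifs with hij
  · rw [Real.rpow_neg (h3 i j (Ne.symm hij)).le, Real.rpow_natCast, inv_pow]
  · rfl
end
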